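/- arXiv:1605.03356 — 18 statements merged into one kernel-verified Lean document; each statement's English description precedes it below -/
import Mathlib

section
/- Let l ≥ 2 and let C ⊆ A^l be an A-code. Let g_{1,1}, g_{1,2}, …, g_{1,l} ∈ F[x] with g_{1,1} monic and g_{1,1} ∣ f in F[x]; suppose the vector g^{(1)} = (ḡ_{1,1}, ḡ_{1,2}, …, ḡ_{1,l}) lies in C, and that every c ∈ C has first coordinate c_1 in the ideal of A generated by ḡ_{1,1}. Let C' = {(c_2, …, c_l) ∈ A^{l−1} : (0, c_2, …, c_l) ∈ C}, and suppose h'^{(2)}, …, h'^{(k)} ∈ A^{l−1}, with h'^{(i)} = (h'_{i,2}, …, h'_{i,l}), generate C'^⊥ as an A-module. Put h_{1,1} = f/g_{1,1}. Then: (a) for each i = 2, …, k there exists α_i ∈ A with α_i·ḡ_{1,1} = −Σ_{j=2}^l h'_{i,j}·ḡ_{1,j} in A; and (b) for any α_2, …, α_k ∈ A satisfying these equations, C^⊥ is generated as an A-module by the k vectors (h̄_{1,1}, 0, …, 0) and (α_i, h'_{i,2}, …, h'_{i,l}) for i = 2, …, k. -/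
open Polynomial

/-- The dual of a set of codewords of length `l` over `R`. -/
def dualSet {R : Type*} [CommRing R] {l : ℕ} (C : Set (Fin l → R)) : Set (Fin l → R) :=
  {a | ∀ c ∈ C, ∑ i, a i * c i = 0}

theorem mul_mk_eq_zero_iff_dvd {F : Type*} [Field F] {f g h : F[X]} (hf : f ≠ 0) (hgh : f = g * h)
    (x : AdjoinRoot f) : x * AdjoinRoot.mk f g = 0 ↔ AdjoinRoot.mk f h ∣ x := by
  have hg : g ≠ 0 := left_ne_zero_of_mul (hgh ▸ hf)
  constructor
  · obtain ⟨p, rfl⟩ := AdjoinRoot.mk_surjective x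
    intro hx
    rw [← map_mul, AdjoinRoot.mk_eq_zero, mul_comm p] at hx
    have hp : g * h ∣ g * p := hgh ▸ hx
    exact map_dvd _ ((mul_dvd_mul_iff_left hg).1 hp)
  · rintro ⟨y, rfl⟩
    rw [mul_right_comm, ← map_mul, mul_comm h, ← hgh, AdjoinRoot.mk_self, zero_mul]

section Dual

variable {R : Type*} [CommRing R] {n : ℕ}

theorem cons_mem_dualSet_iff {C : Set (Fin (n + 1) → R)} {x : R} {w : Fin n → R} :
    (Fin.cons x w : Fin (n + 1) → R) ∈ dualSet C ↔
      ∀ c ∈ C, x * c 0 + ∑ j, w j * c j.succ = 0 := by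
  simp [dualSet, Fin.sum_univ_succ]

/-- The dual of a code, as a submodule. -/
def dualSubmodule {l : ℕ} (C : Set (Fin l → R)) : Submodule R (Fin l → R) where
  carrier := dualSet C
  zero_mem' := fun c _ => by simp
  add_mem' := fun {a b} ha hb c hc => by
    simp only [Pi.add_apply, add_mul, Finset.sum_add_distrib, ha c hc, hb c hc, add_zero]
  smul_mem' := fun r a ha c hc => by
    simp only [Pi.smul_apply, smul_eq_mul, mul_assoc, ← Finset.mul_sum, ha c hc, mul_zero]

/-- The code obtained by shortening and puncturing at the first coordinate. -/
def shortened (Co : Submodule R (Fin (n + 1) → R)) : Set (Fin n → R) :=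
  {w | (Fin.cons 0 w : Fin (n + 1) → R) ∈ Co}

variable {Co : Submodule R (Fin (n + 1) → R)} {v : Fin (n + 1) → R} {h : R}

theorem exists_mul_eq_neg_sum (hv : v ∈ Co) (hvh : h * v 0 = 0)
    (hann : ∀ x, x * h = 0 → v 0 ∣ x) {w : Fin n → R} (hw : w ∈ dualSet (shortened Co)) :
    ∃ α, α * v 0 = -∑ j, w j * v j.succ := by
  have hmem : (fun j : Fin n => h * v j.succ) ∈ shortened Co := by
    have hcons : (Fin.cons 0 fun j : Fin n => h * v j.succ : Fin (n + 1) → R) = h • v := by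
      ext j
      cases j using Fin.cases <;> simp [hvh]
    simpa only [shortened, Set.mem_ofPred_eq, hcons] using Co.smul_mem h hv
  have hsum : (-∑ j, w j * v j.succ) * h = 0 := by
    rw [neg_mul, Finset.sum_mul, neg_eq_zero, ← hw _ hmem]
    exact Finset.sum_congr rfl fun j _ => by ring
  obtain ⟨α, hα⟩ := hann _ hsum
  exact ⟨α, by rw [hα, mul_comm]⟩

theorem cons_mem_dualSet (hv : v ∈ Co) (hfirst : ∀ c ∈ Co, v 0 ∣ c 0) {w : Fin n → R}
    (hw : w ∈ dualSet (shortened Co)) {α : R} (hα : α * v 0 = -∑ j, w j * v j.succ) :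
    (Fin.cons α w : Fin (n + 1) → R) ∈ dualSet (Co : Set (Fin (n + 1) → R)) := by
  refine cons_mem_dualSet_iff.2 fun c hc => ?_
  obtain ⟨b, hb⟩ := hfirst c hc
  have hmem : (fun j : Fin n => c j.succ - b * v j.succ) ∈ shortened Co := by
    have hcons : (Fin.cons 0 fun j : Fin n => c j.succ - b * v j.succ : Fin (n + 1) → R) =
        c - b • v := by
      ext j
      cases j using Fin.cases <;> simp [hb, mul_comm]
    simpa only [shortened, Set.mem_ofPred_eq, hcons] using Co.sub_mem hc (Co.smul_mem b hv)
  have hsum := hw _ hmem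
  simp only [mul_sub, Finset.sum_sub_distrib, mul_left_comm _ b, ← Finset.mul_sum] at hsum
  rw [hb]
  linear_combination hsum + b * hα

theorem tail_mem_dualSet_shortened {a : Fin (n + 1) → R}
    (ha : a ∈ dualSet (Co : Set (Fin (n + 1) → R))) :
    Fin.tail a ∈ dualSet (shortened Co) := by
  intro w hw
  simpa [Fin.sum_univ_succ, Fin.tail] using ha _ hw

theorem dualSet_eq_span {ι : Type*} [Fintype ι] (hv : v ∈ Co) (hfirst : ∀ c ∈ Co, v 0 ∣ c 0)
    (hann : ∀ x, x * v 0 = 0 ↔ h ∣ x) {w : ι → Fin n → R}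
    (hgen : (Submodule.span R (Set.range w) : Set (Fin n → R)) = dualSet (shortened Co))
    {α : ι → R} (hα : ∀ i, α i * v 0 = -∑ j, w i j * v j.succ) :
    dualSet (Co : Set (Fin (n + 1) → R)) =
      Submodule.span R (insert (Fin.cons h (0 : Fin n → R))
        (Set.range fun i => Fin.cons (α i) (w i)) : Set (Fin (n + 1) → R)) := by
  set S := Submodule.span R (insert (Fin.cons h (0 : Fin n → R))
    (Set.range fun i => Fin.cons (α i) (w i)) : Set (Fin (n + 1) → R))
  have hle : S ≤ dualSubmodule (Co : Set (Fin (n + 1) → R)) := by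
    refine Submodule.span_le.2 (Set.insert_subset ?_ (Set.range_subset_iff.2 fun i => ?_))
    · refine cons_mem_dualSet_iff.2 fun c hc => ?_
      obtain ⟨b, hb⟩ := hfirst c hc
      simp [hb, ← mul_assoc, (hann h).2 dvd_rfl]
    · exact cons_mem_dualSet hv hfirst (hgen ▸ Submodule.subset_span ⟨i, rfl⟩) (hα i)
  refine Set.Subset.antisymm (fun a ha => ?_) hle
  have htail : Fin.tail a ∈ Submodule.span R (Set.range w) := by
    rw [← SetLike.mem_coe, hgen]
    exact tail_mem_dualSet_shortened ha
  obtain ⟨r, hr⟩ := (Submodule.mem_span_range_iff_exists_fun R).1 htail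
  set b : Fin (n + 1) → R := ∑ i, r i • (Fin.cons (α i) (w i) : Fin (n + 1) → R) with hb
  have hbS : b ∈ S := Submodule.sum_mem _ fun i _ =>
    S.smul_mem _ (Submodule.subset_span (Or.inr ⟨i, rfl⟩))
  have hsucc (j : Fin n) : (a - b) j.succ = 0 := by
    have hj := congrFun hr j
    simp only [Finset.sum_apply, Pi.smul_apply, Fin.tail] at hj
    simp [hb, ← hj]
  have hdual : a - b ∈ dualSubmodule (Co : Set (Fin (n + 1) → R)) :=
    Submodule.sub_mem _ ha (hle hbS)
  have hzero : (a - b) 0 * v 0 = 0 := by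
    have hsum := hdual v hv
    rw [Fin.sum_univ_succ] at hsum
    simpa only [hsucc, zero_mul, Finset.sum_const_zero, add_zero] using hsum
  obtain ⟨s, hs⟩ := (hann _).1 hzero
  have hab : a - b = s • (Fin.cons h (0 : Fin n → R) : Fin (n + 1) → R) := by
    ext j
    cases j using Fin.cases with
    | zero => simpa [mul_comm] using hs
    | succ j => simpa using hsucc j
  have habS : a - b ∈ S := hab ▸ S.smul_mem s (Submodule.subset_span (Or.inl rfl))
  simpa using S.add_mem habS hbS

end Dual

/-- A generator matrix for the dual of an `A`-code (the corrected Theorem 3 of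
Berger–El Amrani).  Here the length is `l = n + 1 ≥ 2`, `g1 : Fin (n+1) → F[X]` gives the
vector `g⁽¹⁾ ∈ C` with `g1 0` monic dividing `f`, every element of `C` has first coordinate
in the ideal generated by `ḡ_{1,1}`, and the vectors `h' i` generate the dual of the
shortened-and-punctured code `C'`. -/
theorem dual_generators {F : Type*} [Field F] [Fintype F]
    (f : F[X]) (hf : f.Monic) (hm : 1 ≤ f.natDegree) (n : ℕ) (hn : 1 ≤ n)
    (Co : Submodule (AdjoinRoot f) (Fin (n + 1) → AdjoinRoot f))
    (g1 : Fin (n + 1) → F[X]) (hmonic : (g1 0).Monic) (hdvd : g1 0 ∣ f)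
    (hgC : (fun j => AdjoinRoot.mk f (g1 j)) ∈ Co)
    (hfirst : ∀ c ∈ Co, c 0 ∈ Ideal.span {AdjoinRoot.mk f (g1 0)})
    (k' : ℕ) (h' : Fin k' → Fin n → AdjoinRoot f)
    (hgen : (Submodule.span (AdjoinRoot f) (Set.range h') : Set (Fin n → AdjoinRoot f)) =
      dualSet {c' : Fin n → AdjoinRoot f | (Fin.cons 0 c' : Fin (n + 1) → AdjoinRoot f) ∈ Co}) :
    (∀ i : Fin k', ∃ α : AdjoinRoot f,
        α * AdjoinRoot.mk f (g1 0) = -∑ j : Fin n, h' i j * AdjoinRoot.mk f (g1 j.succ)) ∧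
    (∀ α : Fin k' → AdjoinRoot f,
      (∀ i : Fin k',
          α i * AdjoinRoot.mk f (g1 0) = -∑ j : Fin n, h' i j * AdjoinRoot.mk f (g1 j.succ)) →
      dualSet (Co : Set (Fin (n + 1) → AdjoinRoot f)) =
        ↑(Submodule.span (AdjoinRoot f)
          ((insert (Fin.cons (AdjoinRoot.mk f (f / g1 0)) (0 : Fin n → AdjoinRoot f))
            (Set.range fun i : Fin k' => Fin.cons (α i) (h' i))) :
              Set (Fin (n + 1) → AdjoinRoot f)))) := by
  have hfac : f = g1 0 * (f / g1 0) := (EuclideanDomain.mul_div_cancel' hmonic.ne_zero hdvd).symm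
  have hann := mul_mk_eq_zero_iff_dvd hf.ne_zero hfac
  have hann' := mul_mk_eq_zero_iff_dvd hf.ne_zero (hfac.trans (mul_comm _ _))
  refine ⟨fun i => ?_, fun α hα => ?_⟩
  · exact exists_mul_eq_neg_sum hgC ((hann _).2 dvd_rfl) (fun x => (hann' x).1)
      (hgen ▸ Submodule.subset_span ⟨i, rfl⟩ : h' i ∈ dualSet (shortened Co))
  · exact dualSet_eq_span hgC (fun c hc => Ideal.mem_span_singleton.1 (hfirst c hc)) hann hgen hα
end

section
/- Let g^{(1)}, …, g^{(k)} ∈ A^l be nonzero vectors whose entries are given by polynomials of degree < m. For each i let j_i be the least index j with g^{(i)}_j ≠ 0 and let g_{i,j_i} ∈ F[x] (of degree < m) represent that entry. Assume j_1 < j_2 < … < j_k, and that each g_{i,j_i} is monic and divides f in F[x]; set h_i = f/g_{i,j_i}. Let C be the A-span of g^{(1)}, …, g^{(k)}. Then the following are equivalent: (a) for every i = 1, …, k, the vector h̄_i·g^{(i)} lies in the A-span of g^{(i+1)}, …, g^{(k)}; (b) the dimension of C as an F-vector space equals Σ_{i=1}^k (m − deg g_{i,j_i}). -/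
open Polynomial

/-- Adjoining one generator `v` to a submodule `D` of a finite-dimensional `F[X]`-module: if every
polynomial carrying `v` into `D` is divisible by `h`, the dimension grows by at least `deg h`,
with equality exactly when `h` itself carries `v` into `D`. -/
theorem finrank_span_singleton_sup {F M : Type*} [Field F] [AddCommGroup M] [Module F[X] M]
    [Module F M] [IsScalarTower F F[X] M] [FiniteDimensional F M] {f : F[X]} (hf : f ≠ 0)
    (D : Submodule F[X] M) (v : M) (hfv : f • v ∈ D) (h : F[X])
    (hv : ∀ q : F[X], q • v ∈ D → h ∣ q) :
    Module.finrank F D + h.natDegree ≤ Module.finrank F ↥(F[X] ∙ v ⊔ D) ∧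
      (Module.finrank F ↥(F[X] ∙ v ⊔ D) = Module.finrank F D + h.natDegree ↔ h • v ∈ D) := by
  let φ : F[X] →ₗ[F[X]] M ⧸ D := LinearMap.toSpanSingleton F[X] (M ⧸ D) (D.mkQ v)
  have mem_ker (q : F[X]) : q ∈ LinearMap.ker φ ↔ q • v ∈ D := by
    rw [LinearMap.mem_ker, LinearMap.toSpanSingleton_apply, ← map_smul, ← LinearMap.mem_ker,
      Submodule.ker_mkQ]
  obtain ⟨u, hu⟩ := (IsPrincipalIdealRing.principal (LinearMap.ker φ)).principal
  have mem_iff (q : F[X]) : q • v ∈ D ↔ u ∣ q := by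
    rw [← mem_ker, hu]
    exact Ideal.mem_span_singleton
  have hu0 : u ≠ 0 := ne_zero_of_dvd_ne_zero hf ((mem_iff f).1 hfv)
  have hhu : h ∣ u := hv u ((mem_iff u).2 dvd_rfl)
  have hφ : Module.finrank F (LinearMap.range φ) = u.natDegree := by
    rw [← (φ.quotKerEquivRange.restrictScalars F).finrank_eq, hu]
    exact finrank_quotient_span_eq_natDegree
  have hmap : (F[X] ∙ v ⊔ D).map D.mkQ = LinearMap.range φ := by
    rw [Submodule.map_sup, Submodule.mkQ_map_self, sup_bot_eq, Submodule.map_span,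
      Set.image_singleton, LinearMap.range_toSpanSingleton]
  have hdim : Module.finrank F ↥(F[X] ∙ v ⊔ D) = Module.finrank F D + u.natDegree := by
    have key := ((D.mkQ.restrictScalars F).domRestrict
      ((F[X] ∙ v ⊔ D).restrictScalars F)).finrank_range_add_finrank_ker
    have hker : LinearMap.ker ((D.mkQ.restrictScalars F).domRestrict
        ((F[X] ∙ v ⊔ D).restrictScalars F)) =
        (D.restrictScalars F).submoduleOf ((F[X] ∙ v ⊔ D).restrictScalars F) := by
      ext x
      simp [Submodule.submoduleOf]
    have hrange : LinearMap.range ((D.mkQ.restrictScalars F).domRestrict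
        ((F[X] ∙ v ⊔ D).restrictScalars F)) = (LinearMap.range φ).restrictScalars F := by
      rw [LinearMap.range_domRestrict, ← hmap]
      rfl
    have hle : D.restrictScalars F ≤ (F[X] ∙ v ⊔ D).restrictScalars F :=
      fun _ hx => Submodule.mem_sup_right hx
    rw [hker, hrange, (Submodule.submoduleOfEquivOfLe hle).finrank_eq] at key
    change Module.finrank F (LinearMap.range φ) + Module.finrank F D =
      Module.finrank F ↥(F[X] ∙ v ⊔ D) at key
    omega
  rw [hdim, mem_iff]
  refine ⟨by simpa using natDegree_le_of_dvd hhu hu0, fun e => ?_, fun huh => ?_⟩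
  · exact (associated_of_dvd_of_natDegree_le hhu hu0 (by omega)).symm.dvd
  · rw [natDegree_eq_of_degree_eq (degree_eq_degree_of_associated (associated_of_dvd_dvd huh hhu))]

/-- Iteration of `finrank_span_singleton_sup` along a finite family of generators. -/
theorem finrank_span_range_eq_sum_natDegree_iff {F M : Type*} [Field F] [AddCommGroup M]
    [Module F[X] M] [Module F M] [IsScalarTower F F[X] M] [FiniteDimensional F M]
    {f : F[X]} (hf : f ≠ 0) (hfM : ∀ x : M, f • x = 0) {k : ℕ} (v : Fin k → M) (h : Fin k → F[X])
    (hv : ∀ i, ∀ q : F[X], q • v i ∈ Submodule.span F[X] {x | ∃ t, i < t ∧ x = v t} → h i ∣ q) :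
    ∑ i, (h i).natDegree ≤ Module.finrank F (Submodule.span F[X] (Set.range v)) ∧
      (Module.finrank F (Submodule.span F[X] (Set.range v)) = ∑ i, (h i).natDegree ↔
        ∀ i, h i • v i ∈ Submodule.span F[X] {x | ∃ t, i < t ∧ x = v t}) := by
  induction k with
  | zero =>
    have hbot : Submodule.span F[X] (Set.range v) = ⊥ := by simp
    rw [hbot]
    have hfin : Module.finrank F (⊥ : Submodule F[X] M) = 0 := Module.finrank_zero_of_subsingleton
    simp [hfin]
  | succ k ih =>
    have later_zero : {x | ∃ t, (0 : Fin (k + 1)) < t ∧ x = v t} =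
        Set.range fun i : Fin k => v i.succ := by
      ext x
      simp [Fin.exists_fin_succ, eq_comm]
    have later_succ (i : Fin k) : {x | ∃ t, i.succ < t ∧ x = v t} =
        {x | ∃ t, i < t ∧ x = v t.succ} := by
      ext x
      simp [Fin.exists_fin_succ]
    have hrange : Submodule.span F[X] (Set.range v) =
        F[X] ∙ v 0 ⊔ Submodule.span F[X] (Set.range fun i : Fin k => v i.succ) := by
      rw [← Submodule.span_union]
      congr 1
      ext x
      simp [Fin.exists_fin_succ, eq_comm]
    have tail := ih (fun i => v i.succ) (fun i => h i.succ)
      fun i q hq => hv i.succ q (by rwa [later_succ])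
    have head := finrank_span_singleton_sup hf
      (Submodule.span F[X] (Set.range fun i : Fin k => v i.succ)) (v 0)
      (by simp [hfM]) (h 0) fun q hq => hv 0 q (by rwa [later_zero])
    rw [hrange]
    simp only [Fin.forall_fin_succ, later_zero, later_succ, Fin.sum_univ_succ, ← head.2, ← tail.2]
    omega

/-- Characterization of bases of divisors: for vectors `g⁽¹⁾, …, g⁽ᵏ⁾` in echelon form whose
monic leading coefficients divide `f`, condition (iii) (each `h̄ᵢ • g⁽ⁱ⁾` lies in the span of
the later vectors) is equivalent to condition (iii′) (the `F`-dimension of the generated code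
is `∑ (m − deg g_{i,jᵢ})`). -/
theorem basis_of_divisors_characterization {F : Type*} [Field F] [Fintype F]
    (f : F[X]) (hf : f.Monic) (hm : 1 ≤ f.natDegree)
    (k l : ℕ) (P : Fin k → Fin l → F[X])
    (hdeg : ∀ i j, (P i j).degree < (f.natDegree : WithBot ℕ))
    (g : Fin k → Fin l → AdjoinRoot f) (hg : ∀ i j, g i j = AdjoinRoot.mk f (P i j))
    (j : Fin k → Fin l)
    (hlead : ∀ i, g i (j i) ≠ 0) (hmin : ∀ i t, t < j i → g i t = 0)
    (hechelon : StrictMono j)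
    (hmonic : ∀ i, (P i (j i)).Monic) (hdvd : ∀ i, P i (j i) ∣ f) :
    (∀ i : Fin k, (AdjoinRoot.mk f (f / P i (j i))) • g i ∈
        Submodule.span (AdjoinRoot f) {v : Fin l → AdjoinRoot f | ∃ t, i < t ∧ v = g t}) ↔
      Module.finrank F
          ((Submodule.span (AdjoinRoot f) (Set.range g)).restrictScalars F) =
        ∑ i : Fin k, (f.natDegree - (P i (j i)).natDegree) := by
  have hPf (i : Fin k) : P i (j i) * (f / P i (j i)) = f :=
    EuclideanDomain.mul_div_cancel' (hmonic i).ne_zero (hdvd i)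
  have hnat (i : Fin k) : (f / P i (j i)).natDegree = f.natDegree - (P i (j i)).natDegree := by
    have hq : f / P i (j i) ≠ 0 := right_ne_zero_of_mul ((hPf i).symm ▸ hf.ne_zero)
    have hmul := natDegree_mul (hmonic i).ne_zero hq
    rw [hPf] at hmul
    omega
  let : Algebra F[X] (AdjoinRoot f) := (AdjoinRoot.mk f).toAlgebra
  have : IsScalarTower F F[X] (AdjoinRoot f) := IsScalarTower.of_algebraMap_eq fun _ => rfl
  have hspan (S : Set (Fin l → AdjoinRoot f)) : Submodule.span F[X] S =
      (Submodule.span (AdjoinRoot f) S).restrictScalars F[X] :=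
    (Submodule.restrictScalars_span F[X] (AdjoinRoot f) AdjoinRoot.mk_surjective S).symm
  have := hf.finite_adjoinRoot
  have key := (finrank_span_range_eq_sum_natDegree_iff (F := F) hf.ne_zero (fun x => ?_) g
    (fun i => f / P i (j i)) fun i q hq => ?_).2
  · simp only [hnat] at key
    rw [hspan] at key
    simp only [hspan] at key
    exact key.symm
  · ext t
    change AdjoinRoot.mk f f * x t = 0
    rw [AdjoinRoot.mk_self, zero_mul]
  · have hle : Submodule.span F[X] {x | ∃ t, i < t ∧ x = g t} ≤
        LinearMap.ker (LinearMap.proj (R := F[X]) (φ := fun _ => AdjoinRoot f) (j i)) := by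
      rw [Submodule.span_le]
      rintro _ ⟨t, hit, rfl⟩
      exact hmin t _ (hechelon hit)
    have hzero : AdjoinRoot.mk f (P i (j i) * q) = 0 := by
      have hcoord : q • g i (j i) = 0 := hle hq
      rw [hg, Algebra.smul_def] at hcoord
      rw [mul_comm, map_mul]
      exact hcoord
    rw [AdjoinRoot.mk_eq_zero] at hzero
    exact (mul_dvd_mul_iff_left (hmonic i).ne_zero).1 (by rwa [hPf])
end

section
/- Suppose g = (ḡ_1, …, ḡ_l) ∈ A^l is a one-element basis of divisors and let C = A·g be the A-code it generates. Then C is self-dual if and only if either (i) l = 1 and f = g_1² in F[x], or (ii) l = 2, g_1 = 1, and ḡ_2² = −1 in A. -/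
open Polynomial

/-- The span of `v` equals its dual iff every word is a multiple of `v` exactly when it is
orthogonal to `v`. -/
theorem span_singleton_eq_dualSet_iff {R : Type*} [CommRing R] {l : ℕ} (v : Fin l → R) :
    ((Submodule.span R {v} : Set (Fin l → R)) =
        dualSet (Submodule.span R {v} : Set (Fin l → R))) ↔
      ∀ a : Fin l → R, (∃ r, ∀ i, r * v i = a i) ↔ ∑ i, a i * v i = 0 := by
  rw [Set.ext_iff]
  refine forall_congr' fun a => iff_congr ?_ ?_
  · rw [SetLike.mem_coe, Submodule.mem_span_singleton]
    exact exists_congr fun r => funext_iff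
  · constructor
    · intro h
      exact h v (Submodule.mem_span_singleton_self v)
    · intro h c hc
      obtain ⟨r, rfl⟩ := Submodule.mem_span_singleton.1 hc
      simp only [Pi.smul_apply, smul_eq_mul, mul_left_comm _ r, ← Finset.mul_sum, h, mul_zero]

/-- In a self-dual code generated by `v` with `v i = 1`, every other coordinate squares to `-1`,
and the remaining coordinates multiply to zero. -/
theorem sq_eq_neg_one_of_selfDual {R : Type*} [CommRing R] {l : ℕ} {v : Fin l → R}
    (hC : ∀ a : Fin l → R, (∃ r, ∀ i, r * v i = a i) ↔ ∑ i, a i * v i = 0)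
    {i j : Fin l} (hi : v i = 1) (hij : j ≠ i) :
    v j ^ 2 = -1 ∧ ∀ k, k ≠ i → k ≠ j → v j * v k = 0 := by
  obtain ⟨r, hr⟩ := (hC (Pi.single j 1 - Pi.single i (v j))).2 (by
    simp [sub_mul, Finset.sum_sub_distrib, Pi.single_apply, hi])
  have hri : r = -v j := by simpa [hi, Pi.single_apply, hij.symm] using hr i
  subst hri
  refine ⟨?_, fun k hki hkj => ?_⟩
  · have := hr j
    simp only [Pi.sub_apply, Pi.single_eq_same, Pi.single_eq_of_ne hij] at this
    linear_combination -this
  · have := hr k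
    simp only [Pi.sub_apply, Pi.single_eq_of_ne hki, Pi.single_eq_of_ne hkj] at this
    linear_combination -this

/-- A code generated by a one-element basis of divisors `g = (ḡ₀, …, ḡ_{l-1})` is self-dual
iff either `l = 1` and `f = g₀²` in `F[x]`, or `l = 2`, `g₀ = 1` and `ḡ₁² = -1` in `A`. -/
theorem selfDual_of_single_basis {F : Type*} [Field F] [Fintype F]
    (f : F[X]) (hf : f.Monic) (hm : 1 ≤ f.natDegree)
    (l : ℕ) (g : ℕ → F[X])
    (hdeg : ∀ i < l, (g i).degree < (f.natDegree : WithBot ℕ))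
    (i₀ : ℕ) (hi₀ : i₀ < l) (hne : g i₀ ≠ 0) (hminimal : ∀ t < i₀, g t = 0)
    (hmonic : (g i₀).Monic) (hdvd : g i₀ ∣ f)
    (hbasis : ∀ i : Fin l, AdjoinRoot.mk f (f / g i₀) * AdjoinRoot.mk f (g i) = 0) :
    ((Submodule.span (AdjoinRoot f)
        {fun i : Fin l => AdjoinRoot.mk f (g i)} : Set (Fin l → AdjoinRoot f)) =
      dualSet (Submodule.span (AdjoinRoot f)
        {fun i : Fin l => AdjoinRoot.mk f (g i)} : Set (Fin l → AdjoinRoot f))) ↔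
    ((l = 1 ∧ f = g 0 ^ 2) ∨
      (l = 2 ∧ g 0 = 1 ∧ (AdjoinRoot.mk f (g 1)) ^ 2 = -1)) := by
  rw [span_singleton_eq_dualSet_iff]
  have hf0 : f ≠ 0 := hf.ne_zero
  have : Nontrivial (AdjoinRoot f) := AdjoinRoot.nontrivial f (by
    rw [degree_eq_natDegree hf0]
    exact_mod_cast (by omega : f.natDegree ≠ 0))
  constructor
  · intro hC
    obtain ⟨h, hfh⟩ := hdvd
    have hquot : f / g i₀ = h := by
      conv_lhs => rw [hfh]
      exact mul_div_cancel_left₀ h hne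
    rw [hquot] at hbasis
    have hhmonic : h.Monic := Monic.of_mul_monic_left hmonic (hfh ▸ hf)
    have hh0 := hhmonic.ne_zero
    have hmult (j : Fin l) : ∃ r, ∀ i : Fin l, r * AdjoinRoot.mk f (g i) =
        (Pi.single j (AdjoinRoot.mk f h) : Fin l → AdjoinRoot f) i :=
      (hC _).2 (by simp [Pi.single_apply, hbasis])
    rcases (by omega : l = 1 ∨ 2 ≤ l) with rfl | hl
    · left
      obtain rfl : i₀ = 0 := by omega
      refine ⟨rfl, ?_⟩
      have h1 : h ∣ g 0 := by
        have hself := (hC fun i => AdjoinRoot.mk f (g i)).1 ⟨1, fun i => one_mul _⟩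
        simp only [Finset.univ_unique, Finset.sum_singleton, Fin.default_eq_zero,
          Fin.val_zero, ← map_mul, AdjoinRoot.mk_eq_zero] at hself
        rw [hfh] at hself
        exact (mul_dvd_mul_iff_left hne).1 hself
      have h2 : g 0 ∣ h := by
        obtain ⟨r, hr⟩ := hmult 0
        obtain ⟨p, rfl⟩ := AdjoinRoot.mk_surjective r
        have hr0 := hr 0
        rw [Pi.single_eq_same, ← map_mul, AdjoinRoot.mk_eq_mk] at hr0
        exact (dvd_sub_right (Dvd.intro_left p rfl)).1 ((Dvd.intro h hfh.symm).trans hr0)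
      have heq : h = g 0 :=
        eq_of_monic_of_associated hhmonic hmonic (associated_of_dvd_dvd h1 h2)
      rw [hfh, heq, sq]
    · right
      have hone : g i₀ = 1 := by
        obtain ⟨j, hj⟩ : ∃ j : Fin l, j ≠ ⟨i₀, hi₀⟩ :=
          haveI : Nontrivial (Fin l) := Fin.nontrivial_iff_two_le.2 hl
          exists_ne _
        obtain ⟨r, hr⟩ := hmult j
        obtain ⟨p, rfl⟩ := AdjoinRoot.mk_surjective r
        have hz := hr ⟨i₀, hi₀⟩
        rw [Pi.single_eq_of_ne hj.symm, ← map_mul, AdjoinRoot.mk_eq_zero, hfh,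
          mul_comm p] at hz
        obtain ⟨s, rfl⟩ := (mul_dvd_mul_iff_left hne).1 hz
        have hzj := hr j
        rw [Pi.single_eq_same, map_mul, mul_right_comm, hbasis j, zero_mul, eq_comm,
          AdjoinRoot.mk_eq_zero, hfh] at hzj
        have hunit : g i₀ ∣ 1 := (mul_dvd_mul_iff_right hh0).1 (by rwa [one_mul])
        exact hmonic.eq_one_of_isUnit (isUnit_of_dvd_one hunit)
      have hv : AdjoinRoot.mk f (g (⟨i₀, hi₀⟩ : Fin l)) = 1 := by simp [hone]
      have key (j : Fin l) (hj : j ≠ ⟨i₀, hi₀⟩) := sq_eq_neg_one_of_selfDual hC hv hj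
      obtain rfl : i₀ = 0 := by
        by_contra h0
        have hsq := (key ⟨0, by omega⟩ (by simpa [Fin.ext_iff] using Ne.symm h0)).1
        simp [hminimal 0 (by omega)] at hsq
      have k1 := key ⟨1, by omega⟩ (by simp [Fin.ext_iff])
      have hl2 : l = 2 := by
        by_contra h2
        have hmul := k1.2 ⟨2, by omega⟩ (by simp [Fin.ext_iff]) (by simp [Fin.ext_iff])
        have k2 := (key ⟨2, by omega⟩ (by simp [Fin.ext_iff])).1
        have hsq := congrArg (· ^ 2) hmul
        simp only [mul_pow, k1.1, k2] at hsq
        simp at hsq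
      exact ⟨hl2, hone, k1.1⟩
  · rintro (⟨rfl, hsq⟩ | ⟨rfl, h1, hsq⟩) a
    · obtain rfl : i₀ = 0 := by omega
      have hz : AdjoinRoot.mk f (g 0) * AdjoinRoot.mk f (g 0) = 0 := by
        rw [← map_mul, AdjoinRoot.mk_eq_zero, ← sq, ← hsq]
      simp only [Finset.univ_unique, Finset.sum_singleton, Fin.default_eq_zero, Fin.val_zero,
        Fin.forall_fin_one]
      constructor
      · rintro ⟨r, hr⟩
        rw [← hr, mul_assoc, hz, mul_zero]
      · intro ha
        obtain ⟨p, hp⟩ := AdjoinRoot.mk_surjective (a 0)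
        rw [← hp, ← map_mul, AdjoinRoot.mk_eq_zero] at ha
        have hdp : g 0 * g 0 ∣ p * g 0 := by rwa [← sq, ← hsq]
        obtain ⟨s, rfl⟩ := (mul_dvd_mul_iff_right hne).1 hdp
        exact ⟨AdjoinRoot.mk f s, by rw [← hp, map_mul, mul_comm]⟩
    · simp only [Fin.sum_univ_two, Fin.forall_fin_two, Fin.val_zero, Fin.val_one, h1, map_one,
        mul_one]
      constructor
      · rintro ⟨r, hr0, hr1⟩
        rw [← hr0, ← hr1]
        linear_combination r * hsq
      · intro ha
        exact ⟨a 0, rfl, by linear_combination AdjoinRoot.mk f (g 1) * ha - a 1 * hsq⟩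
end

section
/- Suppose g = (ḡ_1, …, ḡ_l) ∈ A^l is a one-element basis of divisors and let C = A·g be the A-code it generates. Then C = C^{⊥R} if and only if one of the following holds: (i) l = 1 and f = g_1² in F[x]; (ii) l = 2, g_1 = 0 and g_2 = 1; (iii) l = 2, g_1 = 1 and g_2 = 0; (iv) l = 2, char F = 2, g_1 = 1 and g_2 is arbitrary. -/
open Polynomial

/-- The reverse (reciprocal) of a set of codewords: `Sᴿ = {(c_l, …, c_1) : c ∈ S}`. -/
def revSet {R : Type*} {l : ℕ} (S : Set (Fin l → R)) : Set (Fin l → R) :=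
  (fun c => fun i => c (Fin.rev i)) '' S

theorem mem_revSet_dualSet_span_singleton {R : Type*} [CommRing R] {l : ℕ} (w v : Fin l → R) :
    v ∈ revSet (dualSet (Submodule.span R {w} : Set (Fin l → R))) ↔
      ∑ i, v (Fin.rev i) * w i = 0 := by
  constructor
  · rintro ⟨a, ha, rfl⟩
    simpa using ha w (Submodule.mem_span_singleton_self w)
  · intro h
    refine ⟨fun i => v (Fin.rev i), ?_, by simp⟩
    intro c hc
    obtain ⟨r, rfl⟩ := Submodule.mem_span_singleton.1 hc
    have hr : ∑ i, v (Fin.rev i) * (r • w) i = r * ∑ i, v (Fin.rev i) * w i := by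
      rw [Finset.mul_sum]
      refine Finset.sum_congr rfl fun i _ => ?_
      simp only [Pi.smul_apply, smul_eq_mul]
      ring
    rw [hr, h, mul_zero]

theorem span_singleton_eq_revSet_dualSet_iff {R : Type*} [CommRing R] {l : ℕ} (w : Fin l → R) :
    (Submodule.span R {w} : Set (Fin l → R)) =
        revSet (dualSet (Submodule.span R {w} : Set (Fin l → R))) ↔
      ∀ v : Fin l → R, (∃ a : R, ∀ i, a * w i = v i) ↔ ∑ i, v (Fin.rev i) * w i = 0 := by
  simp only [Set.ext_iff, mem_revSet_dualSet_span_singleton, SetLike.mem_coe,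
    Submodule.mem_span_singleton, funext_iff, Pi.smul_apply, smul_eq_mul]

/-- If one entry of a generator divides all the others, and the generated code contains its
reciprocal dual, then for every other position some multiple of the generator is the reverse of
`e_i - k e_{i₀}`. -/
theorem exists_mul_eq_single {R : Type*} [CommRing R] {l : ℕ} {w : Fin l → R}
    (h : ∀ v : Fin l → R, ∑ i, v (Fin.rev i) * w i = 0 → ∃ a : R, ∀ i, a * w i = v i)
    {i₀ : Fin l} (hw : ∀ i, w i₀ ∣ w i) {i : Fin l} (hi : i ≠ i₀) :
    ∃ a : R, a * w (Fin.rev i) = 1 ∧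
      ∀ j, j ≠ i → j ≠ i₀ → a * w (Fin.rev j) = 0 := by
  obtain ⟨k, hk⟩ := hw i
  obtain ⟨a, ha⟩ := h
    (fun j => (Pi.single i 1 - Pi.single i₀ k : Fin l → R) (Fin.rev j)) (by
      simp [sub_mul, Finset.sum_sub_distrib, Pi.single_apply, hk, mul_comm k])
  refine ⟨a, ?_, fun j hj hj₀ => ?_⟩
  · simpa [hi] using ha (Fin.rev i)
  · simpa [hj, hj₀] using ha (Fin.rev j)

theorem length_le_two_of_reciprocalDual_le {R : Type*} [CommRing R] [Nontrivial R] {l : ℕ}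
    {w : Fin l → R}
    (h : ∀ v : Fin l → R, ∑ i, v (Fin.rev i) * w i = 0 → ∃ a : R, ∀ i, a * w i = v i)
    {i₀ : Fin l} (hw : ∀ i, w i₀ ∣ w i) : l ≤ 2 := by
  by_contra! hl
  obtain ⟨i, hi, j, hj, hij⟩ : ∃ i, i ≠ i₀ ∧ ∃ j, j ≠ i₀ ∧ i ≠ j := by
    have hcard : 1 < (Finset.univ.erase i₀).card := by
      rw [Finset.card_erase_of_mem (Finset.mem_univ _), Finset.card_univ, Fintype.card_fin]
      omega
    obtain ⟨i, hi, j, hj, hij⟩ := Finset.one_lt_card.1 hcard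
    exact ⟨i, Finset.ne_of_mem_erase hi, j, Finset.ne_of_mem_erase hj, hij⟩
  obtain ⟨a, ha, ha'⟩ := exists_mul_eq_single h hw hi
  obtain ⟨b, hb, -⟩ := exists_mul_eq_single h hw hj
  have haj := ha' j hij.symm hj
  apply one_ne_zero (α := R)
  calc (1 : R) = (a * w (Fin.rev i)) * (b * w (Fin.rev j)) := by rw [ha, hb, one_mul]
    _ = (a * w (Fin.rev j)) * (b * w (Fin.rev i)) := by ring
    _ = 0 := by rw [haj, zero_mul]

theorem isUnit_of_reciprocalDual_le {R : Type*} [CommRing R] {l : ℕ} {w : Fin l → R}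
    (h : ∀ v : Fin l → R, ∑ i, v (Fin.rev i) * w i = 0 → ∃ a : R, ∀ i, a * w i = v i)
    {i₀ : Fin l} (hw : ∀ i, w i₀ ∣ w i) (hl : 2 ≤ l) : IsUnit (w i₀) := by
  have : Nontrivial (Fin l) := Fin.nontrivial_iff_two_le.2 hl
  obtain ⟨i, hi⟩ := exists_ne i₀
  obtain ⟨a, ha, -⟩ := exists_mul_eq_single h hw hi
  exact isUnit_of_dvd_one (ha.subst (motive := (w i₀ ∣ ·)) ((hw _).mul_left a))

theorem AdjoinRoot.mk_dvd_mk_iff {R : Type*} [CommRing R] {f p q : R[X]} (hp : p ∣ f) :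
    AdjoinRoot.mk f p ∣ AdjoinRoot.mk f q ↔ p ∣ q := by
  refine ⟨?_, map_dvd _⟩
  rintro ⟨a, ha⟩
  obtain ⟨r, rfl⟩ := AdjoinRoot.mk_surjective a
  rw [← map_mul, AdjoinRoot.mk_eq_mk] at ha
  exact (dvd_sub_left (dvd_mul_right p r)).1 (hp.trans ha)

theorem AdjoinRoot.mk_eq_zero_iff_of_degree_lt {F : Type*} [Field F] {f p : F[X]}
    (hp : p.degree < (f.natDegree : WithBot ℕ)) : AdjoinRoot.mk f p = 0 ↔ p = 0 := by
  rw [AdjoinRoot.mk_eq_zero]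
  refine ⟨fun h => ?_, fun h => h ▸ dvd_zero f⟩
  by_cases hf : f = 0
  · simpa [hf] using h
  · exact Polynomial.eq_zero_of_dvd_of_degree_lt h
      (Polynomial.degree_eq_natDegree hf ▸ hp)

theorem Polynomial.ringChar_eq_two_or_eq_zero_of_two_mul_eq_zero {F : Type*} [Field F] {p : F[X]}
    (h : 2 * p = 0) : ringChar F = 2 ∨ p = 0 := by
  rcases mul_eq_zero.1 h with h | h
  · left
    have h2 : (2 : F) = 0 := by
      apply Polynomial.C_injective
      rw [map_ofNat, h, map_zero]
    have : CharP F 2 := CharTwo.of_one_ne_zero_of_two_eq_zero one_ne_zero h2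
    exact ringChar.eq F 2 ▸ rfl
  · exact Or.inr h

/-- A code generated by a one-element basis of divisors equals its reciprocal dual `C^{⊥R}`
iff one of: `l = 1` and `f = g₀²`; `l = 2`, `g₀ = 0`, `g₁ = 1`; `l = 2`, `g₀ = 1`, `g₁ = 0`;
or `l = 2`, `char F = 2` and `g₀ = 1` (with `g₁` arbitrary). -/
theorem eq_reciprocalDual_of_single_basis {F : Type*} [Field F] [Fintype F]
    (f : F[X]) (hf : f.Monic) (hm : 1 ≤ f.natDegree)
    (l : ℕ) (g : ℕ → F[X])
    (hdeg : ∀ i < l, (g i).degree < (f.natDegree : WithBot ℕ))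
    (i₀ : ℕ) (hi₀ : i₀ < l) (hne : g i₀ ≠ 0) (hminimal : ∀ t < i₀, g t = 0)
    (hmonic : (g i₀).Monic) (hdvd : g i₀ ∣ f)
    (hbasis : ∀ i : Fin l, AdjoinRoot.mk f (f / g i₀) * AdjoinRoot.mk f (g i) = 0) :
    ((Submodule.span (AdjoinRoot f)
        {fun i : Fin l => AdjoinRoot.mk f (g i)} : Set (Fin l → AdjoinRoot f)) =
      revSet (dualSet (Submodule.span (AdjoinRoot f)
        {fun i : Fin l => AdjoinRoot.mk f (g i)} : Set (Fin l → AdjoinRoot f)))) ↔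
    ((l = 1 ∧ f = g 0 ^ 2) ∨
      (l = 2 ∧ g 0 = 0 ∧ g 1 = 1) ∨
      (l = 2 ∧ g 0 = 1 ∧ g 1 = 0) ∨
      (l = 2 ∧ ringChar F = 2 ∧ g 0 = 1)) := by
  rw [span_singleton_eq_revSet_dualSet_iff]
  have hf₁ : f.degree ≠ 0 := by
    rw [Polynomial.degree_eq_natDegree hf.ne_zero]
    exact_mod_cast (show f.natDegree ≠ 0 by omega)
  have : Nontrivial (AdjoinRoot f) := AdjoinRoot.nontrivial f hf₁
  obtain ⟨h, rfl⟩ := hdvd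
  rw [mul_div_cancel_left₀ h hne] at hbasis
  have hh : h.Monic := hmonic.of_mul_monic_left hf
  have hdvd_g : ∀ i : Fin l, g i₀ ∣ g i := by
    intro i
    have hi := hbasis i
    rw [← map_mul, AdjoinRoot.mk_eq_zero, mul_comm h] at hi
    exact (mul_dvd_mul_iff_right hh.ne_zero).1 hi
  constructor
  · intro H
    have Hle := fun v => (H v).2
    have hw : ∀ i : Fin l, AdjoinRoot.mk (g i₀ * h) (g (⟨i₀, hi₀⟩ : Fin l)) ∣
        AdjoinRoot.mk (g i₀ * h) (g i) := fun i => map_dvd _ (hdvd_g i)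
    have hl := length_le_two_of_reciprocalDual_le Hle hw
    have hself := (H fun i => AdjoinRoot.mk (g i₀ * h) (g i)).1 ⟨1, fun i => one_mul _⟩
    obtain rfl | rfl : l = 1 ∨ l = 2 := by omega
    · left
      obtain rfl : i₀ = 0 := by omega
      refine ⟨rfl, ?_⟩
      simp only [Finset.univ_unique, Fin.default_eq_zero, Finset.sum_singleton,
        Fin.val_zero, ← map_mul, AdjoinRoot.mk_eq_zero, Subsingleton.elim (Fin.rev 0) (0 : Fin 1),
        mul_dvd_mul_iff_left hne] at hself
      obtain ⟨a, ha⟩ := Hle (fun _ => AdjoinRoot.mk (g 0 * h) h) (by simpa using hbasis 0)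
      have hgh : g 0 ∣ h := (AdjoinRoot.mk_dvd_mk_iff (dvd_mul_right _ h)).1
        ⟨a, by simpa [mul_comm] using (ha 0).symm⟩
      rw [sq, ← Polynomial.eq_of_monic_of_associated hmonic hh (associated_of_dvd_dvd hgh hself)]
    · have hu := isUnit_of_reciprocalDual_le Hle hw le_rfl
      have hg : g i₀ = 1 := hmonic.eq_one_of_isUnit <| isUnit_of_dvd_one <|
        (AdjoinRoot.mk_dvd_mk_iff (dvd_mul_right _ h)).1 (by
          rw [map_one]; exact hu.dvd)
      right
      obtain rfl | rfl : i₀ = 1 ∨ i₀ = 0 := by omega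
      · exact Or.inl ⟨rfl, hminimal 0 one_pos, hg⟩
      · right
        have h2 : 2 * g 1 = 0 := by
          rw [← AdjoinRoot.mk_eq_zero_iff_of_degree_lt (f := g 0 * h)]
          · simpa [Fin.sum_univ_two, Fin.rev, hg, two_mul] using hself
          · have hC : (2 : F[X]) * g 1 = (2 : F) • g 1 := by
              rw [Polynomial.smul_eq_C_mul, map_ofNat]
            rw [hC]
            exact (Polynomial.degree_smul_le _ _).trans_lt (hdeg 1 one_lt_two)
        rcases Polynomial.ringChar_eq_two_or_eq_zero_of_two_mul_eq_zero h2 with h2 | h2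
        · exact Or.inr ⟨rfl, h2, hg⟩
        · exact Or.inl ⟨rfl, hg, h2⟩
  · rintro (⟨rfl, hfg⟩ | ⟨rfl, h0, h1⟩ | ⟨rfl, h0, h1⟩ | ⟨rfl, hchar, h0⟩) v
    · obtain rfl : i₀ = 0 := by omega
      rw [sq, mul_right_inj' hne] at hfg
      subst hfg
      obtain ⟨p, hp⟩ := AdjoinRoot.mk_surjective (v 0)
      simp only [Finset.univ_unique, Fin.default_eq_zero, Finset.sum_singleton,
        Fin.val_zero, Subsingleton.elim (Fin.rev 0) (0 : Fin 1), ← hp, ← map_mul,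
        AdjoinRoot.mk_eq_zero, mul_dvd_mul_iff_right hne, Fin.forall_fin_one]
      rw [← AdjoinRoot.mk_dvd_mk_iff (dvd_mul_right (g 0) (g 0))]
      simp only [dvd_iff_exists_eq_mul_left, eq_comm]
    · simp [Fin.sum_univ_two, Fin.rev, Fin.forall_fin_two, h0, h1, eq_comm]
    · simp [Fin.sum_univ_two, Fin.rev, Fin.forall_fin_two, h0, h1, eq_comm]
    · have : CharP F 2 := hchar ▸ ringChar.charP F
      have : CharP (AdjoinRoot (g i₀ * h)) 2 :=
        charP_of_injective_algebraMap (algebraMap F (AdjoinRoot (g i₀ * h))).injective 2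
      simp [Fin.sum_univ_two, Fin.rev, Fin.forall_fin_two, h0, CharTwo.add_eq_zero,
        eq_comm (b := v 1)]
end

section
/- Suppose g ∈ A^l is a one-element basis of divisors and let C = A·g. Then C is isodual — i.e., there exists a permutation σ of {1, …, l} such that C^⊥ = {(c_{σ(1)}, …, c_{σ(l)}) : (c_1, …, c_l) ∈ C} — if and only if l ≤ 2 and either C = C^⊥ or C = C^{⊥R}. -/
open Polynomial

theorem revSet_revSet {R : Type*} {l : ℕ} (S : Set (Fin l → R)) : revSet (revSet S) = S := by
  simp [revSet, Set.image_image]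

theorem Equiv.Perm.eq_one_or_eq_revPerm {l : ℕ} (hl : l ≤ 2) (σ : Equiv.Perm (Fin l)) :
    σ = 1 ∨ σ = Fin.revPerm := by
  revert σ
  interval_cases l <;> decide

/-- The dual of a code with one generator has at least `|R| ^ l / |R|` elements. -/
theorem card_pow_le_card_dualSet_span_singleton {R : Type*} [CommRing R] [Finite R] {l : ℕ}
    (v : Fin l → R) :
    Nat.card R ^ l ≤
      Nat.card (dualSet (Submodule.span R {v} : Set (Fin l → R))) * Nat.card R := by
  let φ : (Fin l → R) →ₗ[R] R := Fintype.linearCombination R v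
  have hker : (LinearMap.ker φ : Set (Fin l → R)) ⊆ dualSet (Submodule.span R {v}) := by
    intro a ha c hc
    obtain ⟨r, rfl⟩ := Submodule.mem_span_singleton.mp hc
    have ha' : ∑ i, a i * v i = 0 := by
      simpa [φ, Fintype.linearCombination_apply] using ha
    calc ∑ i, a i * (r • v) i = r * ∑ i, a i * v i := by
          rw [Finset.mul_sum]
          exact Finset.sum_congr rfl fun i _ => by simp [mul_left_comm]
      _ = 0 := by rw [ha', mul_zero]
  have hcard := Submodule.card_eq_card_quotient_mul_card (LinearMap.ker φ)
  rw [Nat.card_fun, Nat.card_fin] at hcard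
  rw [hcard]
  have hquot : Nat.card ((Fin l → R) ⧸ LinearMap.ker φ) ≤ Nat.card R := by
    rw [Nat.card_congr φ.quotKerEquivRange.toEquiv]
    exact Finite.card_subtype_le _
  have hle : Nat.card (LinearMap.ker φ) ≤
      Nat.card (dualSet (Submodule.span R {v} : Set (Fin l → R))) :=
    Nat.card_mono (Set.toFinite _) hker
  exact Nat.mul_le_mul hle hquot

theorem card_span_singleton_le {R M : Type*} [CommRing R] [Finite R] [AddCommGroup M]
    [Module R M] (v : M) : Nat.card (Submodule.span R {v}) ≤ Nat.card R := by
  rw [← LinearMap.range_toSpanSingleton]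
  exact Nat.card_le_card_of_surjective _ (LinearMap.toSpanSingleton R M v).surjective_rangeRestrict

theorem length_le_two_of_dualSet_span_singleton_eq {R : Type*} [CommRing R] [Finite R]
    [Nontrivial R] {l : ℕ} (v : Fin l → R) (σ : Equiv.Perm (Fin l))
    (h : dualSet (Submodule.span R {v} : Set (Fin l → R)) =
      (fun c : Fin l → R => fun i => c (σ i)) '' (Submodule.span R {v} : Set (Fin l → R))) :
    l ≤ 2 := by
  have h1 := card_pow_le_card_dualSet_span_singleton v
  have h2 : Nat.card (dualSet (Submodule.span R {v} : Set (Fin l → R))) ≤ Nat.card R := by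
    rw [h]
    exact (Nat.card_image_le (Set.toFinite _)).trans (card_span_singleton_le v)
  have h3 : Nat.card R ^ l ≤ Nat.card R ^ 2 := by
    rw [sq]
    exact h1.trans (Nat.mul_le_mul_right _ h2)
  exact (Nat.pow_le_pow_iff_right Finite.one_lt_card).mp h3

/-- A code generated by a one-element basis of divisors is isodual (its dual is a
permutation of it) iff `l ≤ 2` and either `C = C^⊥` or `C = C^{⊥R}`. -/
theorem isodual_of_single_basis {F : Type*} [Field F] [Fintype F]
    (f : F[X]) (hf : f.Monic) (hm : 1 ≤ f.natDegree)
    (l : ℕ) (g : ℕ → F[X])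
    (hdeg : ∀ i < l, (g i).degree < (f.natDegree : WithBot ℕ))
    (i₀ : ℕ) (hi₀ : i₀ < l) (hne : g i₀ ≠ 0) (hminimal : ∀ t < i₀, g t = 0)
    (hmonic : (g i₀).Monic) (hdvd : g i₀ ∣ f)
    (hbasis : ∀ i : Fin l, AdjoinRoot.mk f (f / g i₀) * AdjoinRoot.mk f (g i) = 0) :
    (∃ σ : Equiv.Perm (Fin l),
        dualSet (Submodule.span (AdjoinRoot f)
          {fun i : Fin l => AdjoinRoot.mk f (g i)} : Set (Fin l → AdjoinRoot f)) =
          (fun c : Fin l → AdjoinRoot f => fun i => c (σ i)) ''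
            (Submodule.span (AdjoinRoot f)
              {fun i : Fin l => AdjoinRoot.mk f (g i)} : Set (Fin l → AdjoinRoot f))) ↔
    (l ≤ 2 ∧
      (((Submodule.span (AdjoinRoot f)
          {fun i : Fin l => AdjoinRoot.mk f (g i)} : Set (Fin l → AdjoinRoot f)) =
        dualSet (Submodule.span (AdjoinRoot f)
          {fun i : Fin l => AdjoinRoot.mk f (g i)} : Set (Fin l → AdjoinRoot f))) ∨
       ((Submodule.span (AdjoinRoot f)
          {fun i : Fin l => AdjoinRoot.mk f (g i)} : Set (Fin l → AdjoinRoot f)) =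
        revSet (dualSet (Submodule.span (AdjoinRoot f)
          {fun i : Fin l => AdjoinRoot.mk f (g i)} : Set (Fin l → AdjoinRoot f)))))) := by
  have : Module.Finite F (AdjoinRoot f) := hf.finite_adjoinRoot
  have : Finite (AdjoinRoot f) := Module.finite_of_finite F
  have : Nontrivial (AdjoinRoot f) := AdjoinRoot.nontrivial f fun h => by
    exact (Nat.one_le_iff_ne_zero.mp hm) (natDegree_eq_of_degree_eq_some h)
  constructor
  · rintro ⟨σ, hσ⟩
    have hl := length_le_two_of_dualSet_span_singleton_eq _ σ hσ
    refine ⟨hl, ?_⟩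
    obtain rfl | rfl := σ.eq_one_or_eq_revPerm hl
    · left
      simpa using hσ.symm
    · right
      rw [hσ]
      exact (revSet_revSet _).symm
  · rintro ⟨-, h | h⟩
    · exact ⟨1, by simpa using h.symm⟩
    · refine ⟨Fin.revPerm, ?_⟩
      conv_rhs => rw [h]
      exact (revSet_revSet _).symm
end

section
/- Let C be the class III A-code of length 2 with canonical generator matrix [[ḡ_1, ḡ_2], [0, ḡ_3]]. Then C = C^{⊥R} if and only if g_1·g_3 = f in F[x] and, moreover, char F = 2 or g_2 = 0. -/
open Polynomial

/-- A word of length 2 lies in the reciprocal dual of the code spanned by `x` and `y` iff its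
reverse is orthogonal to both generators. -/
lemma mem_revSet_dualSet_span_pair {R : Type*} [CommRing R] (x y a : Fin 2 → R) :
    a ∈ revSet (dualSet (Submodule.span R {x, y} : Set (Fin 2 → R))) ↔
      a 1 * x 0 + a 0 * x 1 = 0 ∧ a 1 * y 0 + a 0 * y 1 = 0 := by
  constructor
  · rintro ⟨b, hb, rfl⟩
    have hx := hb x (Submodule.subset_span (by simp))
    have hy := hb y (Submodule.subset_span (by simp))
    simpa [Fin.sum_univ_two, Fin.rev] using And.intro hx hy
  · rintro ⟨hx, hy⟩
    refine ⟨fun i => a (Fin.rev i), fun c hc => ?_, funext fun i => by simp⟩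
    obtain ⟨u, v, rfl⟩ := Submodule.mem_span_pair.mp hc
    simp only [Fin.sum_univ_two, Pi.add_apply, Pi.smul_apply, smul_eq_mul]
    change a 1 * _ + a 0 * _ = 0
    linear_combination u * hx + v * hy

/-- Membership in the code with upper triangular generator matrix `[[p, q], [0, r]]`. -/
lemma mem_span_triangular_pair {R : Type*} [CommRing R] (p q r : R) (a : Fin 2 → R) :
    a ∈ Submodule.span R {![p, q], ![0, r]} ↔ ∃ u v, u * p = a 0 ∧ u * q + v * r = a 1 := by
  simp [Submodule.mem_span_pair, funext_iff, Fin.forall_fin_two]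

/-- A class III code of length 2 with CGM `[[ḡ₁, ḡ₂], [0, ḡ₃]]` equals its reciprocal dual
iff `g₁·g₃ = f` in `F[x]` and moreover `char F = 2` or `g₂ = 0`. -/
theorem classIII_eq_reciprocalDual_iff {F : Type*} [Field F] [Fintype F]
    (f : F[X]) (hf : f.Monic) (hm : 1 ≤ f.natDegree)
    (g₁ g₂ g₃ : F[X])
    (hd₁ : g₁.degree < (f.natDegree : WithBot ℕ))
    (hd₂ : g₂.degree < (f.natDegree : WithBot ℕ))
    (hd₃ : g₃.degree < (f.natDegree : WithBot ℕ))
    (hm₁ : g₁.Monic) (hm₃ : g₃.Monic) (hne₁ : g₁ ≠ 0)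
    (hdvd₁ : g₁ ∣ f) (hdvd₃ : g₃ ∣ f) (hdeg₂₃ : g₂.degree < g₃.degree)
    (hIII : AdjoinRoot.mk f (f / g₁) * AdjoinRoot.mk f g₂ ∈
      Ideal.span {AdjoinRoot.mk f g₃}) :
    ((Submodule.span (AdjoinRoot f)
        {![AdjoinRoot.mk f g₁, AdjoinRoot.mk f g₂], ![0, AdjoinRoot.mk f g₃]} :
          Set (Fin 2 → AdjoinRoot f)) =
      revSet (dualSet (Submodule.span (AdjoinRoot f)
        {![AdjoinRoot.mk f g₁, AdjoinRoot.mk f g₂], ![0, AdjoinRoot.mk f g₃]} :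
          Set (Fin 2 → AdjoinRoot f)))) ↔
    (g₁ * g₃ = f ∧ (ringChar F = 2 ∨ g₂ = 0)) := by
  obtain ⟨h, rfl⟩ := hdvd₁
  rw [mul_div_cancel_left₀ _ hne₁] at hIII
  have key : ringChar F = 2 ∨ g₂ = 0 ↔ 2 * g₂ = 0 := by
    rw [← C_ofNat, mul_eq_zero, C_eq_zero]
    refine or_congr_left ⟨fun hc => ?_, fun hc => ?_⟩
    · simpa [hc] using ringChar.Nat.cast_ringChar (R := F)
    · have hd : ringChar F ∣ 2 := ringChar.dvd (by simpa using hc)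
      exact ((Nat.dvd_prime Nat.prime_two).mp hd).resolve_left CharP.ringChar_ne_one
  rw [key, Set.ext_iff]
  simp only [SetLike.mem_coe, mem_span_triangular_pair, mem_revSet_dualSet_span_pair]
  simp only [Matrix.cons_val_zero, Matrix.cons_val_one, mul_zero, zero_add]
  constructor
  · intro H
    have hx := (H ![AdjoinRoot.mk _ g₁, AdjoinRoot.mk _ g₂]).mp ⟨1, 0, by simp, by simp⟩
    simp only [Matrix.cons_val_zero, Matrix.cons_val_one, ← map_mul, ← map_add,
      AdjoinRoot.mk_eq_zero] at hx
    obtain ⟨hx₁, hx₂⟩ := hx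
    have h_dvd : h ∣ g₃ := (mul_dvd_mul_iff_left hne₁).mp hx₂
    obtain ⟨u, v, hu, hv⟩ := (H ![0, AdjoinRoot.mk _ h]).mpr
      ⟨by simp [← map_mul, mul_comm h], by simp⟩
    obtain ⟨u, rfl⟩ := AdjoinRoot.mk_surjective u
    obtain ⟨v, rfl⟩ := AdjoinRoot.mk_surjective v
    simp only [Matrix.cons_val_zero, Matrix.cons_val_one, ← map_mul, ← map_add,
      AdjoinRoot.mk_eq_zero, AdjoinRoot.mk_eq_mk] at hu hv
    rw [mul_comm u, mul_dvd_mul_iff_left hne₁] at hu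
    obtain ⟨w, hw⟩ := Ideal.mem_span_singleton'.mp hIII
    obtain ⟨w, rfl⟩ := AdjoinRoot.mk_surjective w
    rw [← map_mul, ← map_mul, AdjoinRoot.mk_eq_mk] at hw
    have hg₂ : g₃ ∣ h * g₂ :=
      (dvd_sub_right (dvd_mul_left g₃ w)).mp (hdvd₃.trans hw)
    have dvd_h : g₃ ∣ h :=
      (dvd_sub_right (dvd_add (hg₂.trans (mul_dvd_mul_right hu g₂)) (dvd_mul_left g₃ v))).mp
        (hdvd₃.trans hv)
    have h_eq : g₃ = h :=
      eq_of_monic_of_associated hm₃ (hm₁.of_mul_monic_left hf)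
        (associated_of_dvd_dvd dvd_h h_dvd)
    refine ⟨by rw [h_eq], ?_⟩
    have h_two : g₃ ∣ 2 * g₂ := by
      rw [h_eq, ← mul_dvd_mul_iff_left hne₁]
      convert hx₁ using 1
      ring
    refine eq_zero_of_dvd_of_degree_lt h_two (lt_of_le_of_lt ?_ hdeg₂₃)
    rw [two_mul]
    exact (degree_add_le _ _).trans (max_self _).le
  · rintro ⟨h_eq, h_two⟩ a
    obtain rfl : g₃ = h := mul_left_cancel₀ hne₁ h_eq
    have h_two' : 2 * AdjoinRoot.mk (g₁ * g₃) g₂ = 0 := by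
      rw [two_mul, ← map_add, ← two_mul, h_two, map_zero]
    have h_prod : AdjoinRoot.mk (g₁ * g₃) g₁ * AdjoinRoot.mk (g₁ * g₃) g₃ = 0 := by
      rw [← map_mul, AdjoinRoot.mk_self]
    constructor
    · rintro ⟨u, v, h₀, h₁⟩
      rw [← h₀, ← h₁]
      exact ⟨by linear_combination u * AdjoinRoot.mk (g₁ * g₃) g₁ * h_two' + v * h_prod,
        by linear_combination u * h_prod⟩
    · rintro ⟨h₁, h₀⟩
      obtain ⟨p, hp⟩ := AdjoinRoot.mk_surjective (a 0)
      obtain ⟨q, hq⟩ := AdjoinRoot.mk_surjective (a 1)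
      rw [← hp, ← map_mul, AdjoinRoot.mk_eq_zero, mul_dvd_mul_iff_right hm₃.ne_zero] at h₀
      obtain ⟨u, rfl⟩ := h₀
      rw [← hp, ← hq, ← map_mul, ← map_mul, ← map_add, AdjoinRoot.mk_eq_zero,
        show q * g₁ + g₁ * u * g₂ = g₁ * (q + u * g₂) by ring,
        mul_dvd_mul_iff_left hne₁] at h₁
      obtain ⟨v, hv⟩ := h₁
      refine ⟨AdjoinRoot.mk _ u, AdjoinRoot.mk _ v, ?_, ?_⟩
      · rw [← hp, ← map_mul, mul_comm u]
      · rw [← hq, ← map_mul, ← map_mul, ← map_add]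
        congr 1
        linear_combination u * h_two - hv
end

section
/- Let C be the class III A-code of length 2 with canonical generator matrix [[ḡ_1, ḡ_2], [0, ḡ_3]]. Then C is self-dual if and only if all of the following hold: deg g_1 + deg g_3 = m; ḡ_3² = 0, ḡ_2·ḡ_3 = 0 and ḡ_1² + ḡ_2² = 0 in A; and g_1² divides f in F[x]. -/
open Polynomial

theorem mem_dualSet_span_pair {R : Type*} [CommRing R] (a b c x y : R) :
    ![x, y] ∈ dualSet (Submodule.span R {![a, b], ![0, c]} : Set (Fin 2 → R)) ↔
      x * a + y * b = 0 ∧ y * c = 0 := by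
  simp only [dualSet, Set.mem_ofPred_eq, SetLike.mem_coe, Fin.sum_univ_two]
  constructor
  · intro h
    have h₁ := h ![a, b] (Submodule.subset_span (by simp))
    have h₂ := h ![0, c] (Submodule.subset_span (by simp))
    simp only [Matrix.cons_val_zero, Matrix.cons_val_one, mul_zero, zero_add] at h₁ h₂
    exact ⟨h₁, h₂⟩
  · rintro ⟨h₁, h₂⟩ v hv
    obtain ⟨p, q, rfl⟩ := Submodule.mem_span_pair.1 hv
    simp only [Pi.add_apply, Pi.smul_apply, Matrix.cons_val_zero, Matrix.cons_val_one,
      smul_eq_mul, mul_zero, add_zero]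
    linear_combination p * h₁ + q * h₂

theorem mem_span_pair_iff {R : Type*} [CommRing R] (a b c x y : R) :
    ![x, y] ∈ (Submodule.span R {![a, b], ![0, c]} : Set (Fin 2 → R)) ↔
      ∃ p q, p * a = x ∧ p * b + q * c = y := by
  rw [SetLike.mem_coe, Submodule.mem_span_pair]
  simp [funext_iff, Fin.forall_fin_two]

/-- The code spanned by `(a, b)` and `(0, c)` equals its dual iff membership conditions agree. -/
theorem span_pair_eq_dualSet_iff {R : Type*} [CommRing R] (a b c : R) :
    (Submodule.span R {![a, b], ![0, c]} : Set (Fin 2 → R)) =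
      dualSet (Submodule.span R {![a, b], ![0, c]} : Set (Fin 2 → R)) ↔
    ∀ x y, (∃ p q, p * a = x ∧ p * b + q * c = y) ↔ x * a + y * b = 0 ∧ y * c = 0 := by
  constructor
  · intro h x y
    rw [← mem_span_pair_iff, ← mem_dualSet_span_pair, ← h]
  · intro h
    ext v
    rw [show v = ![v 0, v 1] by ext i; fin_cases i <;> rfl]
    rw [mem_span_pair_iff, mem_dualSet_span_pair]
    exact h _ _

theorem dvd_mul_of_relations {F : Type*} [Field F] {f g₁ g₂ g₃ : F[X]}
    (h₃₃ : f ∣ g₃ ^ 2) (h₂₃ : f ∣ g₂ * g₃) (h₁₂ : f ∣ g₁ ^ 2 + g₂ ^ 2) : f ∣ g₁ * g₃ := by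
  rw [← IsIntegrallyClosed.pow_dvd_pow_iff two_ne_zero]
  have h : f ^ 2 ∣ (g₁ ^ 2 + g₂ ^ 2) * g₃ ^ 2 := by
    rw [pow_two]
    exact mul_dvd_mul h₁₂ h₃₃
  have h' : f ^ 2 ∣ (g₂ * g₃) ^ 2 := pow_dvd_pow_of_dvd h₂₃ 2
  convert dvd_sub h h' using 1
  ring

theorem mul_dvd_of_dual_le {F : Type*} [Field F] {f g₁ g₂ g₃ h : F[X]} (hg₁ : g₁ ≠ 0)
    (hf : f = g₁ * h) (hdvd₃ : g₃ ∣ f) (hIII : g₃ ∣ h * g₂)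
    (hsq : g₁ ^ 2 ∣ f) (h₁₃ : f ∣ g₁ * g₃) (h₁₂ : f ∣ g₁ ^ 2 + g₂ ^ 2)
    (hdual : f ∣ h * g₂ → f ∣ h * g₃ → ∃ p q, f ∣ p * g₁ ∧ f ∣ p * g₂ + q * g₃ - h) :
    g₁ * g₃ ∣ f := by
  have hg₂ : g₁ ∣ g₂ := by
    rw [← IsIntegrallyClosed.pow_dvd_pow_iff two_ne_zero]
    exact (dvd_add_right dvd_rfl).1 (hsq.trans h₁₂)
  have hg₁h : g₁ ∣ h := by
    rw [hf, pow_two] at hsq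
    exact (mul_dvd_mul_iff_left hg₁).1 hsq
  have hhg₃ : h ∣ g₃ := by
    rw [hf] at h₁₃
    exact (mul_dvd_mul_iff_left hg₁).1 h₁₃
  have hf' : f = h * g₁ := hf.trans (mul_comm _ _)
  obtain ⟨p, q, hp, hq⟩ := hdual (hf' ▸ mul_dvd_mul_left h hg₂)
    (hf' ▸ mul_dvd_mul_left h (hg₁h.trans hhg₃))
  have hhp : h ∣ p := by
    rw [hf, mul_comm p] at hp
    exact (mul_dvd_mul_iff_left hg₁).1 hp
  have hpg : g₃ ∣ p * g₂ + q * g₃ :=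
    dvd_add (hIII.trans (mul_dvd_mul_right hhp g₂)) (dvd_mul_left _ _)
  have hg₃h : g₃ ∣ h := (dvd_sub_right hpg).1 (hdvd₃.trans hq)
  exact hf ▸ mul_dvd_mul_left g₁ hg₃h

theorem exists_of_mem_dual {F : Type*} [Field F] {f g₁ g₂ g₃ x y : F[X]} (hg₁ : g₁ ≠ 0)
    (hg₃ : g₃ ≠ 0) (hf : f = g₁ * g₃) (hsq : g₁ ^ 2 ∣ f) (h₂₃ : f ∣ g₂ * g₃)
    (h₁₂ : f ∣ g₁ ^ 2 + g₂ ^ 2) (hx : f ∣ x * g₁ + y * g₂) (hy : f ∣ y * g₃) :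
    ∃ p q, p * g₁ = x ∧ p * g₂ + q * g₃ = y := by
  subst hf
  obtain ⟨w, rfl⟩ := (mul_dvd_mul_iff_right hg₃).1 h₂₃
  obtain ⟨t, rfl⟩ := (mul_dvd_mul_iff_right hg₃).1 hy
  rw [pow_two] at hsq
  obtain ⟨s, rfl⟩ := (mul_dvd_mul_iff_left hg₁).1 hsq
  obtain ⟨r, hr⟩ := hx
  obtain ⟨u, hu⟩ := h₁₂
  have hx' : x = g₁ * (s * r - t * w) := mul_left_cancel₀ hg₁ (by linear_combination hr)
  have hu' : 1 + w ^ 2 = s * u :=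
    mul_left_cancel₀ (mul_ne_zero hg₁ hg₁) (by linear_combination hu)
  refine ⟨s * r - t * w, t * u - r * w, by rw [hx']; ring, ?_⟩
  linear_combination -(g₁ * t) * hu'

/-- A class III code of length 2 with CGM `[[ḡ₁, ḡ₂], [0, ḡ₃]]` is self-dual iff
`deg g₁ + deg g₃ = m`, `ḡ₃² = ḡ₂ḡ₃ = ḡ₁² + ḡ₂² = 0` in `A`, and `g₁² ∣ f` in `F[x]`. -/
theorem classIII_selfDual_iff_relations {F : Type*} [Field F] [Fintype F]
    (f : F[X]) (hf : f.Monic) (hm : 1 ≤ f.natDegree)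
    (g₁ g₂ g₃ : F[X])
    (hd₁ : g₁.degree < (f.natDegree : WithBot ℕ))
    (hd₂ : g₂.degree < (f.natDegree : WithBot ℕ))
    (hd₃ : g₃.degree < (f.natDegree : WithBot ℕ))
    (hm₁ : g₁.Monic) (hm₃ : g₃.Monic) (hne₁ : g₁ ≠ 0)
    (hdvd₁ : g₁ ∣ f) (hdvd₃ : g₃ ∣ f) (hdeg₂₃ : g₂.degree < g₃.degree)
    (hIII : AdjoinRoot.mk f (f / g₁) * AdjoinRoot.mk f g₂ ∈
      Ideal.span {AdjoinRoot.mk f g₃}) :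
    ((Submodule.span (AdjoinRoot f)
        {![AdjoinRoot.mk f g₁, AdjoinRoot.mk f g₂], ![0, AdjoinRoot.mk f g₃]} :
          Set (Fin 2 → AdjoinRoot f)) =
      dualSet (Submodule.span (AdjoinRoot f)
        {![AdjoinRoot.mk f g₁, AdjoinRoot.mk f g₂], ![0, AdjoinRoot.mk f g₃]} :
          Set (Fin 2 → AdjoinRoot f))) ↔
    (g₁.natDegree + g₃.natDegree = f.natDegree ∧
      (AdjoinRoot.mk f g₃) ^ 2 = 0 ∧
      AdjoinRoot.mk f g₂ * AdjoinRoot.mk f g₃ = 0 ∧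
      (AdjoinRoot.mk f g₁) ^ 2 + (AdjoinRoot.mk f g₂) ^ 2 = 0 ∧
      g₁ ^ 2 ∣ f) := by
  have hIII' : g₃ ∣ f / g₁ * g₂ := by
    rw [Ideal.mem_span_singleton, ← map_mul] at hIII
    obtain ⟨c, hc⟩ := hIII
    obtain ⟨c, rfl⟩ := AdjoinRoot.mk_surjective c
    rw [← map_mul, AdjoinRoot.mk_eq_mk] at hc
    exact (dvd_sub_left (dvd_mul_right g₃ c)).1 (hdvd₃.trans hc)
  have hfg : f = g₁ * (f / g₁) := (EuclideanDomain.mul_div_cancel' hne₁ hdvd₁).symm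
  rw [span_pair_eq_dualSet_iff]
  simp only [AdjoinRoot.mk_surjective.forall, AdjoinRoot.mk_surjective.exists, ← map_mul,
    ← map_add, ← map_pow, AdjoinRoot.mk_eq_zero, AdjoinRoot.mk_eq_mk]
  generalize f / g₁ = h at hfg hIII'
  constructor
  · intro H
    obtain ⟨h₁₂, h₂₃⟩ := (H g₁ g₂).1 ⟨1, 0, by simp, by simp⟩
    have h₃₃ := ((H 0 g₃).1 ⟨0, 1, by simp, by simp⟩).2
    rw [← pow_two] at h₃₃
    rw [← pow_two, ← pow_two] at h₁₂
    have hsq : g₁ ^ 2 ∣ f := by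
      obtain ⟨p, -, hp, -⟩ := (H h 0).2 ⟨by rw [hfg, mul_comm h]; simp, by simp⟩
      have : g₁ ∣ h := (dvd_sub_right (dvd_mul_left g₁ p)).1 (hdvd₁.trans hp)
      rw [hfg, pow_two]
      exact mul_dvd_mul_left g₁ this
    have h₁₃ := dvd_mul_of_relations h₃₃ h₂₃ h₁₂
    have h₁₃' : g₁ * g₃ ∣ f := by
      refine mul_dvd_of_dual_le hne₁ hfg hdvd₃ hIII' hsq h₁₃ h₁₂ fun h₂ h₃ => ?_
      simpa using (H 0 h).2 ⟨by simpa using h₂, h₃⟩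
    refine ⟨?_, h₃₃, h₂₃, h₁₂, hsq⟩
    rw [← hm₁.natDegree_mul hm₃,
      eq_of_monic_of_associated (hm₁.mul hm₃) hf (associated_of_dvd_dvd h₁₃' h₁₃)]
  · rintro ⟨hdeg, h₃₃, h₂₃, h₁₂, hsq⟩ x y
    have hfg' : f = g₁ * g₃ :=
      eq_of_dvd_of_natDegree_le_of_leadingCoeff (dvd_mul_of_relations h₃₃ h₂₃ h₁₂)
        (by rw [hm₁.natDegree_mul hm₃, hdeg])
        (by rw [hf.leadingCoeff, (hm₁.mul hm₃).leadingCoeff])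
    constructor
    · rintro ⟨p, q, hx, hy⟩
      constructor
      · have := dvd_sub (dvd_add (h₁₂.mul_left p) (h₂₃.mul_left q))
          (dvd_add (hx.mul_right g₁) (hy.mul_right g₂))
        convert this using 1
        ring
      · have := dvd_sub (dvd_add (h₂₃.mul_left p) (h₃₃.mul_left q)) (hy.mul_right g₃)
        convert this using 1
        ring
    · rintro ⟨hx, hy⟩
      obtain ⟨p, q, rfl, rfl⟩ := exists_of_mem_dual hne₁ hm₃.ne_zero hfg' hsq h₂₃ h₁₂ hx hy
      exact ⟨p, q, by simp, by simp⟩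
end

section
/- Let C be the class III A-code of length 2 with canonical generator matrix [[ḡ_1, ḡ_2], [0, ḡ_3]]. Then C is self-dual if and only if there exist polynomials g', f', r ∈ F[x] with g'² = r·f' − 1 in F[x] such that f = g_1²·f', g_3 = g_1·f' and g_2 = g_1·g' in F[x]. -/
open Polynomial

/-- Membership of the class of `(a, b)` in the code spanned by `(g₁, g₂)` and `(0, g₃)`, in terms of
divisibility by `f`. -/
lemma mk_pair_mem_span_iff {R : Type*} [CommRing R] {f g₁ g₂ g₃ a b : R[X]} :
    ![AdjoinRoot.mk f a, AdjoinRoot.mk f b] ∈ Submodule.span (AdjoinRoot f)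
      {![AdjoinRoot.mk f g₁, AdjoinRoot.mk f g₂], ![0, AdjoinRoot.mk f g₃]} ↔
    ∃ u v : R[X], f ∣ a - u * g₁ ∧ f ∣ b - (u * g₂ + v * g₃) := by
  simp only [← AdjoinRoot.mk_eq_mk, map_add, map_mul]
  rw [Submodule.mem_span_pair]
  constructor
  · rintro ⟨u, v, h⟩
    obtain ⟨u, rfl⟩ := AdjoinRoot.mk_surjective u
    obtain ⟨v, rfl⟩ := AdjoinRoot.mk_surjective v
    have h₀ := congrFun h 0
    have h₁ := congrFun h 1
    simp at h₀ h₁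
    exact ⟨u, v, h₀.symm, h₁.symm⟩
  · rintro ⟨u, v, h₀, h₁⟩
    refine ⟨AdjoinRoot.mk f u, AdjoinRoot.mk f v, ?_⟩
    simp [h₀, h₁]

/-- Membership of the class of `(a, b)` in the dual of the code spanned by `(g₁, g₂)` and `(0, g₃)`, in
terms of divisibility by `f`. -/
lemma mk_pair_mem_dualSet_iff {R : Type*} [CommRing R] {f g₁ g₂ g₃ a b : R[X]} :
    ![AdjoinRoot.mk f a, AdjoinRoot.mk f b] ∈ dualSet (Submodule.span (AdjoinRoot f)
      {![AdjoinRoot.mk f g₁, AdjoinRoot.mk f g₂], ![0, AdjoinRoot.mk f g₃]} :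
        Set (Fin 2 → AdjoinRoot f)) ↔
    f ∣ a * g₁ + b * g₂ ∧ f ∣ b * g₃ := by
  simp only [← AdjoinRoot.mk_eq_zero, map_add, map_mul]
  constructor
  · intro h
    have h₀ := h _ (Submodule.subset_span (Set.mem_insert _ _))
    have h₁ := h _ (Submodule.subset_span (Set.mem_insert_of_mem _ rfl))
    simp at h₀ h₁
    exact ⟨h₀, h₁⟩
  · rintro ⟨h₀, h₁⟩ c hc
    obtain ⟨u, v, rfl⟩ := Submodule.mem_span_pair.mp hc
    simp only [Fin.sum_univ_two, Pi.add_apply, Pi.smul_apply, Matrix.cons_val_zero,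
      Matrix.cons_val_one, smul_eq_mul]
    linear_combination u * h₀ + v * h₁

/-- Equality of the code spanned by `(g₁, g₂)` and `(0, g₃)` with its dual, in terms of
divisibility by `f`. -/
lemma span_eq_dualSet_iff {R : Type*} [CommRing R] {f g₁ g₂ g₃ : R[X]} :
    ((Submodule.span (AdjoinRoot f)
        {![AdjoinRoot.mk f g₁, AdjoinRoot.mk f g₂], ![0, AdjoinRoot.mk f g₃]} :
          Set (Fin 2 → AdjoinRoot f)) =
      dualSet (Submodule.span (AdjoinRoot f)
        {![AdjoinRoot.mk f g₁, AdjoinRoot.mk f g₂], ![0, AdjoinRoot.mk f g₃]} :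
          Set (Fin 2 → AdjoinRoot f))) ↔
    ∀ a b : R[X], (∃ u v : R[X], f ∣ a - u * g₁ ∧ f ∣ b - (u * g₂ + v * g₃)) ↔
      f ∣ a * g₁ + b * g₂ ∧ f ∣ b * g₃ := by
  constructor
  · intro h a b
    rw [← mk_pair_mem_span_iff, ← mk_pair_mem_dualSet_iff, ← h, SetLike.mem_coe]
  · intro h
    ext x
    obtain ⟨a, ha⟩ := AdjoinRoot.mk_surjective (x 0)
    obtain ⟨b, hb⟩ := AdjoinRoot.mk_surjective (x 1)
    have hx : x = ![AdjoinRoot.mk f a, AdjoinRoot.mk f b] := by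
      ext i; fin_cases i <;> simp [ha, hb]
    rw [hx, SetLike.mem_coe, mk_pair_mem_span_iff, mk_pair_mem_dualSet_iff, h]

/-- If the code spanned by `(g₁, g₂)` and `(0, g₃)` is self-dual, then `f = g₁ * g₃`. -/
lemma eq_mul_of_span_selfDual {F : Type*} [Field F] {f g₁ g₂ g₃ : F[X]} (hf : f.Monic)
    (hm₁ : g₁.Monic) (hm₃ : g₃.Monic) (hdvd₁ : g₁ ∣ f) (hdvd₃ : g₃ ∣ f)
    (hIII : g₃ ∣ f / g₁ * g₂)
    (h : ∀ a b : F[X], (∃ u v : F[X], f ∣ a - u * g₁ ∧ f ∣ b - (u * g₂ + v * g₃)) ↔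
      f ∣ a * g₁ + b * g₂ ∧ f ∣ b * g₃) :
    f = g₁ * g₃ := by
  obtain ⟨h₁, hh₁⟩ := hdvd₁
  obtain ⟨h₃, hh₃⟩ := hdvd₃
  have hg₁ := hm₁.ne_zero
  have hg₃ := hm₃.ne_zero
  have hh₃m : h₃.Monic := hm₃.of_mul_monic_left (hh₃ ▸ hf)
  have hh₁0 : h₁ ≠ 0 := by
    rintro rfl
    exact hf.ne_zero (by simpa using hh₁)
  rw [hh₁, mul_div_cancel_left₀ _ hg₁] at hIII
  obtain ⟨k, hk⟩ := hIII
  have hk' : h₃ * g₂ = g₁ * k := by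
    apply mul_left_cancel₀ hh₁0
    linear_combination h₃ * hk + k * (hh₁ - hh₃)
  have h33 : h₃ ∣ g₃ := by
    have := ((h 0 g₃).mp ⟨0, 1, by simp, by simp⟩).2
    rw [hh₃] at this
    exact (mul_dvd_mul_iff_left hg₃).mp this
  have h32 : h₃ ∣ g₂ := by
    have := ((h 0 g₃).mp ⟨0, 1, by simp, by simp⟩).1
    rw [hh₃, zero_mul, zero_add] at this
    exact (mul_dvd_mul_iff_left hg₃).mp this
  have h12 : f ∣ g₁ * g₁ + g₂ * g₂ := ((h g₁ g₂).mp ⟨1, 0, by simp, by simp⟩).1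
  have hg₁f : g₁ ^ 2 ∣ f := by
    obtain ⟨u, v, ⟨w, hw⟩, -⟩ := (h h₁ 0).mpr ⟨⟨1, by rw [hh₁]; ring⟩, by simp⟩
    exact ⟨u + w * h₁, by linear_combination hh₁ + g₁ * hw + g₁ * w * hh₁⟩
  obtain ⟨u, v, ⟨w, hw⟩, ⟨z, hz⟩⟩ := (h (-k) h₃).mpr
    ⟨⟨0, by linear_combination hk'⟩, ⟨1, by rw [hh₃]; ring⟩⟩
  obtain ⟨s, rfl⟩ := h32
  obtain ⟨t, rfl⟩ := h33
  have hcop : IsCoprime s t := by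
    refine ⟨u, v + z * h₃, mul_left_cancel₀ hh₃m.ne_zero ?_⟩
    linear_combination -hz - z * hh₃
  have hdvd : h₃ ∣ g₁ := by
    rw [← IsIntegrallyClosed.pow_dvd_pow_iff two_ne_zero]
    have : h₃ ^ 2 ∣ g₁ * g₁ + h₃ * s * (h₃ * s) :=
      Dvd.dvd.trans ⟨t, by rw [hh₃]; ring⟩ h12
    have hs : h₃ ^ 2 ∣ h₃ * s * (h₃ * s) := ⟨s ^ 2, by ring⟩
    rw [sq g₁]
    exact (dvd_add_left hs).mp this
  obtain ⟨c, rfl⟩ := hdvd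
  have hcs : c ^ 2 ∣ s := by
    refine (mul_dvd_mul_iff_left (pow_ne_zero 2 hh₃m.ne_zero)).mp ?_
    exact ⟨-(u + w * h₁), by linear_combination hk' - h₃ * c * hw - h₃ * c * w * hh₁⟩
  have hct : c ^ 2 ∣ t := by
    refine (mul_dvd_mul_iff_left (pow_ne_zero 2 hh₃m.ne_zero)).mp ?_
    have : h₃ ^ 2 * t = f := by rw [hh₃]; ring
    rwa [this, ← mul_pow]
  have hc : c = 1 := (hh₃m.of_mul_monic_left hm₁).eq_one_of_isUnit
    ((isUnit_pow_iff two_ne_zero).mp (hcop.isUnit_of_dvd' hcs hct))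
  rw [hc, hh₃]
  ring

/-- A class III code of length 2 with CGM `[[ḡ₁, ḡ₂], [0, ḡ₃]]` is self-dual iff there exist
`g', f', r ∈ F[x]` with `g'² = r·f' − 1` such that `f = g₁²·f'`, `g₃ = g₁·f'` and
`g₂ = g₁·g'`. -/
theorem classIII_selfDual_iff_factorization {F : Type*} [Field F] [Fintype F]
    (f : F[X]) (hf : f.Monic) (hm : 1 ≤ f.natDegree)
    (g₁ g₂ g₃ : F[X])
    (hd₁ : g₁.degree < (f.natDegree : WithBot ℕ))
    (hd₂ : g₂.degree < (f.natDegree : WithBot ℕ))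
    (hd₃ : g₃.degree < (f.natDegree : WithBot ℕ))
    (hm₁ : g₁.Monic) (hm₃ : g₃.Monic) (hne₁ : g₁ ≠ 0)
    (hdvd₁ : g₁ ∣ f) (hdvd₃ : g₃ ∣ f) (hdeg₂₃ : g₂.degree < g₃.degree)
    (hIII : AdjoinRoot.mk f (f / g₁) * AdjoinRoot.mk f g₂ ∈
      Ideal.span {AdjoinRoot.mk f g₃}) :
    ((Submodule.span (AdjoinRoot f)
        {![AdjoinRoot.mk f g₁, AdjoinRoot.mk f g₂], ![0, AdjoinRoot.mk f g₃]} :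
          Set (Fin 2 → AdjoinRoot f)) =
      dualSet (Submodule.span (AdjoinRoot f)
        {![AdjoinRoot.mk f g₁, AdjoinRoot.mk f g₂], ![0, AdjoinRoot.mk f g₃]} :
          Set (Fin 2 → AdjoinRoot f))) ↔
    (∃ g' f' r : F[X], g' ^ 2 = r * f' - 1 ∧
      f = g₁ ^ 2 * f' ∧ g₃ = g₁ * f' ∧ g₂ = g₁ * g') := by
  rw [span_eq_dualSet_iff]
  constructor
  · intro h
    have hIII' : g₃ ∣ f / g₁ * g₂ := by
      rw [← map_mul, Ideal.mem_span_singleton] at hIII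
      obtain ⟨k, hk⟩ := hIII
      obtain ⟨k, rfl⟩ := AdjoinRoot.mk_surjective k
      rw [← map_mul, AdjoinRoot.mk_eq_mk] at hk
      exact (dvd_iff_dvd_of_dvd_sub (hdvd₃.trans hk)).mpr (dvd_mul_right _ _)
    have hfg := eq_mul_of_span_selfDual hf hm₁ hm₃ hdvd₁ hdvd₃ hIII' h
    have hsq : f ∣ g₁ * g₁ + g₂ * g₂ := ((h g₁ g₂).mp ⟨1, 0, by simp, by simp⟩).1
    obtain ⟨h₁, h₂⟩ := (h 0 g₃).mp ⟨0, 1, by simp, by simp⟩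
    rw [hfg, mul_dvd_mul_iff_right hm₃.ne_zero] at h₂
    rw [hfg, zero_mul, zero_add, mul_comm g₃, mul_dvd_mul_iff_right hm₃.ne_zero] at h₁
    obtain ⟨s, rfl⟩ := h₁
    obtain ⟨t, rfl⟩ := h₂
    obtain ⟨r, hr⟩ := hsq
    refine ⟨s, t, r, ?_, by rw [hfg]; ring, rfl, rfl⟩
    apply mul_left_cancel₀ (pow_ne_zero 2 hne₁)
    linear_combination hr + r * hfg
  · rintro ⟨g', f', r, hr, rfl, rfl, rfl⟩ a b
    have hf' : f' ≠ 0 := right_ne_zero_of_mul hm₃.ne_zero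
    constructor
    · rintro ⟨u, v, ⟨w, hw⟩, ⟨z, hz⟩⟩
      refine ⟨⟨w * g₁ + z * (g₁ * g') + u * r + v * g', ?_⟩,
        ⟨z * (g₁ * f') + u * g' + v * f', ?_⟩⟩
      · linear_combination g₁ * hw + g₁ * g' * hz + u * g₁ ^ 2 * hr
      · linear_combination g₁ * f' * hz
    · rintro ⟨⟨w, hw⟩, ⟨z, hz⟩⟩
      obtain rfl : b = g₁ * z := by
        apply mul_left_cancel₀ (mul_ne_zero hne₁ hf')
        linear_combination hz
      have ha : a = g₁ * (f' * w - z * g') := by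
        apply mul_left_cancel₀ hne₁
        linear_combination hw
      refine ⟨f' * w - z * g', r * z - w * g', by simp [ha, mul_comm], ⟨0, ?_⟩⟩
      linear_combination g₁ * z * hr
end

section
/- An A-code C ⊆ A² of length 2 is self-dual if and only if either (i) C = A·(1, ḡ_2) for some g_2 ∈ F[x] with ḡ_2² = −1 in A, or (ii) there exist polynomials g_1, g', f', r ∈ F[x] with g_1 monic, f = g_1²·f' and g'² = r·f' − 1 in F[x], such that C is the A-span of (ḡ_1, ḡ_1·ḡ') and (0, ḡ_1·f̄') in A². -/
open Polynomial

namespace AdjoinRoot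

variable {F : Type*} [Field F] {f : F[X]}

lemma exists_mk_eq_vecCons (v : Fin 2 → AdjoinRoot f) :
    ∃ a b : F[X], v = ![mk f a, mk f b] := by
  obtain ⟨a, ha⟩ := mk_surjective (v 0)
  obtain ⟨b, hb⟩ := mk_surjective (v 1)
  refine ⟨a, b, ?_⟩
  ext i
  fin_cases i <;> simp [ha, hb]

lemma mk_mem_dualSet_iff (C : Set (Fin 2 → AdjoinRoot f)) (a b : F[X]) :
    ![mk f a, mk f b] ∈ dualSet C ↔
      ∀ c d : F[X], ![mk f c, mk f d] ∈ C → f ∣ a * c + b * d := by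
  constructor
  · intro h c d hcd
    have := h _ hcd
    simpa [← mk_eq_zero] using this
  · intro h v hv
    obtain ⟨c, d, rfl⟩ := exists_mk_eq_vecCons v
    simpa [← mk_eq_zero] using h c d hv

/-- The code spanned by `(g₁, g₁ g')` and `(0, g₁ f')` is self-dual. -/
lemma span_pair_eq_dualSet {g₁ g' f' r : F[X]} (hf0 : f ≠ 0) (hf : f = g₁ ^ 2 * f')
    (hr : g' ^ 2 = r * f' - 1) :
    (Submodule.span (AdjoinRoot f) {![mk f g₁, mk f g₁ * mk f g'], ![0, mk f g₁ * mk f f']} :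
      Set (Fin 2 → AdjoinRoot f)) =
    dualSet (Submodule.span (AdjoinRoot f)
      {![mk f g₁, mk f g₁ * mk f g'], ![0, mk f g₁ * mk f f']} : Set _) := by
  have hg₁ : g₁ ≠ 0 := by rintro rfl; simp [hf] at hf0
  have hf' : f' ≠ 0 := by rintro rfl; simp [hf] at hf0
  have hzero : mk f g₁ ^ 2 * mk f f' = 0 := by
    rw [← map_pow, ← map_mul, ← hf, mk_self]
  have hrA : mk f g' ^ 2 = mk f r * mk f f' - 1 := by
    rw [← map_pow, hr]; simp
  ext v
  constructor
  · intro hv w hw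
    obtain ⟨s, t, rfl⟩ := Submodule.mem_span_pair.1 hv
    obtain ⟨s', t', rfl⟩ := Submodule.mem_span_pair.1 hw
    simp only [Fin.sum_univ_two, Pi.add_apply, Pi.smul_apply, Matrix.cons_val_zero,
      Matrix.cons_val_one, smul_eq_mul]
    linear_combination (s * s' * mk f r + (s * t' + s' * t) * mk f g' + t * t' * mk f f') * hzero +
      s * s' * mk f g₁ ^ 2 * hrA
  · intro hv
    obtain ⟨a, b, rfl⟩ := exists_mk_eq_vecCons v
    rw [mk_mem_dualSet_iff] at hv
    have h1 := hv g₁ (g₁ * g') (by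
      rw [map_mul]; exact Submodule.subset_span (by simp))
    have h2 := hv 0 (g₁ * f') (by
      rw [map_mul, map_zero]; exact Submodule.subset_span (by simp))
    obtain ⟨d, hd⟩ := h1
    obtain ⟨c, hc⟩ := h2
    have hb : b = g₁ * c := by
      apply mul_left_cancel₀ (mul_ne_zero hg₁ hf')
      linear_combination hc + c * hf
    have ha : a = g₁ * f' * d - g' * (g₁ * c) := by
      apply mul_left_cancel₀ hg₁
      linear_combination hd + d * hf - g₁ * g' * hb
    refine Submodule.mem_span_pair.2 ⟨mk f (f' * d - g' * c), mk f (r * c - d * g'), ?_⟩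
    ext i
    fin_cases i
    · simp [ha]; ring
    · simp [hb]
      linear_combination -(mk f c * mk f g₁) * hrA

/-- A self-dual code of length two has a generating pair `(g₁, g₁ g')`, `(0, g₁ f')`. -/
lemma exists_eq_span_pair_of_eq_dualSet (hf0 : f ≠ 0)
    (C : Submodule (AdjoinRoot f) (Fin 2 → AdjoinRoot f))
    (hC : (C : Set (Fin 2 → AdjoinRoot f)) = dualSet (C : Set (Fin 2 → AdjoinRoot f))) :
    ∃ g₁ g' f' r : F[X], g₁.Monic ∧ f = g₁ ^ 2 * f' ∧ g' ^ 2 = r * f' - 1 ∧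
      C = Submodule.span (AdjoinRoot f)
        {![mk f g₁, mk f g₁ * mk f g'], ![0, mk f g₁ * mk f f']} := by
  classical
  have hmem (a b : F[X]) : ![mk f a, mk f b] ∈ C ↔
      ∀ c d : F[X], ![mk f c, mk f d] ∈ C → f ∣ a * c + b * d := by
    rw [← SetLike.mem_coe, hC, mk_mem_dualSet_iff]
    rfl
  let I : Ideal F[X] := Ideal.comap (mk f) (C.map (LinearMap.proj 0))
  have hI (a : F[X]) : a ∈ I ↔ ∃ b, ![mk f a, mk f b] ∈ C := by
    constructor
    · rintro ⟨v, hv, hva⟩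
      obtain ⟨c, d, rfl⟩ := exists_mk_eq_vecCons v
      refine ⟨d, ?_⟩
      have hca : mk f c = mk f a := by simpa using hva
      rw [← hca]
      exact hv
    · rintro ⟨b, hb⟩
      exact ⟨_, hb, by simp⟩
  obtain ⟨g, hg⟩ := (IsPrincipalIdealRing.principal I).principal
  replace hg (a : F[X]) : a ∈ I ↔ normalize g ∣ a := by
    rw [hg, normalize_dvd_iff]; exact Ideal.mem_span_singleton
  have hfI : normalize g ∣ f := (hg f).1 <| (hI f).2 ⟨0, by
    convert C.zero_mem using 1
    ext i
    fin_cases i <;> simp⟩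
  have hg0 : g ≠ 0 := by
    rintro rfl
    exact hf0 (by simpa using hfI)
  have hmonic : (normalize g).Monic := monic_normalize hg0
  generalize normalize g = g₁ at *
  have hg₁ : g₁ ≠ 0 := hmonic.ne_zero
  have hfst {a b : F[X]} (h : ![mk f a, mk f b] ∈ C) : g₁ ∣ a := (hg a).1 ((hI a).2 ⟨b, h⟩)
  obtain ⟨t, ht⟩ := hfI
  obtain ⟨f', rfl⟩ : g₁ ∣ t := by
    refine hfst (b := 0) ((hmem _ _).2 fun c d h ↦ ?_)
    obtain ⟨s, rfl⟩ := hfst h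
    exact ⟨s, by linear_combination -s * ht⟩
  obtain ⟨k, hk⟩ := (hI g₁).1 ((hg g₁).2 dvd_rfl)
  obtain ⟨r, hr⟩ := (hmem _ _).1 hk _ _ hk
  obtain ⟨g', rfl⟩ : g₁ ∣ k := by
    rw [← IsIntegrallyClosed.pow_dvd_pow_iff two_ne_zero]
    exact ⟨f' * r - 1, by linear_combination hr + r * ht⟩
  have hr' : g' ^ 2 = r * f' - 1 := by
    apply mul_left_cancel₀ (pow_ne_zero 2 hg₁)
    linear_combination hr + r * ht
  have hsnd {b : F[X]} (h : ![mk f 0, mk f b] ∈ C) : g₁ * f' ∣ b := by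
    obtain ⟨u, hu⟩ := (hmem _ _).1 hk _ _ h
    obtain ⟨w, hw⟩ := (hmem _ _).1 h _ _ h
    obtain ⟨c, rfl⟩ : g₁ ∣ b := by
      rw [← IsIntegrallyClosed.pow_dvd_pow_iff two_ne_zero]
      exact ⟨f' * w, by linear_combination hw + w * ht⟩
    have hu' : g' * c = f' * u := by
      apply mul_left_cancel₀ (pow_ne_zero 2 hg₁)
      linear_combination hu + u * ht
    exact ⟨r * c - g' * u, by linear_combination g₁ * c * hr' - g₁ * g' * hu'⟩
  have hreduce (a b s : F[X]) (ha : a = g₁ * s) (h : ![mk f a, mk f b] ∈ C) :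
      g₁ * f' ∣ b - s * (g₁ * g') := by
    refine hsnd ?_
    convert C.sub_mem h (C.smul_mem (mk f s) hk) using 1
    ext i
    fin_cases i
    · simp [ha, mul_comm]
    · simp
  refine ⟨g₁, g', f', r, hmonic, by linear_combination ht, hr', le_antisymm ?_ ?_⟩
  · intro v hv
    obtain ⟨a, b, rfl⟩ := exists_mk_eq_vecCons v
    obtain ⟨s, hs⟩ := hfst hv
    obtain ⟨w, hw⟩ := hreduce a b s hs hv
    refine Submodule.mem_span_pair.2 ⟨mk f s, mk f w, ?_⟩
    ext i
    fin_cases i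
    · simp [hs, mul_comm]
    · simp [sub_eq_iff_eq_add.1 hw]
      ring
  · rw [Submodule.span_le]
    rintro v (rfl | rfl)
    · simpa using hk
    · rw [SetLike.mem_coe, ← map_mul, ← map_zero (mk f), hmem]
      intro c d h
      obtain ⟨s, hs⟩ := hfst h
      obtain ⟨w, hw⟩ := hreduce c d s hs h
      exact ⟨s * g' + f' * w, by linear_combination g₁ * f' * hw - (s * g' + f' * w) * ht⟩

/-- A code `A · (1, g₂)` with `g₂² = -1` is the degenerate case `g₁ = 1`, `f' = f`. -/
lemma exists_span_pair_eq_span_one {g₂ : F[X]} (h : mk f g₂ ^ 2 = -1) :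
    ∃ r : F[X], g₂ ^ 2 = r * f - 1 ∧
      Submodule.span (AdjoinRoot f) {![1, mk f g₂]} = Submodule.span (AdjoinRoot f)
        {![mk f 1, mk f 1 * mk f g₂], ![0, mk f 1 * mk f f]} := by
  have hdvd : f ∣ g₂ ^ 2 + 1 := by
    rw [← mk_eq_zero, map_add, map_pow, h, map_one, neg_add_cancel]
  obtain ⟨r, hr⟩ := hdvd
  refine ⟨r, by linear_combination hr, ?_⟩
  have hzero : (![0, mk f 1 * mk f f] : Fin 2 → AdjoinRoot f) = 0 := by
    ext i
    fin_cases i <;> simp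
  rw [hzero, Set.pair_comm, Submodule.span_insert_zero, map_one, one_mul]

end AdjoinRoot

/-- Characterization of self-dual `A`-codes of length 2. -/
theorem selfDual_length_two_iff {F : Type*} [Field F] [Fintype F]
    (f : F[X]) (hf : f.Monic) (hm : 1 ≤ f.natDegree)
    (Co : Submodule (AdjoinRoot f) (Fin 2 → AdjoinRoot f)) :
    ((Co : Set (Fin 2 → AdjoinRoot f)) = dualSet (Co : Set (Fin 2 → AdjoinRoot f))) ↔
    ((∃ g₂ : F[X], (AdjoinRoot.mk f g₂) ^ 2 = -1 ∧
        Co = Submodule.span (AdjoinRoot f) {![1, AdjoinRoot.mk f g₂]}) ∨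
     (∃ g₁ g' f' r : F[X], g₁.Monic ∧ f = g₁ ^ 2 * f' ∧ g' ^ 2 = r * f' - 1 ∧
        Co = Submodule.span (AdjoinRoot f)
          {![AdjoinRoot.mk f g₁, AdjoinRoot.mk f g₁ * AdjoinRoot.mk f g'],
            ![0, AdjoinRoot.mk f g₁ * AdjoinRoot.mk f f']})) := by
  constructor
  · exact fun h ↦ Or.inr (AdjoinRoot.exists_eq_span_pair_of_eq_dualSet hf.ne_zero Co h)
  · rintro (⟨g₂, hg₂, rfl⟩ | ⟨g₁, g', f', r, -, hfg, hr, rfl⟩)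
    · obtain ⟨r, hr, hspan⟩ := AdjoinRoot.exists_span_pair_eq_span_one hg₂
      rw [hspan]
      exact AdjoinRoot.span_pair_eq_dualSet hf.ne_zero (by ring) hr
    · exact AdjoinRoot.span_pair_eq_dualSet hf.ne_zero hfg hr
end

section
/- Let g_1, g' ∈ F[x] be monic polynomials with deg g_1 ≥ 1 and deg g' ≥ 1, let f = g_1²·(g'² + 1), and let A = F[x]/(f). Then the A-code of length 2 spanned over A by the two vectors (ḡ_1, ḡ_1·ḡ') and (0, ḡ_1·(ḡ'² + 1)) is self-dual. -/
open Polynomial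

theorem dvd_of_mk_mul_eq_zero {R : Type*} [CommRing R] [IsDomain R] {f u v p : R[X]}
    (hf : f = u * v) (hu : u ≠ 0) (h : AdjoinRoot.mk f (u * p) = 0) : v ∣ p := by
  rw [AdjoinRoot.mk_eq_zero, hf] at h
  exact (mul_dvd_mul_iff_left hu).1 h

theorem sq_add_one_ne_zero {R : Type*} [CommRing R] [IsDomain R] {g : R[X]}
    (hd : 1 ≤ g.natDegree) : g ^ 2 + 1 ≠ 0 := by
  intro h
  have h' : g ^ 2 = C (-1) := by rw [C_neg, C_1]; linear_combination h
  have := congrArg natDegree h'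
  rw [natDegree_pow, natDegree_C] at this
  omega

/-- For monic `g₁, g'` of positive degree and `f = g₁²·(g'² + 1)`, the `A`-code of length 2
spanned by `(ḡ₁, ḡ₁·ḡ')` and `(0, ḡ₁·(ḡ'² + 1))` is self-dual, where `A = F[x]/(f)`. -/
theorem selfDual_example {F : Type*} [Field F] [Fintype F]
    (g₁ g' : F[X]) (hm₁ : g₁.Monic) (hm' : g'.Monic)
    (hd₁ : 1 ≤ g₁.natDegree) (hd' : 1 ≤ g'.natDegree)
    (f : F[X]) (hf : f = g₁ ^ 2 * (g' ^ 2 + 1)) :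
    (Submodule.span (AdjoinRoot f)
        {![AdjoinRoot.mk f g₁, AdjoinRoot.mk f g₁ * AdjoinRoot.mk f g'],
          ![0, AdjoinRoot.mk f g₁ * ((AdjoinRoot.mk f g') ^ 2 + 1)]} :
        Set (Fin 2 → AdjoinRoot f)) =
      dualSet (Submodule.span (AdjoinRoot f)
        {![AdjoinRoot.mk f g₁, AdjoinRoot.mk f g₁ * AdjoinRoot.mk f g'],
          ![0, AdjoinRoot.mk f g₁ * ((AdjoinRoot.mk f g') ^ 2 + 1)]} :
        Set (Fin 2 → AdjoinRoot f)) := by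
  have hg : g₁ ≠ 0 := hm₁.ne_zero
  have hH : g' ^ 2 + 1 ≠ 0 := sq_add_one_ne_zero hd'
  have hzero : AdjoinRoot.mk f g₁ ^ 2 * (AdjoinRoot.mk f g' ^ 2 + 1) = 0 := by
    simpa [hf] using AdjoinRoot.mk_self (f := f)
  ext a
  simp only [dualSet, SetLike.mem_coe, Submodule.mem_span_pair, Set.mem_ofPred_eq,
    Fin.sum_univ_two]
  constructor
  · rintro ⟨s, t, rfl⟩ c ⟨s', t', rfl⟩
    simp only [Pi.add_apply, Pi.smul_apply, smul_eq_mul, Matrix.cons_val_zero,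
      Matrix.cons_val_one]
    linear_combination (s * s' + s * t' * AdjoinRoot.mk f g' + t * s' * AdjoinRoot.mk f g' +
      t * t' * (AdjoinRoot.mk f g' ^ 2 + 1)) * hzero
  · intro h
    have h₁ := h _ ⟨1, 0, rfl⟩
    have h₂ := h _ ⟨0, 1, rfl⟩
    obtain ⟨p, hp⟩ := AdjoinRoot.mk_surjective (a 0)
    obtain ⟨q, hq⟩ := AdjoinRoot.mk_surjective (a 1)
    simp only [Pi.add_apply, Pi.smul_apply, smul_eq_mul, Matrix.cons_val_zero,
      Matrix.cons_val_one, ← hp, ← hq] at h₁ h₂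
    obtain ⟨b, rfl⟩ : g₁ ∣ q := by
      refine dvd_of_mk_mul_eq_zero (f := f) (u := g₁ * (g' ^ 2 + 1)) (by rw [hf]; ring)
        (mul_ne_zero hg hH) ?_
      simp only [map_mul, map_add, map_pow, map_one]
      linear_combination h₂
    obtain ⟨k, hk⟩ : g₁ * (g' ^ 2 + 1) ∣ p + g' * (g₁ * b) := by
      refine dvd_of_mk_mul_eq_zero (f := f) (u := g₁) (by rw [hf]; ring) hg ?_
      simp only [map_mul, map_add] at h₁ ⊢
      linear_combination h₁
    have hk' := congrArg (AdjoinRoot.mk f) hk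
    simp only [map_mul, map_add, map_pow, map_one] at hk' hq
    refine ⟨AdjoinRoot.mk f ((g' ^ 2 + 1) * k - g' * b), AdjoinRoot.mk f (b - g' * k), ?_⟩
    ext i
    fin_cases i
    · simp [← hp]
      linear_combination -hk'
    · simp [← hq]
      ring
end

section
/- Assume char F = 2 and let C be the class III A-code of length 2 with canonical generator matrix [[ḡ_1, ḡ_2], [0, ḡ_3]]. Then C is self-dual if and only if either (i) g_1 = g_3, g_2 = 0 and f = g_1² in F[x]; or (ii) there exist f', h, s ∈ F[x] such that f = g_1²·f' and g_3 = g_1·f' in F[x], s is monic and satisfies (for all t ∈ F[x]: f' divides t² if and only if s divides t), g_2 = g_1·(h·s + 1) in F[x], and deg h < deg f' − deg s. -/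
open Polynomial

section ClassThreeCode

variable {F : Type*} [Field F]

/-- The class III code with rows `(ḡ₁, ḡ₂)` and `(0, ḡ₃)` is the reduction of the lattice
spanned by `(g₁, g₂)` and `(0, g₃)`. -/
lemma mem_span_classIII_iff {f g₁ g₂ g₃ k₁ k₃ w : F[X]}
    (hk₁ : f = g₁ * k₁) (hk₃ : f = g₃ * k₃) (hw : k₁ * g₂ = g₃ * w) (a b : F[X]) :
    ![AdjoinRoot.mk f a, AdjoinRoot.mk f b] ∈ Submodule.span (AdjoinRoot f)
        {![AdjoinRoot.mk f g₁, AdjoinRoot.mk f g₂], ![0, AdjoinRoot.mk f g₃]} ↔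
      ∃ u v : F[X], a = u * g₁ ∧ b = u * g₂ + v * g₃ := by
  rw [Submodule.mem_span_pair]
  constructor
  · rintro ⟨x, y, h⟩
    obtain ⟨u, rfl⟩ := AdjoinRoot.mk_surjective x
    obtain ⟨v, rfl⟩ := AdjoinRoot.mk_surjective y
    have h0 := congrFun h 0
    have h1 := congrFun h 1
    simp only [Matrix.smul_cons, smul_eq_mul, Matrix.smul_empty, Pi.add_apply,
      Matrix.cons_val_zero, Matrix.cons_val_one, mul_zero, add_zero, ← map_mul, ← map_add,
      AdjoinRoot.mk_eq_mk] at h0 h1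
    obtain ⟨c, hc⟩ := h0
    obtain ⟨d, hd⟩ := h1
    refine ⟨u - k₁ * c, v + c * w - k₃ * d, ?_, ?_⟩
    · linear_combination -hc - c * hk₁
    · linear_combination -hd - d * hk₃ + c * hw
  · rintro ⟨u, v, rfl, rfl⟩
    refine ⟨AdjoinRoot.mk f u, AdjoinRoot.mk f v, ?_⟩
    ext i
    fin_cases i <;> simp

lemma mem_dualSet_classIII_iff {f g₁ g₂ g₃ : F[X]} (a b : F[X]) :
    ![AdjoinRoot.mk f a, AdjoinRoot.mk f b] ∈ dualSet (Submodule.span (AdjoinRoot f)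
        {![AdjoinRoot.mk f g₁, AdjoinRoot.mk f g₂], ![0, AdjoinRoot.mk f g₃]} :
          Set (Fin 2 → AdjoinRoot f)) ↔
      f ∣ a * g₁ + b * g₂ ∧ f ∣ b * g₃ := by
  simp only [dualSet, Set.mem_ofPred_eq, SetLike.mem_coe, Fin.sum_univ_two,
    Matrix.cons_val_zero, Matrix.cons_val_one, ← AdjoinRoot.mk_eq_zero, map_add, map_mul]
  constructor
  · intro h
    refine ⟨?_, ?_⟩
    · simpa using h _ (Submodule.subset_span (Set.mem_insert _ _))
    · simpa using h _ (Submodule.subset_span (Set.mem_insert_of_mem _ rfl))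
  · rintro ⟨h₁, h₂⟩ c hc
    obtain ⟨x, y, rfl⟩ := Submodule.mem_span_pair.1 hc
    simp only [Matrix.smul_cons, smul_eq_mul, Matrix.smul_empty, Pi.add_apply,
      Matrix.cons_val_zero, Matrix.cons_val_one, mul_zero, add_zero]
    linear_combination x * h₁ + y * h₂

/-- Characteristic-free description of the self-dual class III codes of length 2. -/
lemma classIII_selfDual_iff {f g₁ g₂ g₃ : F[X]} (hf : f.Monic) (hm₁ : g₁.Monic)
    (hm₃ : g₃.Monic) (hdvd₁ : g₁ ∣ f) (hdvd₃ : g₃ ∣ f)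
    (hIII : AdjoinRoot.mk f (f / g₁) * AdjoinRoot.mk f g₂ ∈
      Ideal.span {AdjoinRoot.mk f g₃}) :
    ((Submodule.span (AdjoinRoot f)
        {![AdjoinRoot.mk f g₁, AdjoinRoot.mk f g₂], ![0, AdjoinRoot.mk f g₃]} :
          Set (Fin 2 → AdjoinRoot f)) =
      dualSet (Submodule.span (AdjoinRoot f)
        {![AdjoinRoot.mk f g₁, AdjoinRoot.mk f g₂], ![0, AdjoinRoot.mk f g₃]} :
          Set (Fin 2 → AdjoinRoot f))) ↔
    ∃ f' e : F[X], f = g₁ ^ 2 * f' ∧ g₃ = g₁ * f' ∧ g₂ = g₁ * e ∧ f' ∣ e ^ 2 + 1 := by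
  obtain ⟨k₁, hk₁⟩ := hdvd₁
  obtain ⟨k₃, hk₃⟩ := hdvd₃
  have hg₁ := hm₁.ne_zero
  have hg₃ := hm₃.ne_zero
  have hdiv : f / g₁ = k₁ := by
    rw [hk₁, mul_div_cancel_left₀ _ hg₁]
  have hw : g₃ ∣ k₁ * g₂ := by
    rw [hdiv, Ideal.mem_span_singleton] at hIII
    obtain ⟨x, hx⟩ := hIII
    obtain ⟨y, rfl⟩ := AdjoinRoot.mk_surjective x
    rw [← map_mul, ← map_mul, AdjoinRoot.mk_eq_mk] at hx
    exact (dvd_sub_left (dvd_mul_right g₃ y)).1 ((Dvd.intro _ hk₃.symm).trans hx)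
  obtain ⟨w, hw⟩ := hw
  have hmem := mem_span_classIII_iff hk₁ hk₃ hw
  have hdual := mem_dualSet_classIII_iff (f := f) (g₁ := g₁) (g₂ := g₂) (g₃ := g₃)
  have hset : ∀ S T : Set (Fin 2 → AdjoinRoot f), S = T ↔ ∀ a b : F[X],
      ![AdjoinRoot.mk f a, AdjoinRoot.mk f b] ∈ S ↔
        ![AdjoinRoot.mk f a, AdjoinRoot.mk f b] ∈ T := by
    intro S T
    refine ⟨fun h a b => by rw [h], fun h => Set.ext fun c => ?_⟩
    obtain ⟨a, ha⟩ := AdjoinRoot.mk_surjective (c 0)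
    obtain ⟨b, hb⟩ := AdjoinRoot.mk_surjective (c 1)
    have hc : c = ![AdjoinRoot.mk f a, AdjoinRoot.mk f b] := by
      ext i
      fin_cases i <;> simp [ha, hb]
    rw [hc]
    exact h a b
  rw [hset]
  simp only [SetLike.mem_coe, hmem, hdual]
  constructor
  · intro h
    obtain ⟨h₁₂, h₂₃⟩ := (h g₁ g₂).1 ⟨1, 0, by ring, by ring⟩
    obtain ⟨-, h₃₃⟩ := (h 0 g₃).1 ⟨0, 1, by ring, by ring⟩
    have hkw : k₃ * g₂ = g₁ * w := by
      have hk₁0 : k₁ ≠ 0 := fun h0 => hf.ne_zero (by rw [hk₁, h0, mul_zero])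
      refine mul_left_cancel₀ hk₁0 ?_
      linear_combination k₃ * hw - w * hk₃ + w * hk₁
    obtain ⟨u₁, v₁, ha₁, hb₁⟩ := (h k₁ 0).2 ⟨⟨1, by linear_combination -hk₁⟩, by simp⟩
    obtain ⟨u₂, v₂, ha₂, hb₂⟩ := (h (-w) k₃).2
      ⟨⟨0, by linear_combination hkw⟩, ⟨1, by linear_combination -hk₃⟩⟩
    have hle : f ∣ g₁ * g₃ := by
      rw [← IsIntegrallyClosed.pow_dvd_pow_iff (n := 2) two_ne_zero]
      obtain ⟨x, hx⟩ := h₁₂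
      obtain ⟨y, hy⟩ := h₂₃
      obtain ⟨z, hz⟩ := h₃₃
      refine ⟨x * z - y ^ 2, ?_⟩
      linear_combination g₃ ^ 2 * hx + f * x * hz - (g₂ * g₃ + f * y) * hy
    have hge : g₁ * g₃ ∣ f := by
      rw [← IsIntegrallyClosed.pow_dvd_pow_iff (n := 2) two_ne_zero]
      refine ⟨u₁ * v₂ - v₁ * u₂, ?_⟩
      have hdet : k₁ * k₃ = (u₁ * v₂ - v₁ * u₂) * (g₁ * g₃) := by
        linear_combination k₃ * ha₁ + u₁ * g₁ * hb₂ - u₂ * g₁ * hb₁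
      linear_combination f * hk₁ + g₁ * k₁ * hk₃ + g₁ * g₃ * hdet
    have hfg : f = g₁ * g₃ :=
      eq_of_monic_of_associated hf (hm₁.mul hm₃) (associated_of_dvd_dvd hle hge)
    obtain ⟨e, he⟩ : g₁ ∣ g₂ := by
      rw [hfg] at h₂₃
      exact (mul_dvd_mul_iff_right hg₃).1 h₂₃
    obtain ⟨f', hf'⟩ : g₁ ∣ g₃ := by
      rw [hfg] at h₃₃
      exact (mul_dvd_mul_iff_right hg₃).1 h₃₃
    have hff : f = g₁ ^ 2 * f' := by rw [hfg, hf']; ring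
    refine ⟨f', e, hff, hf', he, ?_⟩
    rw [← mul_dvd_mul_iff_left (pow_ne_zero 2 hg₁), ← hff]
    convert h₁₂ using 1
    rw [he]
    ring
  · rintro ⟨f', e, rfl, rfl, rfl, ⟨r, hr⟩⟩ a b
    have hf' : f' ≠ 0 := right_ne_zero_of_mul hg₃
    constructor
    · rintro ⟨u, v, rfl, rfl⟩
      exact ⟨⟨u * r + v * e, by linear_combination u * g₁ ^ 2 * hr⟩,
        ⟨u * e + v * f', by ring⟩⟩
    · rintro ⟨⟨c, hc⟩, ⟨b', hb⟩⟩
      have hb' : b = g₁ * b' := by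
        refine mul_right_cancel₀ hg₃ ?_
        linear_combination hb
      subst hb'
      have ha : a = (f' * c - b' * e) * g₁ := by
        refine mul_right_cancel₀ hg₁ ?_
        linear_combination hc
      exact ⟨_, b' * r - c * e, ha, by linear_combination b' * g₁ * hr⟩

/-- In characteristic 2 the polynomials whose square is divisible by `p` form an ideal, whose
monic generator is the "square root" of `p`. -/
lemma exists_monic_dvd_sq_iff_dvd [CharP F 2] {p : F[X]} (hp : p ≠ 0) :
    ∃ s : F[X], s.Monic ∧ ∀ t : F[X], p ∣ t ^ 2 ↔ s ∣ t := by
  let I : Ideal F[X] :=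
    { carrier := {t | p ∣ t ^ 2}
      add_mem' := fun {a b} ha hb => by
        simpa only [Set.mem_ofPred_eq, CharTwo.add_sq] using dvd_add ha hb
      zero_mem' := by simp
      smul_mem' := fun c x hx => by
        simpa only [Set.mem_ofPred_eq, smul_eq_mul, mul_pow] using Dvd.dvd.mul_left hx _ }
  have hI : ∀ t, p ∣ t ^ 2 ↔ Submodule.IsPrincipal.generator I ∣ t := fun t =>
    Submodule.IsPrincipal.mem_iff_generator_dvd I (x := t)
  have h0 : Submodule.IsPrincipal.generator I ≠ 0 := fun h =>
    hp (zero_dvd_iff.1 (h ▸ (hI p).1 (dvd_pow_self p two_ne_zero)))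
  classical
  exact ⟨normalize (Submodule.IsPrincipal.generator I), monic_normalize h0, fun t => by
    rw [hI, normalize_dvd_iff]⟩

end ClassThreeCode

/-- In characteristic 2, a class III code of length 2 with CGM `[[ḡ₁, ḡ₂], [0, ḡ₃]]` is
self-dual iff either `g₁ = g₃`, `g₂ = 0` and `f = g₁²`, or `f = g₁²·f'`, `g₃ = g₁·f'` and
`g₂ = g₁·(h·s + 1)` where `s` is the monic "square root" of `f'` (characterized by
`f' ∣ t² ↔ s ∣ t`) and `deg h < deg f' − deg s`. -/
theorem classIII_selfDual_iff_char_two {F : Type*} [Field F] [Fintype F]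
    (hchar : ringChar F = 2)
    (f : F[X]) (hf : f.Monic) (hm : 1 ≤ f.natDegree)
    (g₁ g₂ g₃ : F[X])
    (hd₁ : g₁.degree < (f.natDegree : WithBot ℕ))
    (hd₂ : g₂.degree < (f.natDegree : WithBot ℕ))
    (hd₃ : g₃.degree < (f.natDegree : WithBot ℕ))
    (hm₁ : g₁.Monic) (hm₃ : g₃.Monic) (hne₁ : g₁ ≠ 0)
    (hdvd₁ : g₁ ∣ f) (hdvd₃ : g₃ ∣ f) (hdeg₂₃ : g₂.degree < g₃.degree)
    (hIII : AdjoinRoot.mk f (f / g₁) * AdjoinRoot.mk f g₂ ∈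
      Ideal.span {AdjoinRoot.mk f g₃}) :
    ((Submodule.span (AdjoinRoot f)
        {![AdjoinRoot.mk f g₁, AdjoinRoot.mk f g₂], ![0, AdjoinRoot.mk f g₃]} :
          Set (Fin 2 → AdjoinRoot f)) =
      dualSet (Submodule.span (AdjoinRoot f)
        {![AdjoinRoot.mk f g₁, AdjoinRoot.mk f g₂], ![0, AdjoinRoot.mk f g₃]} :
          Set (Fin 2 → AdjoinRoot f))) ↔
    ((g₁ = g₃ ∧ g₂ = 0 ∧ f = g₁ ^ 2) ∨
     (∃ f' h s : F[X], f = g₁ ^ 2 * f' ∧ g₃ = g₁ * f' ∧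
        s.Monic ∧ (∀ t : F[X], f' ∣ t ^ 2 ↔ s ∣ t) ∧
        g₂ = g₁ * (h * s + 1) ∧ h.degree + s.degree < f'.degree)) := by
  have : CharP F 2 := ringChar.of_eq hchar
  rw [classIII_selfDual_iff hf hm₁ hm₃ hdvd₁ hdvd₃ hIII]
  constructor
  · rintro ⟨f', e, hff, rfl, rfl, he⟩
    have hf' : f'.Monic := hm₁.of_mul_monic_left hm₃
    rw [degree_mul, degree_mul] at hdeg₂₃
    have hdeg : e.degree < f'.degree := lt_of_add_lt_add_left hdeg₂₃
    by_cases h1 : f' = 1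
    · left
      subst h1
      have : e = 0 := by
        rw [degree_one] at hdeg
        exact degree_eq_bot.1 (Nat.WithBot.lt_zero_iff.1 hdeg)
      simp [this, hff]
    · right
      obtain ⟨s, hs, hst⟩ := exists_monic_dvd_sq_iff_dvd hf'.ne_zero
      have hse : s ∣ e + 1 := by
        rw [← hst, CharTwo.add_sq, one_pow]
        exact he
      obtain ⟨h, hh⟩ := hse
      refine ⟨f', h, s, hff, rfl, hs, hst, ?_, ?_⟩
      · rw [mul_comm h s, ← hh, add_assoc, CharTwo.add_self_eq_zero, add_zero]
      · rw [← degree_mul, mul_comm h s, ← hh]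
        refine (degree_add_le _ _).trans_lt (max_lt hdeg ?_)
        rw [degree_one]
        exact hf'.degree_pos.2 h1
  · rintro (⟨rfl, rfl, hff⟩ | ⟨f', h, s, hff, hg, -, hst, hg₂, -⟩)
    · exact ⟨1, 0, by simp [hff], by simp, by simp, one_dvd _⟩
    · refine ⟨f', h * s + 1, hff, hg, hg₂, ?_⟩
      rw [CharTwo.add_sq, one_pow, add_assoc, CharTwo.add_self_eq_zero, add_zero, hst]
      exact dvd_mul_left s h
end

section
/- There exist self-dual A-codes of every length — i.e., for every l ≥ 1 there is an A-submodule C ⊆ A^l with C = C^⊥ — if and only if f is a square in F[x], i.e., there exists g ∈ F[x] with f = g². -/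
open Polynomial

theorem AdjoinRoot.mk_mul_eq_zero_iff_of_eq_sq {F : Type*} [Field F] {f g : F[X]}
    (hf : f ≠ 0) (hg : f = g ^ 2) (a : AdjoinRoot f) :
    AdjoinRoot.mk f g * a = 0 ↔ ∃ b, a = AdjoinRoot.mk f g * b := by
  have hg0 : g ≠ 0 := by
    rintro rfl
    exact hf (by simpa using hg)
  have hsq : AdjoinRoot.mk f g * AdjoinRoot.mk f g = 0 := by
    rw [← map_mul, AdjoinRoot.mk_eq_zero, hg, sq]
  constructor
  · induction a using AdjoinRoot.induction_on with | ih p => ?_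
    intro h
    rw [← map_mul, AdjoinRoot.mk_eq_zero] at h
    nth_rewrite 1 [hg] at h
    rw [sq, mul_dvd_mul_iff_left hg0] at h
    obtain ⟨k, rfl⟩ := h
    exact ⟨AdjoinRoot.mk f k, map_mul _ _ _⟩
  · rintro ⟨b, rfl⟩
    rw [← mul_assoc, hsq, zero_mul]

/-- If the annihilator of `a` is generated by `a`, then the words with all
coordinates divisible by `a` form a self-dual code. -/
theorem exists_eq_dualSet_of_annihilator {R : Type*} [CommRing R] {a : R}
    (ha : ∀ x, a * x = 0 ↔ ∃ b, x = a * b) (l : ℕ) :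
    ∃ C : Submodule R (Fin l → R), (C : Set (Fin l → R)) = dualSet (C : Set (Fin l → R)) := by
  refine ⟨LinearMap.range (LinearMap.lsmul R (Fin l → R) a), Set.ext fun x ↦ ⟨?_, fun hx ↦ ?_⟩⟩
  · rintro ⟨y, rfl⟩ _ ⟨z, rfl⟩
    refine Finset.sum_eq_zero fun i _ ↦ ?_
    have hsq : a * a = 0 := (ha a).2 ⟨1, (mul_one a).symm⟩
    simp only [LinearMap.lsmul_apply, Pi.smul_apply, smul_eq_mul]
    linear_combination y i * z i * hsq
  · have h (i : Fin l) : ∃ b, x i = a * b := by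
      have h0 : x i * a = 0 := by simpa [Pi.single_apply] using hx _ ⟨Pi.single i 1, rfl⟩
      exact (ha _).1 (by rw [mul_comm, h0])
    choose b hb using h
    exact ⟨b, funext fun i ↦ (hb i).symm⟩

/-- A self-dual code of length one is given by an ideal equal to its own annihilator. -/
theorem exists_ideal_mem_iff_of_eq_dualSet {R : Type*} [CommRing R]
    (C : Submodule R (Fin 1 → R))
    (hC : (C : Set (Fin 1 → R)) = dualSet (C : Set (Fin 1 → R))) :
    ∃ I : Ideal R, ∀ a, a ∈ I ↔ ∀ c ∈ I, a * c = 0 := by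
  refine ⟨C.comap (LinearMap.pi fun _ ↦ LinearMap.id), fun a ↦ ?_⟩
  have h : (fun _ : Fin 1 ↦ a) ∈ C ↔ (fun _ : Fin 1 ↦ a) ∈ dualSet (C : Set (Fin 1 → R)) := by
    rw [← hC, SetLike.mem_coe]
  refine h.trans ⟨fun H c hc ↦ by simpa using H _ hc, fun H c hc ↦ ?_⟩
  have hc0 : c = fun _ ↦ c 0 := funext fun i ↦ by rw [Subsingleton.elim i 0]
  rw [hc0] at hc
  simpa using H (c 0) hc

theorem exists_eq_sq_of_ideal_mem_iff {F : Type*} [Field F] {f : F[X]} (hf : f.Monic)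
    (I : Ideal (AdjoinRoot f)) (hI : ∀ a, a ∈ I ↔ ∀ c ∈ I, a * c = 0) :
    ∃ g : F[X], f = g ^ 2 := by
  classical
  obtain ⟨g, hg⟩ := (inferInstance : (I.comap (AdjoinRoot.mk f)).IsPrincipal)
  have hmem (p : F[X]) : AdjoinRoot.mk f p ∈ I ↔ g ∣ p := by
    rw [← Ideal.mem_comap, hg, ← Ideal.mem_span_singleton]
  obtain ⟨h, hgh⟩ : g ∣ f := (hmem f).1 (by simp)
  have hdvd : g ∣ h := by
    refine (hmem h).1 ((hI _).2 fun c ↦ ?_)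
    induction c using AdjoinRoot.induction_on with | ih p => ?_
    intro hp
    rw [← map_mul, AdjoinRoot.mk_eq_zero, hgh, mul_comm g]
    exact mul_dvd_mul_left h ((hmem p).1 hp)
  have hfg : f ∣ g ^ 2 := by
    have hgI := (hmem g).2 dvd_rfl
    rw [← AdjoinRoot.mk_eq_zero, sq, map_mul]
    exact (hI _).1 hgI _ hgI
  have hgf : g ^ 2 ∣ f := by
    rw [hgh, sq]
    exact mul_dvd_mul_left g hdvd
  have hg0 : g ≠ 0 := by
    rintro rfl
    exact hf.ne_zero (by simpa using hgh)
  exact ⟨normalize g, eq_of_monic_of_associated hf ((monic_normalize hg0).pow 2)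
    ((associated_of_dvd_dvd hfg hgf).trans (associated_normalize g).pow_pow)⟩

/-- There exist self-dual `A`-codes of every length `l ≥ 1` iff `f` is a square in `F[x]`. -/
theorem selfDual_all_lengths_iff_isSquare {F : Type*} [Field F] [Fintype F]
    (f : F[X]) (hf : f.Monic) (hm : 1 ≤ f.natDegree) :
    (∀ l : ℕ, 1 ≤ l → ∃ Co : Submodule (AdjoinRoot f) (Fin l → AdjoinRoot f),
        (Co : Set (Fin l → AdjoinRoot f)) = dualSet (Co : Set (Fin l → AdjoinRoot f))) ↔
    (∃ g : F[X], f = g ^ 2) := by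
  constructor
  · intro h
    obtain ⟨C, hC⟩ := h 1 le_rfl
    obtain ⟨I, hI⟩ := exists_ideal_mem_iff_of_eq_dualSet C hC
    exact exists_eq_sq_of_ideal_mem_iff hf I hI
  · rintro ⟨g, hg⟩ l -
    exact exists_eq_dualSet_of_annihilator
      (AdjoinRoot.mk_mul_eq_zero_iff_of_eq_sq hf.ne_zero hg) l
end

section
/- The following are equivalent: (i) for every even l ≥ 2 there exists a self-dual A-code of length l; (ii) there exist g, f' ∈ F[x] with f = g²·f' such that −1 is a square in the quotient ring F[x]/(f'); (iii) q is even, or q ≡ 1 (mod 4), or q ≡ 3 (mod 4) and for every monic irreducible polynomial p ∈ F[x] dividing f, the product deg(p)·e_p is even, where e_p is the multiplicity of p in the factorization of f. -/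
open Polynomial

namespace Polynomial

variable {F : Type*} [Field F]

theorem isSquare_neg_one_adjoinRoot_iff {p : F[X]} :
    IsSquare (-1 : AdjoinRoot p) ↔ ∃ i : F[X], p ∣ i ^ 2 + 1 := by
  constructor
  · rintro ⟨r, hr⟩
    obtain ⟨i, rfl⟩ := AdjoinRoot.mk_surjective r
    refine ⟨i, AdjoinRoot.mk_eq_zero.1 ?_⟩
    rw [map_add, map_pow, map_one, pow_two, ← hr, neg_add_cancel]
  · rintro ⟨i, hi⟩
    refine ⟨AdjoinRoot.mk p i, ?_⟩
    have h := AdjoinRoot.mk_eq_zero.2 hi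
    rw [map_add, map_pow, map_one] at h
    linear_combination -h

theorem isSquare_neg_one_adjoinRoot_iff_card [Fintype F] {p : F[X]} (hp : Irreducible p) :
    IsSquare (-1 : AdjoinRoot p) ↔ Fintype.card F ^ p.natDegree % 4 ≠ 3 := by
  have : Fact (Irreducible p) := ⟨hp⟩
  have : Module.Finite F (AdjoinRoot p) := (AdjoinRoot.powerBasis hp.ne_zero).finite
  have : Finite (AdjoinRoot p) := Module.finite_of_finite F
  have := Fintype.ofFinite (AdjoinRoot p)
  rw [FiniteField.isSquare_neg_one_iff, Module.card_eq_pow_finrank (K := F),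
    (AdjoinRoot.powerBasis hp.ne_zero).finrank, AdjoinRoot.powerBasis_dim]

theorem dvd_and_dvd_of_dvd_sq_add_sq {p : F[X]} (hp : Irreducible p)
    (hsq : ¬IsSquare (-1 : AdjoinRoot p)) {a b : F[X]} (h : p ∣ a ^ 2 + b ^ 2) :
    p ∣ a ∧ p ∣ b := by
  have hb : p ∣ b := by
    by_contra hb
    obtain ⟨u, v, huv⟩ := (hp.coprime_iff_not_dvd).2 hb
    refine hsq (isSquare_neg_one_adjoinRoot_iff.2 ⟨v * a, ?_⟩)
    have h1 : (v * a) ^ 2 + 1 = v ^ 2 * (a ^ 2 + b ^ 2) + p * (u * (1 + v * b)) := by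
      linear_combination (-1 - v * b) * huv
    rw [h1]
    exact dvd_add (h.mul_left _) (dvd_mul_right _ _)
  exact ⟨hp.prime.dvd_of_dvd_pow ((dvd_add_left (hb.pow two_ne_zero)).1 h), hb⟩

theorem pow_dvd_and_pow_dvd_of_pow_dvd_sq_add_sq {p : F[X]} (hp : Irreducible p)
    (hsq : ¬IsSquare (-1 : AdjoinRoot p)) (k : ℕ) {a b : F[X]}
    (h : p ^ (2 * k + 1) ∣ a ^ 2 + b ^ 2) : p ^ (k + 1) ∣ a ∧ p ^ (k + 1) ∣ b := by
  induction k generalizing a b with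
  | zero => simpa using dvd_and_dvd_of_dvd_sq_add_sq hp hsq (by simpa using h)
  | succ k ih =>
    obtain ⟨⟨a, rfl⟩, ⟨b, rfl⟩⟩ :=
      dvd_and_dvd_of_dvd_sq_add_sq hp hsq ((dvd_pow_self p (by omega)).trans h)
    have h1 : p ^ (2 * k + 1) ∣ a ^ 2 + b ^ 2 := by
      refine (mul_dvd_mul_iff_left (pow_ne_zero 2 hp.ne_zero)).1 ?_
      convert h using 1 <;> ring
    obtain ⟨h2, h3⟩ := ih h1
    rw [pow_succ' p (k + 1)]
    exact ⟨mul_dvd_mul_left p h2, mul_dvd_mul_left p h3⟩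

/-- A polynomial all of whose odd-degree prime factors have even multiplicity is a square times
a polynomial modulo which `-1` is a square, over a finite field. -/
theorem exists_eq_sq_mul_isSquare_neg_one [Fintype F] (f : F[X])
    (h : ∀ p : F[X], Irreducible p → ∀ e : ℕ, p ^ e ∣ f → ¬p ^ (e + 1) ∣ f →
      Even (p.natDegree * e)) :
    ∃ g f' : F[X], f = g ^ 2 * f' ∧ ∃ i : F[X], f' ∣ i ^ 2 + 1 := by
  induction f using UniqueFactorizationMonoid.induction_on_coprime with
  | h0 => exact ⟨0, 1, by simp, 0, one_dvd _⟩
  | h1 hx => exact ⟨1, _, by simp, 0, hx.dvd⟩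
  | @hpr p e hp =>
    have he := h p hp.irreducible e dvd_rfl
      (fun h' => absurd ((pow_dvd_pow_iff hp.ne_zero hp.not_isUnit).1 h') (by omega))
    obtain ⟨k, rfl⟩ | ⟨k, rfl⟩ := e.even_or_odd
    · exact ⟨p ^ k, 1, by ring, 0, one_dvd _⟩
    · refine ⟨p ^ k, p, by ring, isSquare_neg_one_adjoinRoot_iff.1 ?_⟩
      rw [isSquare_neg_one_adjoinRoot_iff_card hp.irreducible]
      obtain ⟨d, hd⟩ : Even p.natDegree :=
        (Nat.even_mul.1 he).resolve_right (by simp)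
      rw [hd, pow_add]
      have := Nat.mod_lt (Fintype.card F ^ d) (show 0 < 4 by simp)
      rw [Nat.mul_mod]
      interval_cases Fintype.card F ^ d % 4 <;> simp
  | @hcp x y hxy ihx ihy =>
    have restrict {x y : F[X]} (hxy : IsRelPrime x y)
        (h : ∀ p : F[X], Irreducible p → ∀ e : ℕ, p ^ e ∣ x * y → ¬p ^ (e + 1) ∣ x * y →
          Even (p.natDegree * e)) :
        ∀ p : F[X], Irreducible p → ∀ e : ℕ, p ^ e ∣ x → ¬p ^ (e + 1) ∣ x →
          Even (p.natDegree * e) := by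
      intro p hp e h1 h2
      obtain rfl | he := eq_or_ne e 0
      · simp
      have hpy : ¬p ∣ y := fun hpy => hp.not_isUnit (hxy ((dvd_pow_self p he).trans h1) hpy)
      exact h p hp e (h1.mul_right y) fun h' =>
        h2 ((hp.coprime_iff_not_dvd.2 hpy).pow_left.dvd_of_dvd_mul_right h')
    obtain ⟨g₁, f₁, rfl, i₁, hi₁⟩ := ihx (restrict hxy h)
    obtain ⟨g₂, f₂, rfl, i₂, hi₂⟩ := ihy (restrict hxy.symm (by simpa only [mul_comm] using h))
    have hco : IsCoprime f₁ f₂ :=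
      (hxy.of_dvd_left (dvd_mul_left _ _)).of_dvd_right (dvd_mul_left _ _) |>.isCoprime
    obtain ⟨u, v, huv⟩ := hco
    refine ⟨g₁ * g₂, f₁ * f₂, by ring, u * f₁ * i₂ + v * f₂ * i₁, ?_⟩
    refine IsCoprime.mul_dvd ⟨u, v, huv⟩ ?_ ?_
    · have : (u * f₁ * i₂ + v * f₂ * i₁) ^ 2 + 1
          = (i₁ ^ 2 + 1) + f₁ * (u * (i₂ - i₁) * (2 * i₁ + u * f₁ * (i₂ - i₁))) := by
        obtain h : v * f₂ = 1 - u * f₁ := by linear_combination huv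
        rw [h]; ring
      rw [this]
      exact dvd_add hi₁ (dvd_mul_right _ _)
    · have : (u * f₁ * i₂ + v * f₂ * i₁) ^ 2 + 1
          = (i₂ ^ 2 + 1) + f₂ * (v * (i₁ - i₂) * (2 * i₂ + v * f₂ * (i₁ - i₂))) := by
        obtain h : u * f₁ = 1 - v * f₂ := by linear_combination huv
        rw [h]; ring
      rw [this]
      exact dvd_add hi₂ (dvd_mul_right _ _)

end Polynomial

/-- If `p ^ e` exactly divides `f` with `e` odd, and `-1` is not a square modulo `p`, then there
is no self-dual code of length `2` over `F[X] / (f)`. -/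
theorem not_selfDual_two_of_odd {F : Type*} [Field F] {f p : F[X]} (hp : Irreducible p)
    (hsq : ¬IsSquare (-1 : AdjoinRoot p)) {k : ℕ} (h1 : p ^ (2 * k + 1) ∣ f)
    (h2 : ¬p ^ (2 * k + 1 + 1) ∣ f) (C : Set (Fin 2 → AdjoinRoot f)) : C ≠ dualSet C := by
  intro hC
  obtain ⟨h, rfl⟩ := h1
  have key : ∀ a b : F[X], ![AdjoinRoot.mk _ a, AdjoinRoot.mk _ b] ∈ C → p ^ (k + 1) ∣ a := by
    intro a b hab
    have h3 := hab
    rw [hC] at h3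
    have h4 := h3 _ hab
    simp only [Fin.sum_univ_two, Matrix.cons_val_zero, Matrix.cons_val_one, ← map_mul,
      ← map_add, AdjoinRoot.mk_eq_zero] at h4
    refine (Polynomial.pow_dvd_and_pow_dvd_of_pow_dvd_sq_add_sq hp hsq k (b := b) ?_).1
    rw [pow_two, pow_two]
    exact (dvd_mul_right _ _).trans h4
  have hmem : ![AdjoinRoot.mk (p ^ (2 * k + 1) * h) (p ^ k * h), AdjoinRoot.mk _ 0] ∈ C := by
    rw [hC]
    intro c hc
    obtain ⟨a, ha⟩ := AdjoinRoot.mk_surjective (c 0)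
    obtain ⟨b, hb⟩ := AdjoinRoot.mk_surjective (c 1)
    have hc' : c = ![AdjoinRoot.mk _ a, AdjoinRoot.mk _ b] := by
      ext i; fin_cases i <;> simp [ha, hb]
    rw [hc'] at hc ⊢
    obtain ⟨a, rfl⟩ := key a b hc
    simp only [Fin.sum_univ_two, Matrix.cons_val_zero, Matrix.cons_val_one, ← map_mul,
      ← map_add, AdjoinRoot.mk_eq_zero]
    exact ⟨a, by ring⟩
  have h3 := key _ _ hmem
  rw [pow_succ, mul_dvd_mul_iff_left (pow_ne_zero k hp.ne_zero)] at h3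
  exact h2 (by rw [pow_succ]; exact mul_dvd_mul_left _ h3)

/-- If `f = g² f'` and `i² ≡ -1` modulo `f'`, the pairs `(a, b)` with `g ∣ a` and
`b ≡ i a` modulo `g f'` form a self-dual code; powers of it have every even length. -/
theorem exists_selfDual_of_even {F : Type*} [Field F] {g f' i : F[X]} (hf : g ^ 2 * f' ≠ 0)
    (hi : f' ∣ i ^ 2 + 1) {l : ℕ} (hl : Even l) :
    ∃ C : Submodule (AdjoinRoot (g ^ 2 * f')) (Fin l → AdjoinRoot (g ^ 2 * f')),
      (C : Set (Fin l → AdjoinRoot (g ^ 2 * f'))) = dualSet (C : Set _) := by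
  obtain ⟨n, rfl⟩ := hl
  set f := g ^ 2 * f' with hfdef
  have hg : g ≠ 0 := by rintro rfl; simp [hfdef] at hf
  have hf' : f' ≠ 0 := by rintro rfl; simp [hfdef] at hf
  let φ := AdjoinRoot.mk f
  have φf : φ g ^ 2 * φ f' = 0 := by
    rw [← map_pow, ← map_mul]; exact AdjoinRoot.mk_self
  obtain ⟨w, hw⟩ := hi
  have φi : φ i ^ 2 + 1 = φ f' * φ w := by
    rw [← map_pow, ← map_mul, ← hw, map_add, map_one]
  have cancel {s t : F[X]} (hs : s ≠ 0) (hst : f = s * t) {x : AdjoinRoot f}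
      (hx : x * φ s = 0) : φ t ∣ x := by
    obtain ⟨x, rfl⟩ := AdjoinRoot.mk_surjective x
    change φ x * φ s = 0 at hx
    rw [← map_mul] at hx
    have h1 : f ∣ x * s := AdjoinRoot.mk_eq_zero.1 hx
    rw [hst, mul_comm x, mul_dvd_mul_iff_left hs] at h1
    exact map_dvd φ h1
  let e₀ : Fin n → Fin (n + n) := Fin.castAdd n
  let e₁ : Fin n → Fin (n + n) := Fin.natAdd n
  let C : Submodule (AdjoinRoot f) (Fin (n + n) → AdjoinRoot f) :=
    { carrier := {v | ∀ j, φ g ∣ v (e₀ j) ∧ φ g * φ f' ∣ v (e₁ j) - φ i * v (e₀ j)}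
      add_mem' := by
        intro v w hv hw j
        refine ⟨dvd_add (hv j).1 (hw j).1, ?_⟩
        convert dvd_add (hv j).2 (hw j).2 using 1
        simp only [Pi.add_apply]; ring
      zero_mem' := by intro j; simp
      smul_mem' := by
        intro r v hv j
        refine ⟨(hv j).1.mul_left r, ?_⟩
        convert (hv j).2.mul_left r using 1
        simp only [Pi.smul_apply, smul_eq_mul]; ring }
  have mem_iff (v) : v ∈ C ↔
      ∀ j, φ g ∣ v (e₀ j) ∧ φ g * φ f' ∣ v (e₁ j) - φ i * v (e₀ j) := Iff.rfl
  have pair_mem (j : Fin n) {a b : AdjoinRoot f} (ha : φ g ∣ a)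
      (hb : φ g * φ f' ∣ b - φ i * a) :
      (Fin.append (Pi.single j a) (Pi.single j b) : Fin (n + n) → AdjoinRoot f) ∈ C := by
    rw [mem_iff]
    intro k
    obtain rfl | hk := eq_or_ne k j
    · simpa [e₀, e₁, -Fin.natAdd_eq_addNat] using ⟨ha, hb⟩
    · simp [e₀, e₁, hk, -Fin.natAdd_eq_addNat]
  refine ⟨C, Set.ext fun v => ⟨fun hv c hc => ?_, fun hv => ?_⟩⟩
  · rw [Fin.sum_univ_add, ← Finset.sum_add_distrib]
    refine Finset.sum_eq_zero fun j _ => ?_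
    obtain ⟨⟨a, ha⟩, s, hs⟩ := (mem_iff v).1 hv j
    obtain ⟨⟨b, hb⟩, t, ht⟩ := (mem_iff c).1 hc j
    change v (e₀ j) * c (e₀ j) + v (e₁ j) * c (e₁ j) = 0
    rw [sub_eq_iff_eq_add.1 hs, sub_eq_iff_eq_add.1 ht, ha, hb]
    linear_combination (s * t * φ f' + φ i * a * t + φ i * b * s + a * b * φ w) * φf
      + φ g ^ 2 * a * b * φi
  · refine (mem_iff v).2 fun j => ?_
    have pairing {a b : AdjoinRoot f} (ha : φ g ∣ a) (hb : φ g * φ f' ∣ b - φ i * a) :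
        v (e₀ j) * a + v (e₁ j) * b = 0 := by
      have h := hv _ (pair_mem j ha hb)
      simpa [Fin.sum_univ_add, Pi.single_apply, -Fin.natAdd_eq_addNat] using h
    have h1 : φ g ∣ v (e₁ j) := by
      refine cancel (mul_ne_zero hg hf') (by rw [hfdef]; ring) ?_
      rw [map_mul]
      simpa using pairing (a := 0) (b := φ g * φ f') (by simp) (by simp)
    have h2 : φ g * φ f' ∣ v (e₀ j) + φ i * v (e₁ j) := by
      rw [← map_mul]
      refine cancel hg (by rw [hfdef]; ring) ?_
      have := pairing (a := φ g) (b := φ i * φ g) dvd_rfl (by simp)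
      linear_combination this
    obtain ⟨b, hb⟩ := h1
    obtain ⟨s, hs⟩ := h2
    refine ⟨⟨φ f' * s - φ i * b, ?_⟩, ⟨φ w * b - φ i * s, ?_⟩⟩
    · linear_combination hs - φ i * hb
    · linear_combination (-φ i) * hs + v (e₁ j) * φi + φ f' * φ w * hb

/-- The following are equivalent: (i) there exist self-dual `A`-codes of every even length;
(ii) `f = g²·f'` with `-1` a square modulo `f'`; (iii) `q` is even, or `q ≡ 1 (mod 4)`, or
`q ≡ 3 (mod 4)` and `deg(p)·e_p` is even for every monic irreducible `p ∣ f` with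
multiplicity `e_p` in `f`. -/
theorem selfDual_even_lengths_tfae {F : Type*} [Field F] [Fintype F]
    (f : F[X]) (hf : f.Monic) (hm : 1 ≤ f.natDegree) :
    ((∀ l : ℕ, 2 ≤ l → Even l →
        ∃ Co : Submodule (AdjoinRoot f) (Fin l → AdjoinRoot f),
          (Co : Set (Fin l → AdjoinRoot f)) = dualSet (Co : Set (Fin l → AdjoinRoot f))) ↔
      (∃ g f' : F[X], f = g ^ 2 * f' ∧ IsSquare (-1 : AdjoinRoot f'))) ∧
    ((∃ g f' : F[X], f = g ^ 2 * f' ∧ IsSquare (-1 : AdjoinRoot f')) ↔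
      (Even (Fintype.card F) ∨ Fintype.card F % 4 = 1 ∨
        (Fintype.card F % 4 = 3 ∧
          ∀ p : F[X], p.Monic → Irreducible p → p ∣ f →
            ∀ e : ℕ, p ^ e ∣ f → ¬ p ^ (e + 1) ∣ f → Even (p.natDegree * e)))) := by
  have iii_ii : (Even (Fintype.card F) ∨ Fintype.card F % 4 = 1 ∨
      (Fintype.card F % 4 = 3 ∧
        ∀ p : F[X], p.Monic → Irreducible p → p ∣ f →
          ∀ e : ℕ, p ^ e ∣ f → ¬ p ^ (e + 1) ∣ f → Even (p.natDegree * e))) →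
      ∃ g f' : F[X], f = g ^ 2 * f' ∧ IsSquare (-1 : AdjoinRoot f') := by
    simp only [Polynomial.isSquare_neg_one_adjoinRoot_iff]
    intro h
    by_cases hq : Fintype.card F % 4 = 3
    · have h3 := (h.resolve_left (by rw [Nat.even_iff]; omega)).resolve_left (by omega)
      refine Polynomial.exists_eq_sq_mul_isSquare_neg_one f fun p hp e h1 h2 => ?_
      obtain rfl | he := eq_or_ne e 0
      · simp
      classical
      have hassoc : Associated (normalize p) p := (associated_normalize p).symm
      have := h3.2 (normalize p) (monic_normalize hp.ne_zero) (hassoc.irreducible_iff.2 hp)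
        (hassoc.dvd.trans ((dvd_pow_self p he).trans h1)) e
        (((hassoc.pow_pow (n := e)).dvd_iff_dvd_left).2 h1)
        (fun h' => h2 (((hassoc.pow_pow (n := e + 1)).dvd_iff_dvd_left).1 h'))
      rwa [natDegree_eq_of_degree_eq (degree_normalize (p := p))] at this
    · obtain ⟨r, hr⟩ := FiniteField.isSquare_neg_one_iff.2 hq
      refine ⟨1, f, by simp, C r, ?_⟩
      have : (C r ^ 2 + 1 : F[X]) = 0 := by
        rw [pow_two, ← C_mul, ← hr]; simp
      simp [this]
  have ii_i : (∃ g f' : F[X], f = g ^ 2 * f' ∧ IsSquare (-1 : AdjoinRoot f')) →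
      ∀ l : ℕ, 2 ≤ l → Even l →
        ∃ Co : Submodule (AdjoinRoot f) (Fin l → AdjoinRoot f),
          (Co : Set (Fin l → AdjoinRoot f)) = dualSet (Co : Set (Fin l → AdjoinRoot f)) := by
    rintro ⟨g, f', rfl, hsq⟩ l - hl
    obtain ⟨i, hi⟩ := Polynomial.isSquare_neg_one_adjoinRoot_iff.1 hsq
    exact exists_selfDual_of_even hf.ne_zero hi hl
  have i_iii : (∀ l : ℕ, 2 ≤ l → Even l →
        ∃ Co : Submodule (AdjoinRoot f) (Fin l → AdjoinRoot f),
          (Co : Set (Fin l → AdjoinRoot f)) = dualSet (Co : Set (Fin l → AdjoinRoot f))) →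
      (Even (Fintype.card F) ∨ Fintype.card F % 4 = 1 ∨
      (Fintype.card F % 4 = 3 ∧
        ∀ p : F[X], p.Monic → Irreducible p → p ∣ f →
          ∀ e : ℕ, p ^ e ∣ f → ¬ p ^ (e + 1) ∣ f → Even (p.natDegree * e))) := by
    intro h
    by_cases hq : Fintype.card F % 4 = 3
    · refine Or.inr (Or.inr ⟨hq, fun p _ hp _ e h1 h2 => ?_⟩)
      by_contra hodd
      obtain ⟨hd, k, rfl⟩ := Nat.odd_mul.1 (Nat.not_even_iff_odd.1 hodd)
      obtain ⟨Co, hCo⟩ := h 2 le_rfl even_two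
      refine not_selfDual_two_of_odd hp ?_ h1 h2 _ hCo
      rw [Polynomial.isSquare_neg_one_adjoinRoot_iff_card hp, not_not]
      obtain ⟨d, hd⟩ := hd
      rw [hd, pow_succ, pow_mul, Nat.mul_mod, Nat.pow_mod, Nat.pow_mod _ 2, hq]
      simp
    · rw [Nat.even_iff]
      omega
  exact ⟨⟨iii_ii ∘ i_iii, ii_i⟩, ⟨i_iii ∘ ii_i, iii_ii⟩⟩
end

section
/- If l is a positive integer divisible by 4, then there exists a self-dual A-code of length l, i.e., an A-submodule C ⊆ A^l with C = C^⊥. -/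
open Polynomial

/-- Over a commutative ring in which `-1 = a ^ 2 + b ^ 2`, the direct sum of copies of the code
with generator matrix `[1, 0, a, b; 0, 1, -b, a]`. -/
def fourBlockCode {R : Type*} [CommRing R] {k l : ℕ} (e : Fin k × Fin 4 ≃ Fin l) (a b : R) :
    Submodule R (Fin l → R) where
  carrier := {v | ∀ j, v (e (j, 2)) = a * v (e (j, 0)) - b * v (e (j, 1)) ∧
    v (e (j, 3)) = b * v (e (j, 0)) + a * v (e (j, 1))}
  zero_mem' := by simp
  add_mem' {v w} hv hw j := by
    simp only [Pi.add_apply, (hv j).1, (hv j).2, (hw j).1, (hw j).2]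
    constructor <;> ring
  smul_mem' r v hv j := by
    simp only [Pi.smul_apply, smul_eq_mul, (hv j).1, (hv j).2]
    constructor <;> ring

theorem sum_eq_sum_fourBlocks {R : Type*} [CommRing R] {k l : ℕ} (e : Fin k × Fin 4 ≃ Fin l)
    (g : Fin l → R) :
    ∑ i, g i = ∑ j, (g (e (j, 0)) + g (e (j, 1)) + g (e (j, 2)) + g (e (j, 3))) := by
  rw [← e.sum_comp, Fintype.sum_prod_type]
  simp only [Fin.sum_univ_four]

/-- The codeword of `fourBlockCode` supported on the block `j` with information symbols
`x` and `y`. -/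
def blockWord {R : Type*} [CommRing R] {k l : ℕ} (e : Fin k × Fin 4 ≃ Fin l) (a b : R)
    (j : Fin k) (x y : R) (i : Fin l) : R :=
  if (e.symm i).1 = j then ![x, y, a * x - b * y, b * x + a * y] (e.symm i).2 else 0

theorem blockWord_mem {R : Type*} [CommRing R] {k l : ℕ} (e : Fin k × Fin 4 ≃ Fin l) (a b : R)
    (j : Fin k) (x y : R) : blockWord e a b j x y ∈ fourBlockCode e a b := by
  intro j'
  by_cases h : j' = j <;> simp [blockWord, h]

theorem sum_mul_blockWord {R : Type*} [CommRing R] {k l : ℕ} (e : Fin k × Fin 4 ≃ Fin l)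
    (a b : R) (j : Fin k) (x y : R) (v : Fin l → R) :
    ∑ i, v i * blockWord e a b j x y i = v (e (j, 0)) * x + v (e (j, 1)) * y +
      v (e (j, 2)) * (a * x - b * y) + v (e (j, 3)) * (b * x + a * y) := by
  rw [sum_eq_sum_fourBlocks e, Finset.sum_eq_single j]
  · simp [blockWord]
  · intro j' _ h
    simp [blockWord, h]
  · simp

theorem fourBlockCode_eq_dualSet {R : Type*} [CommRing R] {k l : ℕ}
    (e : Fin k × Fin 4 ≃ Fin l) {a b : R} (hab : a ^ 2 + b ^ 2 = -1) :
    (fourBlockCode e a b : Set (Fin l → R)) =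
      dualSet (fourBlockCode e a b : Set (Fin l → R)) := by
  ext v
  simp only [SetLike.mem_coe, dualSet, Set.mem_ofPred_eq]
  constructor
  · intro hv c hc
    rw [sum_eq_sum_fourBlocks e]
    refine Finset.sum_eq_zero fun j _ => ?_
    rw [(hv j).1, (hv j).2, (hc j).1, (hc j).2]
    linear_combination
      (v (e (j, 0)) * c (e (j, 0)) + v (e (j, 1)) * c (e (j, 1))) * hab
  · intro hv j
    have h₁ := hv _ (blockWord_mem e a b j 1 0)
    have h₂ := hv _ (blockWord_mem e a b j 0 1)
    rw [sum_mul_blockWord] at h₁ h₂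
    constructor
    · linear_combination v (e (j, 2)) * hab - a * h₁ + b * h₂
    · linear_combination v (e (j, 3)) * hab - b * h₁ - a * h₂

/-- If `4 ∣ l` and `l > 0`, then there exists a self-dual `A`-code of length `l`. -/
theorem exists_selfDual_of_four_dvd {F : Type*} [Field F] [Fintype F]
    (f : F[X]) (hf : f.Monic) (hm : 1 ≤ f.natDegree)
    (l : ℕ) (hl : 0 < l) (h4 : 4 ∣ l) :
    ∃ Co : Submodule (AdjoinRoot f) (Fin l → AdjoinRoot f),
      (Co : Set (Fin l → AdjoinRoot f)) = dualSet (Co : Set (Fin l → AdjoinRoot f)) := by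
  obtain ⟨k, rfl⟩ := h4
  obtain ⟨p, _⟩ := CharP.exists F
  have : NeZero p := ⟨CharP.char_ne_zero_of_finite F p⟩
  obtain ⟨a, b, hab⟩ := CharP.sq_add_sq F p (-1)
  refine ⟨_, fourBlockCode_eq_dualSet (finProdFinEquiv.trans (finCongr (mul_comm k 4)))
    (a := (a : AdjoinRoot f)) (b := (b : AdjoinRoot f)) ?_⟩
  simpa using congrArg (AdjoinRoot.of f) hab
end

section
/- Assume m ≥ 2. There exists a polynomial g ∈ F[x] such that M_xᵀ = M_g (where M_xᵀ is the transpose of the companion matrix of f) if and only if f = x^m − 1, or f = x^m + 1, or m = 2 and f = x² + a·x − 1 for some a ∈ F. -/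
open Polynomial Matrix

/-- The `m × m` companion matrix of a polynomial `f`: it has `1` in the entries `(i, i+1)`
for `0 ≤ i < m - 1`, last row `(-f₀, -f₁, …, -f_{m-1})`, and `0` elsewhere. -/
def companion (F : Type*) [Field F] (m : ℕ) (f : Polynomial F) : Matrix (Fin m) (Fin m) F :=
  Matrix.of fun i j =>
    if (i : ℕ) + 1 = (j : ℕ) then 1
    else if (i : ℕ) = m - 1 then -f.coeff (j : ℕ) else 0

theorem companion_castSucc {F : Type*} [Field F] (n : ℕ) (f : F[X]) (i : Fin n) :
    companion F (n + 1) f i.castSucc = Pi.single i.succ 1 := by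
  ext j
  simp [companion, Pi.single_apply, Fin.ext_iff, i.isLt.ne, eq_comm (a := (j : ℕ))]

theorem companion_last {F : Type*} [Field F] (n : ℕ) (f : F[X]) :
    companion F (n + 1) f (Fin.last n) = fun j : Fin (n + 1) => -f.coeff j := by
  ext j
  have hj : n + 1 ≠ (j : ℕ) := j.isLt.ne'
  simp [companion, hj]

theorem companion_mul_transpose_apply {F : Type*} [Field F] (m : ℕ) (f : F[X]) (i j : Fin m) :
    (companion F m f * (companion F m f)ᵀ) i j = companion F m f i ⬝ᵥ companion F m f j :=
  rfl

theorem companion_transpose_mul_apply_zero {F : Type*} [Field F] (n : ℕ) (f : F[X])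
    (i : Fin (n + 1)) :
    ((companion F (n + 1) f)ᵀ * companion F (n + 1) f) i 0 = f.coeff i * f.coeff 0 := by
  rw [Matrix.mul_apply, Fin.sum_univ_castSucc]
  simp [companion_castSucc, companion_last]

theorem companion_transpose_mul_apply_succ_self {F : Type*} [Field F] (n : ℕ) (f : F[X])
    (i : Fin n) :
    ((companion F (n + 1) f)ᵀ * companion F (n + 1) f) i.succ i.succ =
      1 + f.coeff (i + 1) * f.coeff (i + 1) := by
  rw [Matrix.mul_apply, Fin.sum_univ_castSucc]
  simp [companion_castSucc, companion_last, Pi.single_apply]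

/-- Over a field, a one-sided inverse of a square matrix is a polynomial in that matrix. -/
theorem exists_aeval_eq_of_mul_eq_one {F ι : Type*} [Field F] [Fintype ι] [DecidableEq ι]
    {A B : Matrix ι ι F} (h : A * B = 1) : ∃ g : F[X], B = aeval A g := by
  have hBA : B * A = 1 := mul_eq_one_comm.mp h
  have hc : A.charpoly.coeff 0 ≠ 0 := by
    intro h0
    have hdet := A.det_eq_sign_charpoly_coeff
    rw [h0, mul_zero] at hdet
    simpa [hdet] using congrArg Matrix.det h
  have hq : aeval A A.charpoly.divX * A = -algebraMap F _ (A.charpoly.coeff 0) := by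
    have := A.aeval_self_charpoly
    rw [← A.charpoly.divX_mul_X_add] at this
    simp only [map_add, map_mul, aeval_X, aeval_C] at this
    exact eq_neg_of_add_eq_zero_left this
  refine ⟨C (-(A.charpoly.coeff 0)⁻¹) * A.charpoly.divX, ?_⟩
  have : aeval A (C (-(A.charpoly.coeff 0)⁻¹) * A.charpoly.divX) * A = 1 := by
    rw [map_mul, mul_assoc, hq, aeval_C, ← map_neg, ← map_mul, neg_mul_neg,
      inv_mul_cancel₀ hc, map_one]
  exact (left_inv_eq_right_inv this h).symm

theorem companion_mul_transpose_eq_one {F : Type*} [Field F] (n : ℕ) {c : F} (hc : c * c = 1) :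
    companion F (n + 1) (X ^ (n + 1) + C c) * (companion F (n + 1) (X ^ (n + 1) + C c))ᵀ = 1 := by
  have hlast : companion F (n + 1) (X ^ (n + 1) + C c) (Fin.last n) = Pi.single 0 (-c) := by
    rw [companion_last]
    ext j
    have hj : (j : ℕ) ≠ n + 1 := j.isLt.ne
    by_cases h : j = 0 <;> simp [coeff_X_pow, coeff_C, h, hj]
  ext i j
  rw [companion_mul_transpose_apply]
  refine Fin.lastCases ?_ (fun i => ?_) i <;> refine Fin.lastCases ?_ (fun j => ?_) j
  · simp [hlast, hc]
  · simp [hlast, companion_castSucc, Fin.ext_iff, j.isLt.ne']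
  · simp [hlast, companion_castSucc, Fin.ext_iff, i.isLt.ne]
  · simp [companion_castSucc, Matrix.one_apply, Pi.single_apply, eq_comm]

theorem coeff_of_commute_companion_transpose {F : Type*} [Field F] (n : ℕ) (f : F[X])
    (h : Commute (companion F (n + 2) f) (companion F (n + 2) f)ᵀ) :
    f.coeff 0 * f.coeff 0 = 1 ∧ -f.coeff 1 = f.coeff (n + 1) * f.coeff 0 ∧
      ∀ k : Fin n, f.coeff (k + 1) = 0 := by
  have key (i j : Fin (n + 2)) := congrFun (congrFun h.eq i) j
  refine ⟨?_, ?_, fun k => ?_⟩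
  · have := key 0 0
    rw [companion_transpose_mul_apply_zero, companion_mul_transpose_apply, ← Fin.castSucc_zero,
      companion_castSucc, single_one_dotProduct, Pi.single_eq_same] at this
    exact this.symm
  · have := key (Fin.last _) 0
    rw [companion_transpose_mul_apply_zero, companion_mul_transpose_apply, ← Fin.castSucc_zero,
      companion_castSucc, companion_last, dotProduct_single_one] at this
    exact this
  · have := key k.castSucc.succ k.castSucc.succ
    rw [companion_transpose_mul_apply_succ_self, companion_mul_transpose_apply, Fin.succ_castSucc,
      companion_castSucc, single_one_dotProduct, Pi.single_eq_same] at this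
    exact mul_self_eq_zero.mp (left_eq_add.mp this)

/-- For monic `f` of degree `m ≥ 2`, the transpose of the companion matrix `M_x` of `f` is of
the form `M_g = g(M_x)` for some polynomial `g` iff `f = xᵐ - 1`, or `f = xᵐ + 1`, or `m = 2`
and `f = x² + a·x - 1` for some `a ∈ F`. -/
theorem companion_transpose_eq_aeval_iff {F : Type*} [Field F]
    (m : ℕ) (hm : 2 ≤ m) (f : F[X]) (hf : f.Monic) (hdeg : f.natDegree = m) :
    (∃ g : F[X], (companion F m f)ᵀ = Polynomial.aeval (companion F m f) g) ↔
    (f = X ^ m - 1 ∨ f = X ^ m + 1 ∨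
      (m = 2 ∧ ∃ a : F, f = X ^ 2 + Polynomial.C a * X - 1)) := by
  obtain ⟨n, rfl⟩ := Nat.exists_eq_add_of_le' hm
  constructor
  · rintro ⟨g, hg⟩
    have hcomm : Commute (companion F (n + 2) f) (companion F (n + 2) f)ᵀ := by
      rw [hg]
      simpa using Commute.map (Polynomial.commute_X g) (aeval (companion F (n + 2) f))
    obtain ⟨h0, h1, hk⟩ := coeff_of_commute_companion_transpose n f hcomm
    have hsum := hf.as_sum
    rw [hdeg, Finset.sum_range_succ, Finset.sum_range_succ', Finset.sum_eq_zero] at hsum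
    swap
    · intro k hkn
      simp [hk ⟨k, Finset.mem_range.mp hkn⟩]
    simp only [zero_add, pow_zero, mul_one] at hsum
    have hzero (hlast : f.coeff (n + 1) = 0) : f = X ^ (n + 2) - 1 ∨ f = X ^ (n + 2) + 1 := by
      rw [hlast] at hsum
      rcases mul_self_eq_one_iff.mp h0 with h | h <;> rw [h] at hsum
      · right
        simpa using hsum
      · left
        simpa [sub_eq_add_neg] using hsum
    rcases n with _ | n
    · rcases mul_self_eq_one_iff.mp h0 with h | h
      · by_cases h2 : (1 : F) = -1
        · refine Or.inr (Or.inr ⟨rfl, f.coeff 1, ?_⟩)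
          rw [h, h2] at hsum
          simp only [zero_add, pow_one, map_neg, map_one] at hsum
          linear_combination hsum
        · have h1' : f.coeff 1 = 0 := by
            have h3 : f.coeff 1 * (1 - -1) = 0 := by
              rw [h, zero_add] at h1
              linear_combination -h1
            exact (mul_eq_zero.mp h3).resolve_right (sub_ne_zero.mpr h2)
          exact (hzero h1').imp_right Or.inl
      · refine Or.inr (Or.inr ⟨rfl, f.coeff 1, ?_⟩)
        rw [h] at hsum
        simp only [zero_add, pow_one, map_neg, map_one] at hsum
        linear_combination hsum
    · rw [show f.coeff 1 = 0 from hk 0, neg_zero] at h1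
      have h0' : f.coeff 0 ≠ 0 := left_ne_zero_of_mul_eq_one h0
      exact (hzero ((mul_eq_zero.mp h1.symm).resolve_right h0')).imp_right Or.inl
  · rintro (h | h | ⟨h2, a, h⟩)
    · rw [h, show (X ^ (n + 2) - 1 : F[X]) = X ^ (n + 1 + 1) + C (-1) by simp [sub_eq_add_neg]]
      exact exists_aeval_eq_of_mul_eq_one (companion_mul_transpose_eq_one (n + 1) (by ring))
    · rw [h, show (X ^ (n + 2) + 1 : F[X]) = X ^ (n + 1 + 1) + C 1 by simp]
      exact exists_aeval_eq_of_mul_eq_one (companion_mul_transpose_eq_one (n + 1) (by ring))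
    · obtain rfl : n = 0 := by lia
      refine ⟨X, ?_⟩
      rw [aeval_X, h]
      ext i j
      fin_cases i <;> fin_cases j <;> simp [companion, coeff_X, coeff_one]
end

section
/- (a) If m = 2 and f = x² + a·x − 1 for some a ∈ F, then for every g ∈ F[x] the matrix M_g = g(M_x) is symmetric, i.e. M_gᵀ = M_g. (b) If m ≥ 2 and f = x^m − 1 or f = x^m + 1, then M_x is invertible and for every g ∈ F[x] one has M_gᵀ = g(M_x^{−1}). -/
open Polynomial Matrix

theorem Matrix.transpose_aeval {R n : Type*} [CommRing R] [Fintype n] [DecidableEq n]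
    (M : Matrix n n R) (g : R[X]) : (aeval M g)ᵀ = aeval Mᵀ g := by
  induction g using Polynomial.induction_on' with
  | add p q hp hq => simp [hp, hq]
  | monomial k a =>
    rw [aeval_monomial, aeval_monomial, ← Algebra.smul_def, ← Algebra.smul_def, transpose_smul,
      transpose_pow]

theorem companion_two_transpose {F : Type*} [Field F] (a : F) :
    (companion F 2 (X ^ 2 + C a * X - 1))ᵀ = companion F 2 (X ^ 2 + C a * X - 1) := by
  ext i j
  fin_cases i <;> fin_cases j <;> simp [companion, coeff_one, coeff_X]

/-- The companion matrix of `Xᵐ - c` is a weighted cyclic permutation matrix. -/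
theorem companion_X_pow_sub_C_apply {F : Type*} [Field F] {m : ℕ} (hm : 0 < m) (c : F)
    (i j : Fin m) :
    companion F m (X ^ m - C c) i j =
      if j = ⟨(i + 1) % m, Nat.mod_lt _ hm⟩ then (if (i : ℕ) + 1 = m then c else 1) else 0 := by
  have hj := j.isLt
  by_cases hi : (i : ℕ) + 1 = m
  · have hi' : (i : ℕ) = m - 1 := by omega
    simp only [companion, of_apply, Fin.ext_iff, hi, Nat.mod_self, coeff_sub, coeff_X_pow, coeff_C]
    simp [hi', hj.ne, hj.ne']
  · have hi' : (i : ℕ) ≠ m - 1 := by omega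
    have hlt : (i : ℕ) + 1 < m := by omega
    simp [companion, Fin.ext_iff, hi, hi', Nat.mod_eq_of_lt hlt, eq_comm]

theorem companion_X_pow_sub_C_mul_transpose {F : Type*} [Field F] {m : ℕ} (hm : 0 < m) {c : F}
    (hc : c * c = 1) :
    companion F m (X ^ m - C c) * (companion F m (X ^ m - C c))ᵀ = 1 := by
  ext i k
  simp only [mul_apply, transpose_apply, companion_X_pow_sub_C_apply hm, one_apply]
  simp only [ite_mul, zero_mul, Finset.sum_ite_eq', Finset.mem_univ, if_true, Fin.mk.injEq]
  by_cases hik : i = k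
  · subst hik
    by_cases hi : (i : ℕ) + 1 = m <;> simp [hi, hc]
  · have hne : ((i : ℕ) + 1) % m ≠ ((k : ℕ) + 1) % m := fun h =>
      hik (Fin.ext (Nat.ModEq.eq_of_lt_of_lt (Nat.ModEq.add_right_cancel' 1 h) i.isLt k.isLt))
    simp [hik, hne]

/-- (a) If `f = x² + a·x - 1`, then `M_g = g(M_x)` is symmetric for every `g`.
(b) If `m ≥ 2` and `f = xᵐ ± 1`, then `M_x` is invertible and `M_gᵀ = g(M_x⁻¹)` for
every `g`. -/
theorem companion_aeval_transpose {F : Type*} [Field F] :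
    (∀ (a : F) (g : F[X]),
        (Polynomial.aeval (companion F 2 (X ^ 2 + Polynomial.C a * X - 1)) g)ᵀ =
          Polynomial.aeval (companion F 2 (X ^ 2 + Polynomial.C a * X - 1)) g) ∧
    (∀ (m : ℕ) (f : F[X]), 2 ≤ m → (f = X ^ m - 1 ∨ f = X ^ m + 1) →
        IsUnit (companion F m f) ∧
        ∀ g : F[X],
          (Polynomial.aeval (companion F m f) g)ᵀ =
            Polynomial.aeval (companion F m f)⁻¹ g) := by
  refine ⟨fun a g => by rw [transpose_aeval, companion_two_transpose], ?_⟩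
  intro m f hm hf
  obtain ⟨c, hc, rfl⟩ : ∃ c : F, c * c = 1 ∧ f = X ^ m - C c := by
    rcases hf with rfl | rfl
    · exact ⟨1, by simp, by simp⟩
    · exact ⟨-1, by simp, by simp⟩
  have h := companion_X_pow_sub_C_mul_transpose (by omega : 0 < m) hc
  exact ⟨IsUnit.of_mul_eq_one _ h, fun g => by rw [transpose_aeval, inv_eq_right_inv h]⟩
end

section
/- The F-dual of every A-code is an A-code — i.e., for every l ≥ 1 and every A-submodule C ⊆ A^l, the F-subspace C^{⊥_F} is an A-submodule of A^l — if and only if m = 1, or m = 2 and f = x² + a·x − 1 for some a ∈ F, or m ≥ 2 and f = x^m − 1 or f = x^m + 1. -/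
open Polynomial

/-- The `F`-dual of a set of codewords in `(F[x]/(f))ˡ`, computed with respect to the
standard dot product on `F^{lm}` obtained by identifying each element of `F[x]/(f)` with
the coefficient vector of its representative of degree `< m` (i.e., its coordinates in the
power basis `1, x̄, …, x̄^{m-1}`). -/
noncomputable def FdualSet {F : Type*} [Field F] {f : F[X]} (hf : f ≠ 0) {l : ℕ}
    (C : Set (Fin l → AdjoinRoot f)) : Set (Fin l → AdjoinRoot f) :=
  {u | ∀ c ∈ C, ∑ i, ∑ n, (AdjoinRoot.powerBasis hf).basis.repr (u i) n *
      (AdjoinRoot.powerBasis hf).basis.repr (c i) n = 0}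

namespace AdjoinRoot

variable {F : Type*} [Field F] {f : F[X]}

/-- The `n`-th coefficient of the representative of degree `< f.natDegree`. -/
noncomputable def reprCoeff (hf : f.Monic) (n : ℕ) : AdjoinRoot f →ₗ[F] F :=
  (lcoeff F n).comp (modByMonicHom hf)

/-- The dot product of coefficient vectors. -/
noncomputable def coeffDot (hf : f.Monic) (a b : AdjoinRoot f) : F :=
  ∑ n ∈ Finset.range f.natDegree, reprCoeff hf n a * reprCoeff hf n b

theorem reprCoeff_mk (hf : f.Monic) {p : F[X]} (hp : p.degree < f.degree) (n : ℕ) :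
    reprCoeff hf n (mk f p) = p.coeff n := by
  simp [reprCoeff, modByMonicHom_mk, (modByMonic_eq_self_iff hf).2 hp]

theorem reprCoeff_root_pow (hf : f.Monic) {i : ℕ} (hi : i < f.natDegree) (n : ℕ) :
    reprCoeff hf n (root f ^ i) = if n = i then 1 else 0 := by
  have h : root f ^ i = mk f (X ^ i) := by simp
  rw [h, reprCoeff_mk hf _, coeff_X_pow]
  rw [degree_X_pow, degree_eq_natDegree hf.ne_zero]
  exact_mod_cast hi

theorem exists_mk_eq (hf : f.Monic) (a : AdjoinRoot f) :
    ∃ p : F[X], p.degree < f.degree ∧ mk f p = a :=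
  ⟨modByMonicHom hf a, by
    obtain ⟨q, rfl⟩ := mk_surjective a
    simpa using degree_modByMonic_lt q hf, mk_leftInverse hf a⟩

theorem powerBasis_repr (hf : f.Monic) (a : AdjoinRoot f) (n : Fin (powerBasis hf.ne_zero).dim) :
    (powerBasis hf.ne_zero).basis.repr a n = reprCoeff hf n a := by
  have h : (powerBasis hf.ne_zero).basis.coord n = reprCoeff hf n := by
    refine (powerBasis hf.ne_zero).basis.ext fun i => ?_
    have hi : (i : ℕ) < f.natDegree := i.2
    rw [Module.Basis.coord_apply, Module.Basis.repr_self, (powerBasis hf.ne_zero).basis_eq_pow,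
      powerBasis_gen, reprCoeff_root_pow hf hi]
    simp only [Finsupp.single_apply, Fin.ext_iff, eq_comm]
  exact LinearMap.congr_fun h a

theorem sum_powerBasis_repr (hf : f.Monic) (a b : AdjoinRoot f) :
    ∑ n, (powerBasis hf.ne_zero).basis.repr a n * (powerBasis hf.ne_zero).basis.repr b n =
      coeffDot hf a b := by
  refine (Finset.sum_congr rfl fun n _ => ?_).trans
    (Fin.sum_univ_eq_sum_range (fun n => reprCoeff hf n a * reprCoeff hf n b) f.natDegree)
  rw [powerBasis_repr, powerBasis_repr]

theorem reprCoeff_root_mul (hf : f.Monic) (hm : 1 ≤ f.natDegree) (a : AdjoinRoot f) (n : ℕ) :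
    reprCoeff hf n (root f * a) =
      (if n = 0 then 0 else reprCoeff hf (n - 1) a) -
        f.coeff n * reprCoeff hf (f.natDegree - 1) a := by
  obtain ⟨p, hp, rfl⟩ := exists_mk_eq hf a
  have h : root f * mk f p = mk f (X * p - C (p.coeff (f.natDegree - 1)) * f) := by simp
  rw [h, reprCoeff_mk, reprCoeff_mk hf hp, reprCoeff_mk hf hp]
  · rcases n with _ | n
    · simp [mul_comm]
    · simp [mul_comm]
  · rw [degree_eq_natDegree hf.ne_zero, degree_lt_iff_coeff_zero] at *
    intro k hk
    obtain ⟨k, rfl⟩ : ∃ j, k = j + 1 := ⟨k - 1, by omega⟩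
    rw [coeff_sub, coeff_X_mul, coeff_C_mul]
    rcases hk.eq_or_lt with h | h
    · rw [← h, hf.coeff_natDegree, h]
      simp
    · rw [coeff_eq_zero_of_natDegree_lt h, hp k (by omega)]
      simp

theorem coeffDot_comm (hf : f.Monic) (a b : AdjoinRoot f) :
    coeffDot hf a b = coeffDot hf b a := by
  simp [coeffDot, mul_comm]

theorem coeffDot_add_left (hf : f.Monic) (a b c : AdjoinRoot f) :
    coeffDot hf (a + b) c = coeffDot hf a c + coeffDot hf b c := by
  simp [coeffDot, add_mul, Finset.sum_add_distrib]

theorem coeffDot_smul_left (hf : f.Monic) (r : F) (a b : AdjoinRoot f) :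
    coeffDot hf (r • a) b = r * coeffDot hf a b := by
  simp [coeffDot, Finset.mul_sum, mul_assoc]

theorem coeffDot_add_right (hf : f.Monic) (a b c : AdjoinRoot f) :
    coeffDot hf a (b + c) = coeffDot hf a b + coeffDot hf a c := by
  simp [coeffDot, mul_add, Finset.sum_add_distrib]

theorem coeffDot_smul_right (hf : f.Monic) (r : F) (a b : AdjoinRoot f) :
    coeffDot hf a (r • b) = r * coeffDot hf a b := by
  rw [coeffDot_comm, coeffDot_smul_left, coeffDot_comm]

theorem coeffDot_root_pow_left (hf : f.Monic) {i : ℕ} (hi : i < f.natDegree)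
    (a : AdjoinRoot f) : coeffDot hf (root f ^ i) a = reprCoeff hf i a := by
  simp [coeffDot, reprCoeff_root_pow hf hi, hi]

/-- If multiplication by the root has an adjoint given by multiplication, then so does
multiplication by any element. -/
theorem exists_adjoint_mul (hf : f.Monic) {t : AdjoinRoot f}
    (ht : ∀ u c, coeffDot hf (root f * u) c = coeffDot hf u (t * c)) (r : AdjoinRoot f) :
    ∃ s, ∀ u c, coeffDot hf (r * u) c = coeffDot hf u (s * c) := by
  obtain ⟨p, rfl⟩ := mk_surjective r
  refine ⟨aeval t p, ?_⟩
  induction p using Polynomial.induction_on with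
  | C a =>
    intro u c
    have h (v : AdjoinRoot f) : mk f (C a) * v = a • v := by
      rw [Algebra.smul_def]; rfl
    rw [h, aeval_C, ← Algebra.smul_def, coeffDot_smul_left, coeffDot_smul_right]
  | add p q hp hq =>
    intro u c
    rw [map_add, map_add, add_mul, add_mul, coeffDot_add_left, coeffDot_add_right, hp, hq]
  | monomial n a h =>
    intro u c
    rw [pow_succ, ← mul_assoc, map_mul (mk f), map_mul (aeval t), mk_X, mul_assoc, h, ht, aeval_X]
    congr 1
    ring

theorem mem_FdualSet_iff (hf : f.Monic) {l : ℕ} (S : Set (Fin l → AdjoinRoot f))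
    (u : Fin l → AdjoinRoot f) :
    u ∈ FdualSet hf.ne_zero S ↔ ∀ c ∈ S, ∑ i, coeffDot hf (u i) (c i) = 0 := by
  refine forall₂_congr fun c _ => ?_
  rw [Finset.sum_congr rfl fun i _ => sum_powerBasis_repr hf (u i) (c i)]

theorem exists_submodule_eq_FdualSet (hf : f.Monic) {t : AdjoinRoot f}
    (ht : ∀ u c, coeffDot hf (root f * u) c = coeffDot hf u (t * c)) {l : ℕ}
    (S : Submodule (AdjoinRoot f) (Fin l → AdjoinRoot f)) :
    ∃ D : Submodule (AdjoinRoot f) (Fin l → AdjoinRoot f),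
      (D : Set (Fin l → AdjoinRoot f)) = FdualSet hf.ne_zero (S : Set (Fin l → AdjoinRoot f)) := by
  refine ⟨{ carrier := FdualSet hf.ne_zero (S : Set (Fin l → AdjoinRoot f))
            add_mem' := ?_, zero_mem' := ?_, smul_mem' := ?_ }, rfl⟩
  · intro a b ha hb
    rw [mem_FdualSet_iff hf] at *
    intro c hc
    simp [coeffDot_add_left, Finset.sum_add_distrib, ha c hc, hb c hc]
  · rw [mem_FdualSet_iff hf]
    simp [coeffDot]
  · intro r u hu
    rw [mem_FdualSet_iff hf] at *
    intro c hc
    obtain ⟨s, hs⟩ := exists_adjoint_mul hf ht r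
    simpa [hs] using hu (s • c) (S.smul_mem s hc)

/-- Multiplication by the root is an isometry for `f = X ^ m - ε` with `ε ^ 2 = 1`. -/
theorem coeffDot_root_mul_root_mul (hf : f.Monic) (hm : 1 ≤ f.natDegree) {ε : F}
    (hε : ε ^ 2 = 1) (h : f = X ^ f.natDegree - C ε) (u v : AdjoinRoot f) :
    coeffDot hf (root f * u) (root f * v) = coeffDot hf u v := by
  have h0 : f.coeff 0 = -ε := by
    rw [h]; simp [coeff_X_pow]; omega
  have hn (n : ℕ) (hn : n + 1 < f.natDegree) : f.coeff (n + 1) = 0 := by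
    rw [h]; simp [coeff_X_pow]; omega
  obtain ⟨k, hk⟩ : ∃ k, f.natDegree = k + 1 := ⟨f.natDegree - 1, by omega⟩
  simp only [coeffDot, hk]
  rw [Finset.sum_range_succ', Finset.sum_range_succ]
  congr 1
  · refine Finset.sum_congr rfl fun n hn' => ?_
    rw [Finset.mem_range] at hn'
    simp [reprCoeff_root_mul hf hm, hn n (by omega)]
  · simp only [reprCoeff_root_mul hf hm, h0, hk]
    simp
    linear_combination (reprCoeff hf k u * reprCoeff hf k v) * hε

theorem exists_adjoint_root_of_isometry (hf : f.Monic) (hm : 1 ≤ f.natDegree) {ε : F}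
    (hε : ε ^ 2 = 1) (h : f = X ^ f.natDegree - C ε) :
    ∃ t : AdjoinRoot f, ∀ u c, coeffDot hf (root f * u) c = coeffDot hf u (t * c) := by
  have hr : root f ^ f.natDegree = of f ε := by
    have := congrArg (mk f) h
    rw [mk_self] at this
    exact sub_eq_zero.1 (by simpa using this.symm)
  refine ⟨of f ε * root f ^ (f.natDegree - 1), fun u c => ?_⟩
  rw [← coeffDot_root_mul_root_mul hf hm hε h u]
  congr 1
  have h1 : root f * root f ^ (f.natDegree - 1) = of f ε := by
    rw [← pow_succ', Nat.sub_add_cancel hm, hr]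
  have h2 : of f ε * of f ε = 1 := by rw [← map_mul, ← sq, hε, map_one]
  linear_combination -(of f ε * c) * h1 - c * h2

/-- Multiplication by the root preserves orthogonality to the cyclic submodules. -/
theorem sum_coeffDot_root_mul_eq_zero (hf : f.Monic)
    (H : ∀ l : ℕ, 1 ≤ l → ∀ S : Submodule (AdjoinRoot f) (Fin l → AdjoinRoot f),
        ∃ D : Submodule (AdjoinRoot f) (Fin l → AdjoinRoot f),
          (D : Set (Fin l → AdjoinRoot f)) =
            FdualSet hf.ne_zero (S : Set (Fin l → AdjoinRoot f)))
    {l : ℕ} (hl : 1 ≤ l) (u w : Fin l → AdjoinRoot f)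
    (h : ∀ a, ∑ i, coeffDot hf (u i) (a * w i) = 0) (a : AdjoinRoot f) :
    ∑ i, coeffDot hf (root f * u i) (a * w i) = 0 := by
  obtain ⟨D, hD⟩ := H l hl (Submodule.span _ {w})
  have hu : u ∈ D := by
    rw [← SetLike.mem_coe, hD, mem_FdualSet_iff hf]
    intro c hc
    obtain ⟨b, rfl⟩ := Submodule.mem_span_singleton.1 hc
    simpa using h b
  have hxu := D.smul_mem (root f) hu
  rw [← SetLike.mem_coe, hD, mem_FdualSet_iff hf] at hxu
  simpa using hxu (a • w) (Submodule.smul_mem _ _ (Submodule.mem_span_singleton_self w))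

theorem coeffDot_root_mul_root_pow (hf : f.Monic) {i : ℕ} (hi : i + 1 < f.natDegree)
    (a : AdjoinRoot f) : coeffDot hf (root f * root f ^ i) a = reprCoeff hf (i + 1) a := by
  rw [← pow_succ', coeffDot_root_pow_left hf hi]

theorem coeffDot_root_mul_root_pow_last (hf : f.Monic) (hm : 1 ≤ f.natDegree) {j : ℕ}
    (hj : j < f.natDegree) :
    coeffDot hf (root f * root f ^ (f.natDegree - 1)) (root f ^ j) = -f.coeff j := by
  rw [coeffDot_comm, coeffDot_root_pow_left hf hj, reprCoeff_root_mul hf hm,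
    reprCoeff_root_pow hf (by omega), reprCoeff_root_pow hf (by omega)]
  have : ¬ (j ≠ 0 ∧ j - 1 = f.natDegree - 1) := by omega
  split_ifs <;> simp_all

theorem coeff_relation_zero (hf : f.Monic) (hm : 2 ≤ f.natDegree)
    (H : ∀ l : ℕ, 1 ≤ l → ∀ S : Submodule (AdjoinRoot f) (Fin l → AdjoinRoot f),
        ∃ D : Submodule (AdjoinRoot f) (Fin l → AdjoinRoot f),
          (D : Set (Fin l → AdjoinRoot f)) =
            FdualSet hf.ne_zero (S : Set (Fin l → AdjoinRoot f)))
    {j : ℕ} (hj : j < f.natDegree) :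
    (if j = 0 then 1 else 0) - f.coeff 1 * (if j = f.natDegree - 1 then 1 else 0) -
      f.coeff 0 * f.coeff j = 0 := by
  have h := sum_coeffDot_root_mul_eq_zero hf H (l := 2) (by omega)
    ![root f ^ 0, f.coeff 0 • root f ^ (f.natDegree - 1)] ![root f, 1] (fun a => by
      rw [Fin.sum_univ_two]
      simp only [Matrix.cons_val_zero, Matrix.cons_val_one, mul_one]
      rw [coeffDot_smul_left, coeffDot_root_pow_left hf (by omega),
        coeffDot_root_pow_left hf (by omega), mul_comm a, reprCoeff_root_mul hf (by omega)]
      simp) (root f ^ j)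
  rw [Fin.sum_univ_two] at h
  simp only [Matrix.cons_val_zero, Matrix.cons_val_one, mul_one] at h
  rw [mul_smul_comm, coeffDot_smul_left, coeffDot_root_mul_root_pow hf (by omega),
    coeffDot_root_mul_root_pow_last hf (by omega) hj, mul_comm (root f ^ j),
    reprCoeff_root_mul hf (by omega), reprCoeff_root_pow hf hj, reprCoeff_root_pow hf hj] at h
  simp only [zero_add, one_ne_zero, if_false, Nat.sub_self, eq_comm (b := j)] at h
  linear_combination h

theorem coeff_relation_succ (hf : f.Monic)
    (H : ∀ l : ℕ, 1 ≤ l → ∀ S : Submodule (AdjoinRoot f) (Fin l → AdjoinRoot f),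
        ∃ D : Submodule (AdjoinRoot f) (Fin l → AdjoinRoot f),
          (D : Set (Fin l → AdjoinRoot f)) =
            FdualSet hf.ne_zero (S : Set (Fin l → AdjoinRoot f)))
    {i j : ℕ} (hi : i + 2 < f.natDegree) (hj : j < f.natDegree) :
    f.coeff (i + 2) * (if j = f.natDegree - 1 then 1 else 0) +
      f.coeff (i + 1) * f.coeff j = 0 := by
  have h := sum_coeffDot_root_mul_eq_zero hf H (l := 3) (by omega)
    ![root f ^ i, (-1 : F) • root f ^ (i + 1), (-f.coeff (i + 1)) • root f ^ (f.natDegree - 1)]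
    ![1, root f, 1] (fun a => by
      rw [Fin.sum_univ_three]
      simp only [Matrix.cons_val, mul_one]
      rw [coeffDot_smul_left, coeffDot_smul_left, coeffDot_root_pow_left hf (by omega),
        coeffDot_root_pow_left hf (by omega), coeffDot_root_pow_left hf (by omega), mul_comm a,
        reprCoeff_root_mul hf (by omega)]
      simp) (root f ^ j)
  rw [Fin.sum_univ_three] at h
  simp only [Matrix.cons_val, mul_one] at h
  rw [mul_smul_comm, mul_smul_comm, coeffDot_smul_left, coeffDot_smul_left,
    coeffDot_root_mul_root_pow hf (by omega), coeffDot_root_mul_root_pow hf (by omega),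
    coeffDot_root_mul_root_pow_last hf (by omega) hj, mul_comm (root f ^ j),
    reprCoeff_root_mul hf (by omega), reprCoeff_root_pow hf hj, reprCoeff_root_pow hf hj] at h
  simp only [Nat.add_eq_zero_iff, one_ne_zero, and_false, if_false, Nat.add_sub_cancel,
    eq_comm (b := j)] at h
  rw [reprCoeff_root_pow hf hj] at h
  simp only [eq_comm (b := j)] at h
  linear_combination h

/-- In degree at most two, with constant coefficient `-1` in degree two, multiplication by the
root is self-adjoint. -/
theorem coeffDot_root_mul_comm (hf : f.Monic)
    (h : f.natDegree = 1 ∨ f.natDegree = 2 ∧ f.coeff 0 = -1) (u c : AdjoinRoot f) :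
    coeffDot hf (root f * u) c = coeffDot hf u (root f * c) := by
  rcases h with h | ⟨h, h0⟩ <;>
    simp [coeffDot, h, Finset.sum_range_succ, reprCoeff_root_mul hf (by omega : 1 ≤ f.natDegree)]
  · ring
  · rw [h0]
    ring

end AdjoinRoot

/-- The `F`-dual of every `A`-code is an `A`-code iff `m = 1`, or `m = 2` and
`f = x² + a·x - 1` for some `a ∈ F`, or `m ≥ 2` and `f = xᵐ ± 1`. -/
theorem Fdual_is_code_iff {F : Type*} [Field F] [Fintype F]
    (f : F[X]) (hf : f.Monic) (hm : 1 ≤ f.natDegree) :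
    (∀ l : ℕ, 1 ≤ l → ∀ Co : Submodule (AdjoinRoot f) (Fin l → AdjoinRoot f),
        ∃ D : Submodule (AdjoinRoot f) (Fin l → AdjoinRoot f),
          (D : Set (Fin l → AdjoinRoot f)) =
            FdualSet hf.ne_zero (Co : Set (Fin l → AdjoinRoot f))) ↔
    (f.natDegree = 1 ∨
      (f.natDegree = 2 ∧ ∃ a : F, f = X ^ 2 + Polynomial.C a * X - 1) ∨
      (2 ≤ f.natDegree ∧ (f = X ^ f.natDegree - 1 ∨ f = X ^ f.natDegree + 1))) := by
  refine ⟨fun H => ?_, ?_⟩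
  · rcases hm.eq_or_lt with h1 | h2
    · exact Or.inl h1.symm
    right
    have hz : f.coeff 0 * f.coeff 0 = 1 := by
      have := AdjoinRoot.coeff_relation_zero hf h2 H (j := 0) (by omega)
      rw [if_pos rfl, if_neg (by omega)] at this
      linear_combination -this
    have hsum := hf.as_sum
    rcases (show 2 ≤ f.natDegree from h2).eq_or_lt with h2' | h3
    · have h1 := AdjoinRoot.coeff_relation_zero hf h2 H (j := 1) h2
      rw [if_neg one_ne_zero, if_pos (by omega)] at h1
      simp only [← h2', Finset.sum_range_succ, Finset.sum_range_zero, zero_add, pow_zero, pow_one,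
        mul_one] at hsum
      rcases mul_self_eq_one_iff.1 hz with h0 | h0
      · by_cases hc : f.coeff 1 = 0
        · refine Or.inr ⟨h2, Or.inr ?_⟩
          rw [← h2']
          simpa [h0, hc] using hsum
        · refine Or.inl ⟨h2'.symm, f.coeff 1, ?_⟩
          have h0' : f.coeff 0 = -1 :=
            mul_right_cancel₀ hc (by linear_combination -h1)
          rw [h0', C_neg, C_1] at hsum
          linear_combination hsum
      · refine Or.inl ⟨h2'.symm, f.coeff 1, ?_⟩
        rw [h0, C_neg, C_1] at hsum
        linear_combination hsum
    · have hmid (i : ℕ) (hi : i + 2 < f.natDegree) : f.coeff (i + 1) = 0 := by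
        have := AdjoinRoot.coeff_relation_succ hf H hi (j := i + 1) (by omega)
        rw [if_neg (by omega)] at this
        simpa using this
      have hlow (i : ℕ) (hi : i < f.natDegree) (hi0 : i ≠ 0) : f.coeff i = 0 := by
        obtain ⟨k, rfl⟩ := Nat.exists_eq_succ_of_ne_zero hi0
        rcases Nat.lt_or_ge (k + 2) f.natDegree with hk | hk
        · exact hmid k hk
        · obtain ⟨n, rfl⟩ : ∃ n, k = n + 1 := ⟨k - 1, by omega⟩
          have := AdjoinRoot.coeff_relation_succ hf H (i := n) (j := n + 2) hi hi
          rw [if_pos (by omega), hmid n hi] at this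
          simpa using this
      rw [Finset.sum_eq_single_of_mem 0 (Finset.mem_range.2 (by omega)) fun i hi hi0 => by
        rw [hlow i (Finset.mem_range.1 hi) hi0]; simp] at hsum
      refine Or.inr ⟨h2, ?_⟩
      rcases mul_self_eq_one_iff.1 hz with h0 | h0 <;> rw [h0] at hsum
      · exact Or.inr (by simpa using hsum)
      · exact Or.inl (by simpa [sub_eq_add_neg] using hsum)
  · intro h l _ S
    have ht : ∃ t, ∀ u c, AdjoinRoot.coeffDot hf (AdjoinRoot.root f * u) c =
        AdjoinRoot.coeffDot hf u (t * c) := by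
      rcases h with h | ⟨h, a, ha⟩ | ⟨-, h | h⟩
      · exact ⟨_, AdjoinRoot.coeffDot_root_mul_comm hf (Or.inl h)⟩
      · exact ⟨_, AdjoinRoot.coeffDot_root_mul_comm hf (Or.inr ⟨h, by rw [ha]; simp⟩)⟩
      · exact AdjoinRoot.exists_adjoint_root_of_isometry hf hm (ε := 1) (by simp) (by simpa using h)
      · exact AdjoinRoot.exists_adjoint_root_of_isometry hf hm (ε := -1) (by simp) (by simpa using h)
    obtain ⟨t, ht⟩ := ht
    exact AdjoinRoot.exists_submodule_eq_FdualSet hf ht S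
end

section
/- One has C^⊥ = C^{⊥_F} for every l ≥ 1 and every A-code C ⊆ A^l if and only if m = 1, or m = 2 and f = x² + a·x − 1 for some a ∈ F. -/
open Polynomial

/-- If a linear functional `φ` makes a basis orthonormal for the form `(u, c) ↦ φ (u * c)`, then
this form is the standard dot product in coordinates. -/
theorem Module.Basis.sum_repr_mul_repr_eq {K A ι : Type*} [Field K] [CommRing A] [Algebra K A]
    [Fintype ι] [DecidableEq ι] (b : Module.Basis ι K A) (φ : A →ₗ[K] K)
    (h : ∀ i j, φ (b i * b j) = if i = j then 1 else 0) (u c : A) :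
    ∑ n, b.repr u n * b.repr c n = φ (u * c) := by
  conv_rhs => rw [← b.sum_repr u, ← b.sum_repr c, Finset.sum_mul_sum]
  simp [h, mul_comm]

/-- The dot product of the coordinates against a basis vector reads off a coordinate. -/
theorem Module.Basis.sum_repr_mul_repr_self {K A ι : Type*} [Field K] [AddCommGroup A]
    [Module K A] [Fintype ι] (b : Module.Basis ι K A) (u : A) (i : ι) :
    ∑ n, b.repr u n * b.repr (b i) n = b.repr u i := by
  classical
  simp [Finsupp.single_apply]

/-- If the dot product of coordinates is induced by a functional on the ring, then the two notions
of dual agree on every code. -/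
theorem dualSet_eq_FdualSet_of_form {F : Type*} [Field F] {f : F[X]} (hf : f ≠ 0)
    (φ : AdjoinRoot f →ₗ[F] F)
    (h : ∀ u c, ∑ n, (AdjoinRoot.powerBasis hf).basis.repr u n *
      (AdjoinRoot.powerBasis hf).basis.repr c n = φ (u * c))
    {l : ℕ} (Co : Submodule (AdjoinRoot f) (Fin l → AdjoinRoot f)) :
    dualSet (Co : Set (Fin l → AdjoinRoot f)) =
      FdualSet hf (Co : Set (Fin l → AdjoinRoot f)) := by
  ext u
  simp only [dualSet, FdualSet, Set.mem_ofPred_eq, SetLike.mem_coe, h, ← map_sum]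
  refine ⟨fun hu c hc => by rw [hu c hc, map_zero], fun hu c hc => ?_⟩
  refine (AdjoinRoot.powerBasis hf).basis.ext_elem fun i => ?_
  rw [← Module.Basis.sum_repr_mul_repr_self, h, map_zero, Finsupp.zero_apply, Finset.sum_mul]
  have := hu _ (Co.smul_mem ((AdjoinRoot.powerBasis hf).basis i) hc)
  simpa [mul_comm, mul_left_comm, mul_assoc] using this

/-- If the dual of every code of length two is contained in its `F`-dual, then multiplication by
every element is self-adjoint for the dot product of coordinates. -/
theorem sum_repr_mul_eq_of_dualSet_subset {F : Type*} [Field F] {f : F[X]} (hf : f ≠ 0)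
    (h : ∀ Co : Submodule (AdjoinRoot f) (Fin 2 → AdjoinRoot f),
      dualSet (Co : Set (Fin 2 → AdjoinRoot f)) ⊆
        FdualSet hf (Co : Set (Fin 2 → AdjoinRoot f))) (r u c : AdjoinRoot f) :
    ∑ n, (AdjoinRoot.powerBasis hf).basis.repr (r * u) n *
        (AdjoinRoot.powerBasis hf).basis.repr c n =
      ∑ n, (AdjoinRoot.powerBasis hf).basis.repr u n *
        (AdjoinRoot.powerBasis hf).basis.repr (r * c) n := by
  have hmem : ![-(r * u), u] ∈ dualSet (Submodule.span (AdjoinRoot f) {![1, r]} :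
      Set (Fin 2 → AdjoinRoot f)) := by
    intro d hd
    obtain ⟨a, rfl⟩ := Submodule.mem_span_singleton.mp hd
    simp only [Fin.sum_univ_two, Pi.smul_apply, smul_eq_mul, Matrix.cons_val_zero,
      Matrix.cons_val_one]
    ring
  have := h _ hmem (c • ![1, r])
    (Submodule.smul_mem _ _ (Submodule.mem_span_singleton_self _))
  simp only [Fin.sum_univ_two, Pi.smul_apply, smul_eq_mul, Matrix.cons_val_zero,
    Matrix.cons_val_one, mul_one, map_neg, Finsupp.neg_apply, neg_mul,
    Finset.sum_neg_distrib, mul_comm c r] at this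
  exact (neg_add_eq_zero.mp this)

/-- The `A`-dual and the `F`-dual of every `A`-code coincide iff `m = 1`, or `m = 2` and
`f = x² + a·x - 1` for some `a ∈ F`. -/
theorem Adual_eq_Fdual_iff {F : Type*} [Field F] [Fintype F]
    (f : F[X]) (hf : f.Monic) (hm : 1 ≤ f.natDegree) :
    (∀ l : ℕ, 1 ≤ l → ∀ Co : Submodule (AdjoinRoot f) (Fin l → AdjoinRoot f),
        dualSet (Co : Set (Fin l → AdjoinRoot f)) =
          FdualSet hf.ne_zero (Co : Set (Fin l → AdjoinRoot f))) ↔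
    (f.natDegree = 1 ∨
      (f.natDegree = 2 ∧ ∃ a : F, f = X ^ 2 + Polynomial.C a * X - 1)) := by
  set b := (AdjoinRoot.powerBasis hf.ne_zero).basis with hb_def
  have hdim : (AdjoinRoot.powerBasis hf.ne_zero).dim = f.natDegree := rfl
  have hb : ∀ i, b i = AdjoinRoot.root f ^ (i : ℕ) := fun i => by
    rw [hb_def, PowerBasis.coe_basis, AdjoinRoot.powerBasis_gen]
  constructor
  · intro h
    have adj := sum_repr_mul_eq_of_dualSet_subset hf.ne_zero fun Co => (h 2 one_le_two Co).le
    rcases hm.eq_or_lt with h1 | h2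
    · exact Or.inl h1.symm
    right
    have key : b.repr (AdjoinRoot.root f ^ 2) ⟨0, by omega⟩ = 1 := by
      have := adj (AdjoinRoot.root f) (b ⟨1, by omega⟩) (b ⟨0, by omega⟩)
      rw [← hb_def, Module.Basis.sum_repr_mul_repr_self] at this
      have e : AdjoinRoot.root f * b ⟨0, by omega⟩ = b ⟨1, by omega⟩ := by simp [hb]
      rw [e, Module.Basis.sum_repr_mul_repr_self] at this
      have e2 : AdjoinRoot.root f * b ⟨1, by omega⟩ = AdjoinRoot.root f ^ 2 := by
        simp [hb, sq]
      rw [e2] at this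
      simpa using this
    have hd : f.natDegree = 2 := by
      by_contra hne
      have e : AdjoinRoot.root f ^ 2 = b ⟨2, by omega⟩ := by simp [hb]
      rw [e] at key
      simp at key
    refine ⟨hd, f.coeff 1, ?_⟩
    have hfX : f = X ^ 2 + C (f.coeff 1) * X + C (f.coeff 0) := by
      conv_lhs => rw [hf.as_sum, hd]
      simp only [Finset.sum_range_succ, Finset.sum_range_zero, pow_zero, pow_one, mul_one]
      ring
    have hroot : AdjoinRoot.root f ^ 2 =
        (-f.coeff 1) • b ⟨1, by omega⟩ + (-f.coeff 0) • b ⟨0, by omega⟩ := by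
      have e : AdjoinRoot.mk f (X ^ 2 + C (f.coeff 1) * X + C (f.coeff 0)) = 0 := by
        rw [← hfX, AdjoinRoot.mk_self]
      simp only [map_add, map_mul, map_pow, AdjoinRoot.mk_X, AdjoinRoot.mk_C] at e
      simp only [hb, pow_one, pow_zero, Algebra.smul_def, AdjoinRoot.algebraMap_eq, map_neg]
      linear_combination e
    rw [hroot] at key
    have h0 : f.coeff 0 = -1 := by
      simp at key
      linear_combination -key
    conv_lhs => rw [hfX, h0]
    simp [sub_eq_add_neg]
  · intro h l _ Co
    refine dualSet_eq_FdualSet_of_form hf.ne_zero (b.coord ⟨0, by omega⟩)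
      (b.sum_repr_mul_repr_eq _ ?_) Co
    rcases h with h | ⟨h, a, ha⟩
    · intro i j
      have hi : i = ⟨0, by omega⟩ := Fin.ext (by have := i.2; simp only; omega)
      have hj : j = ⟨0, by omega⟩ := Fin.ext (by have := j.2; simp only; omega)
      have e : b ⟨0, by omega⟩ * b ⟨0, by omega⟩ = b ⟨0, by omega⟩ := by simp [hb]
      rw [hi, hj, e]
      simp
    · have hcase : ∀ i : Fin (AdjoinRoot.powerBasis hf.ne_zero).dim,
          i = ⟨0, by omega⟩ ∨ i = ⟨1, by omega⟩ := fun i => by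
        have := i.2
        simp only [Fin.ext_iff]
        omega
      have e00 : b ⟨0, by omega⟩ * b ⟨0, by omega⟩ = b ⟨0, by omega⟩ := by simp [hb]
      have e01 : b ⟨0, by omega⟩ * b ⟨1, by omega⟩ = b ⟨1, by omega⟩ := by simp [hb]
      have e10 : b ⟨1, by omega⟩ * b ⟨0, by omega⟩ = b ⟨1, by omega⟩ := by simp [hb]
      have e11 : b ⟨1, by omega⟩ * b ⟨1, by omega⟩ =
          (-a) • b ⟨1, by omega⟩ + b ⟨0, by omega⟩ := by
        have e : AdjoinRoot.mk f (X ^ 2 + C a * X - 1) = 0 := by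
          rw [← ha, AdjoinRoot.mk_self]
        simp only [map_add, map_sub, map_mul, map_pow, map_one, AdjoinRoot.mk_X,
          AdjoinRoot.mk_C] at e
        simp only [hb, pow_one, pow_zero, Algebra.smul_def, AdjoinRoot.algebraMap_eq, map_neg]
        linear_combination e
      intro i j
      rcases hcase i with rfl | rfl <;> rcases hcase j with rfl | rfl
      · rw [e00]; simp
      · rw [e01]; simp
      · rw [e10]; simp
      · rw [e11]; simp
end
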